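/- Let X₁ = {(x,y,z) ∈ ℂ³ : (y³ − z²x)(y³ + z²x) + (x+y+z)⁷ = 0} and X₂ = {(x,y,z) ∈ ℂ³ : (y³ − z²x)(y³ + 2z²x) + (x+y+z)⁷ = 0}. Then (X₁,0) and (X₂,0) are inner bilipschitz equivalent: there exist open neighborhoods U₁, U₂ of 0 in ℂ³, a homeomorphism φ : X₁ ∩ U₁ → X₂ ∩ U₂ with φ(0) = 0 and K ≥ 1 with (1/K)·d_{X₁∩U₁}(p,q) ≤ d_{X₂∩U₂}(φ(p),φ(q)) ≤ K·d_{X₁∩U₁}(p,q) for all p, q ∈ X₁ ∩ U₁. -/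

import Mathlib

open scoped Topology ENNReal

noncomputable section

/-- `ℂ³` with the Euclidean (Hermitian) norm. -/
abbrev C3 := EuclideanSpace ℂ (Fin 3)

/-- The inner distance on `Y ⊆ ℂ³`: the infimum of lengths (total Euclidean variation)
of continuous paths in `Y` from `p` to `q`. -/
def innerDist (Y : Set C3) (p q : C3) : ℝ≥0∞ :=
  sInf {L | ∃ γ : ℝ → C3, ContinuousOn γ (Set.Icc 0 1) ∧
    (∀ t ∈ Set.Icc (0 : ℝ) 1, γ t ∈ Y) ∧ γ 0 = p ∧ γ 1 = q ∧
    L = eVariationOn γ (Set.Icc 0 1)}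

/-- The germs `(X₁,0)` and `(X₂,0)` are inner bilipschitz equivalent. -/
def InnerBilipschitzEquiv (X₁ X₂ : Set C3) : Prop :=
  ∃ U₁ U₂ : Set C3, IsOpen U₁ ∧ IsOpen U₂ ∧ (0 : C3) ∈ U₁ ∧ (0 : C3) ∈ U₂ ∧
    ∃ φ : (X₁ ∩ U₁ : Set C3) ≃ₜ (X₂ ∩ U₂ : Set C3),
      (∀ p : (X₁ ∩ U₁ : Set C3), (p : C3) = 0 → (φ p : C3) = 0) ∧
      ∃ K : ℝ, 1 ≤ K ∧ ∀ p q : (X₁ ∩ U₁ : Set C3),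
        ENNReal.ofReal (1 / K) * innerDist (X₁ ∩ U₁) p q ≤
            innerDist (X₂ ∩ U₂) (φ p) (φ q) ∧
        innerDist (X₂ ∩ U₂) (φ p) (φ q) ≤
            ENNReal.ofReal K * innerDist (X₁ ∩ U₁) p q

/-- `X₁ = {(x,y,z) : (y³ − z²x)(y³ + z²x) + (x+y+z)⁷ = 0}`. -/
def XOne : Set C3 :=
  {p | (p 1 ^ 3 - p 2 ^ 2 * p 0) * (p 1 ^ 3 + p 2 ^ 2 * p 0) +
        (p 0 + p 1 + p 2) ^ 7 = 0}

/-- `X₂ = {(x,y,z) : (y³ − z²x)(y³ + 2z²x) + (x+y+z)⁷ = 0}`. -/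
def XTwo : Set C3 :=
  {p | (p 1 ^ 3 - p 2 ^ 2 * p 0) * (p 1 ^ 3 + 2 * p 2 ^ 2 * p 0) +
        (p 0 + p 1 + p 2) ^ 7 = 0}

section Work

open Set Filter

def LipAt {E F : Type*} [NormedAddCommGroup E] [NormedAddCommGroup F] (K : ℝ) (A : Set E)
    (φ : E → F) (p : E) : Prop :=
  ∃ s ∈ 𝓝[A] p, ∀ q ∈ s, ∀ q' ∈ s, ‖φ q - φ q'‖ ≤ K * ‖q - q'‖

def Half {E F : Type*} [NormedAddCommGroup E] [NormedAddCommGroup F] (A : Set E) (B : Set F)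
    (φ : E → F) (ψ : F → E) (K ε : ℝ) : Prop :=
  0 < K ∧ 0 < ε ∧ ∀ p ∈ A, ‖p‖ < ε → φ p ∈ B ∧ ψ (φ p) = p ∧ ‖φ p‖ ≤ K * ‖p‖ ∧
    (p ≠ 0 → LipAt K A φ p)

def GermEq {E F : Type*} [NormedAddCommGroup E] [NormedAddCommGroup F] (A : Set E) (B : Set F) :
    Prop :=
  ∃ (φ : E → F) (ψ : F → E), (∃ K ε, Half A B φ ψ K ε) ∧ (∃ K ε, Half B A ψ φ K ε)

section
variable {E F G : Type*} [NormedAddCommGroup E] [NormedAddCommGroup F] [NormedAddCommGroup G]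

theorem GermEq.symm {A : Set E} {B : Set F} (h : GermEq A B) : GermEq B A := by
  obtain ⟨φ, ψ, h1, h2⟩ := h
  exact ⟨ψ, φ, h2, h1⟩

theorem LipAt.cont {K : ℝ} {A : Set E} {φ : E → F} {p : E} (hp : p ∈ A) (h : LipAt K A φ p) :
    ContinuousWithinAt φ A p := by
  obtain ⟨s, hs, h⟩ := h
  have hps : p ∈ s := mem_of_mem_nhdsWithin hp hs
  rw [ContinuousWithinAt, tendsto_iff_norm_sub_tendsto_zero]
  have h0 : Tendsto (fun q => K * ‖q - p‖) (𝓝[A] p) (𝓝 0) := by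
    have : Continuous (fun q : E => K * ‖q - p‖) := by fun_prop
    have := (this.tendsto p).mono_left (nhdsWithin_le_nhds (s := A))
    simpa using this
  refine squeeze_zero' (Eventually.of_forall fun _ => norm_nonneg _) ?_ h0
  filter_upwards [hs] with q hq using h q hq p hps

theorem LipAt.comp {K L : ℝ} (hL : 0 ≤ L) {A : Set E} {B : Set F} {φ : E → F} {χ : F → G} {p : E}
    (hp : p ∈ A) (h : LipAt K A φ p) (hm : ∀ᶠ q in 𝓝[A] p, φ q ∈ B) (h2 : LipAt L B χ (φ p)) :
    LipAt (L * K) A (χ ∘ φ) p := by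
  have hc := h.cont hp
  obtain ⟨s, hs, h⟩ := h
  obtain ⟨t, ht, h2⟩ := h2
  have : Tendsto φ (𝓝[A] p) (𝓝[B] (φ p)) := tendsto_nhdsWithin_iff.2 ⟨hc, hm⟩
  refine ⟨s ∩ φ ⁻¹' t, inter_mem hs (this ht), ?_⟩
  rintro q ⟨hq, hq2⟩ q' ⟨hq', hq2'⟩
  calc _ ≤ L * ‖φ q - φ q'‖ := h2 _ hq2 _ hq2'
    _ ≤ L * (K * ‖q - q'‖) := by gcongr; exact h _ hq _ hq'
    _ = _ := by ring

theorem Half.comp {A : Set E} {B : Set F} {C : Set G} {φ1 : E → F} {ψ1 : F → E} {φ2 : F → G}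
    {ψ2 : G → F} {K1 K2 ε1 ε2 : ℝ} (h1 : Half A B φ1 ψ1 K1 ε1) (h2 : Half B C φ2 ψ2 K2 ε2)
    (h0 : (0:F) ∈ B → ψ1 0 = 0) :
    Half A C (φ2 ∘ φ1) (ψ1 ∘ ψ2) (K2 * K1) (min ε1 (ε2 / K1)) := by
  obtain ⟨hK1, he1, h1⟩ := h1
  obtain ⟨hK2, he2, h2⟩ := h2
  refine ⟨by positivity, by positivity, fun p hp hpn => ?_⟩
  have hp1 : ‖p‖ < ε1 := lt_of_lt_of_le hpn (min_le_left _ _)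
  have hp2 : K1 * ‖p‖ < ε2 := by
    have := lt_of_lt_of_le hpn (min_le_right _ _)
    rwa [lt_div_iff₀ hK1, mul_comm] at this
  obtain ⟨a1, a2, a3, a4⟩ := h1 p hp hp1
  obtain ⟨b1, b2, b3, b4⟩ := h2 _ a1 (a3.trans_lt hp2)
  refine ⟨b1, by simp [b2, a2], ?_, fun hp0 => ?_⟩
  · calc _ ≤ K2 * ‖φ1 p‖ := b3
      _ ≤ K2 * (K1 * ‖p‖) := by gcongr
      _ = _ := by ring
  · have hφ0 : φ1 p ≠ 0 := by
      intro h
      apply hp0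
      rw [← a2, h, h0 (h ▸ a1)]
    refine LipAt.comp hK2.le hp (a4 hp0) ?_ (b4 hφ0)
    filter_upwards [self_mem_nhdsWithin, mem_nhdsWithin_of_mem_nhds
      (continuous_norm.continuousAt.eventually_lt_const hp1)] with q hq hq1
    exact (h1 q hq hq1).1

theorem Half.zero {A : Set E} {B : Set F} {φ : E → F} {ψ : F → E} {K ε : ℝ}
    (h : Half A B φ ψ K ε) (h0 : (0:E) ∈ A) : φ 0 = 0 := by
  have := (h.2.2 0 h0 (by simpa using h.2.1)).2.2.1
  simpa using this

theorem GermEq.trans {A : Set E} {B : Set F} {C : Set G} (h1 : GermEq A B) (h2 : GermEq B C) :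
    GermEq A C := by
  obtain ⟨φ1, ψ1, ⟨K1, ε1, a1⟩, ⟨L1, δ1, b1⟩⟩ := h1
  obtain ⟨φ2, ψ2, ⟨K2, ε2, a2⟩, ⟨L2, δ2, b2⟩⟩ := h2
  exact ⟨φ2 ∘ φ1, ψ1 ∘ ψ2, ⟨_, _, a1.comp a2 b1.zero⟩, ⟨_, _, b2.comp b1 a2.zero⟩⟩

theorem LipAt.mono {K L : ℝ} (hKL : K ≤ L) {A : Set E} {φ : E → F} {p : E} (h : LipAt K A φ p) :
    LipAt L A φ p := by
  obtain ⟨s, hs, h⟩ := h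
  exact ⟨s, hs, fun q hq q' hq' => (h q hq q' hq').trans (by gcongr)⟩

theorem Half.contOn {A : Set E} {B : Set F} {φ : E → F} {ψ : F → E} {K ε : ℝ}
    (h : Half A B φ ψ K ε) : ContinuousOn φ (A ∩ Metric.ball 0 ε) := by
  rintro p ⟨hpA, hp⟩
  have hp' : ‖p‖ < ε := by simpa using hp
  by_cases hp0 : p = 0
  · subst hp0
    rw [ContinuousWithinAt, h.zero hpA, tendsto_zero_iff_norm_tendsto_zero]
    have h0 : Tendsto (fun q => K * ‖q‖) (𝓝[A ∩ Metric.ball 0 ε] (0:E)) (𝓝 0) := by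
      have : Continuous (fun q : E => K * ‖q‖) := by fun_prop
      have := (this.tendsto 0).mono_left (nhdsWithin_le_nhds (s := A ∩ Metric.ball 0 ε))
      simpa using this
    refine squeeze_zero' (Eventually.of_forall fun _ => norm_nonneg _) ?_ h0
    filter_upwards [self_mem_nhdsWithin] with q hq
    exact (h.2.2 q hq.1 (by simpa using hq.2)).2.2.1
  · exact (((h.2.2 p hpA hp').2.2.2 hp0).cont hpA).mono inter_subset_left

theorem path_edist {A : Set E} {B : Set F} {φ : E → F} {ψ : F → E} {K ε : ℝ}
    (h : Half A B φ ψ K ε) {γ : ℝ → E} {s t : ℝ} (hst : s ≤ t) (hγ : ContinuousOn γ (Icc s t))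
    (hA : ∀ u ∈ Icc s t, γ u ∈ A ∧ ‖γ u‖ < ε) :
    edist (φ (γ s)) (φ (γ t)) ≤ ENNReal.ofReal K * eVariationOn γ (Icc s t) := by
  have hK := h.1
  by_cases hz : ∃ u ∈ Icc s t, γ u = 0
  · obtain ⟨u, hu, hu0⟩ := hz
    have key : ∀ v ∈ Icc s t, ∀ S : Set ℝ, v ∈ S → u ∈ S → edist (φ (γ v)) 0 ≤
        ENNReal.ofReal K * eVariationOn γ S := by
      intro v hv S hvS huS
      calc edist (φ (γ v)) 0 ≤ ENNReal.ofReal K * edist (γ v) (γ u) := by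
            rw [edist_dist, edist_dist, hu0, dist_zero_right, dist_zero_right,
              ← ENNReal.ofReal_mul hK.le]
            exact ENNReal.ofReal_le_ofReal (h.2.2 _ (hA v hv).1 (hA v hv).2).2.2.1
        _ ≤ _ := by gcongr; exact eVariationOn.edist_le _ hvS huS
    calc _ ≤ edist (φ (γ s)) 0 + edist 0 (φ (γ t)) := edist_triangle _ _ _
      _ ≤ ENNReal.ofReal K * eVariationOn γ (Icc s u) + ENNReal.ofReal K * eVariationOn γ (Icc u t) := by
          rw [edist_comm 0]
          exact add_le_add (key s ⟨le_rfl, hst⟩ _ ⟨le_rfl, hu.1⟩ ⟨hu.1, le_rfl⟩)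
            (key t ⟨hst, le_rfl⟩ _ ⟨hu.2, le_rfl⟩ ⟨le_rfl, hu.2⟩)
      _ = _ := by
          rw [← mul_add]
          have := eVariationOn.Icc_add_Icc γ (s := univ) hu.1 hu.2 (mem_univ _)
          simp only [univ_inter] at this
          rw [this]
  · push Not at hz
    have hl : ∀ u : Icc s t, ∃ W : Set (Icc s t), IsOpen W ∧ u ∈ W ∧ ∀ a ∈ W, ∀ b ∈ W,
        edist (φ (γ a)) (φ (γ b)) ≤ ENNReal.ofReal K * edist (γ a) (γ b) := by
      intro u
      obtain ⟨S, hS, hL⟩ := (h.2.2 _ (hA u u.2).1 (hA u u.2).2).2.2.2 (hz u u.2)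
      have hc : Tendsto (fun v : Icc s t => γ v) (𝓝 u) (𝓝[A] (γ u)) :=
        tendsto_nhdsWithin_iff.2 ⟨(continuousOn_iff_continuous_domRestrict.1 hγ).continuousAt,
          Eventually.of_forall fun v => (hA v v.2).1⟩
      obtain ⟨W, hW, hWo, huW⟩ := mem_nhds_iff.1 (hc hS)
      refine ⟨W, hWo, huW, fun a ha b hb => ?_⟩
      rw [edist_dist, edist_dist, dist_eq_norm, dist_eq_norm, ← ENNReal.ofReal_mul hK.le]
      exact ENNReal.ofReal_le_ofReal (hL _ (hW ha) _ (hW hb))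
    choose W hWo huW hW using hl
    obtain ⟨T, hT0, hTm, ⟨m, hm⟩, hTW⟩ := exists_monotone_Icc_subset_open_cover_Icc hst hWo
      (fun u _ => mem_iUnion.2 ⟨u, huW u⟩)
    have ind : ∀ n, edist (φ (γ s)) (φ (γ (T n))) ≤
        ENNReal.ofReal K * eVariationOn γ (Icc s (T n)) := by
      intro n
      induction n with
      | zero => simp [hT0]
      | succ n ih =>
        obtain ⟨i, hi⟩ := hTW n
        have hle : T n ≤ T (n+1) := hTm (Nat.le_succ n)
        have e1 := hW i _ (hi ⟨le_rfl, hle⟩) _ (hi ⟨hle, le_rfl⟩)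
        have hle' : (T n : ℝ) ≤ T (n+1) := hle
        have e2 := eVariationOn.Icc_add_Icc γ (s := univ) (T n).2.1 hle' (mem_univ _)
        simp only [univ_inter] at e2
        calc _ ≤ _ := edist_triangle _ (φ (γ (T n))) _
          _ ≤ ENNReal.ofReal K * eVariationOn γ (Icc s (T n)) +
              ENNReal.ofReal K * eVariationOn γ (Icc (T n : ℝ) (T (n+1))) := by
            refine add_le_add ih (e1.trans ?_)
            gcongr
            exact eVariationOn.edist_le _ ⟨le_rfl, hle'⟩ ⟨hle', le_rfl⟩
          _ = _ := by rw [← mul_add, e2]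
    have := ind m
    rwa [hm m le_rfl] at this

theorem path_var {A : Set E} {B : Set F} {φ : E → F} {ψ : F → E} {K ε : ℝ}
    (h : Half A B φ ψ K ε) {γ : ℝ → E} (hγ : ContinuousOn γ (Icc 0 1))
    (hA : ∀ u ∈ Icc (0:ℝ) 1, γ u ∈ A ∧ ‖γ u‖ < ε) :
    eVariationOn (φ ∘ γ) (Icc 0 1) ≤ ENNReal.ofReal K * eVariationOn γ (Icc 0 1) := by
  refine iSup_le ?_
  rintro ⟨n, u, hu, hus⟩
  calc _ ≤ ∑ i ∈ Finset.range n, ENNReal.ofReal K * eVariationOn γ (Icc (u i) (u (i+1))) := by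
        refine Finset.sum_le_sum fun i _ => ?_
        rw [edist_comm]
        have hsub : Icc (u i) (u (i+1)) ⊆ Icc 0 1 := Icc_subset_Icc (hus i).1 (hus (i+1)).2
        exact path_edist h (hu (Nat.le_succ i)) (hγ.mono hsub) fun v hv => hA v (hsub hv)
    _ = ENNReal.ofReal K * eVariationOn γ (Icc (u 0) (u n)) := by
        rw [← Finset.mul_sum, eVariationOn.sum' γ hu]
    _ ≤ _ := by
        gcongr
        exact eVariationOn.mono _ (Icc_subset_Icc (hus 0).1 (hus n).2)

end

theorem innerDist_le {A B U V : Set C3} {φ ψ : C3 → C3} {K ε : ℝ}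
    (h : Half A B φ ψ K ε) (hU : U ⊆ Metric.ball 0 ε) (hm : ∀ p ∈ A ∩ U, φ p ∈ B ∩ V)
    (p q : C3) : innerDist (B ∩ V) (φ p) (φ q) ≤ ENNReal.ofReal K * innerDist (A ∩ U) p q := by
  have hK0 : ENNReal.ofReal K ≠ 0 := by simpa using h.1
  have hKt : ENNReal.ofReal K ≠ ⊤ := ENNReal.ofReal_ne_top
  rw [mul_comm, ← ENNReal.div_le_iff hK0 hKt]
  refine le_sInf ?_
  rintro L ⟨γ, h1, h2, h3, h4, rfl⟩
  rw [ENNReal.div_le_iff hK0 hKt, mul_comm]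
  refine le_trans (sInf_le ?_) (path_var h h1 fun u hu => ⟨(h2 u hu).1, by simpa using hU (h2 u hu).2⟩)
  refine ⟨φ ∘ γ, ?_, fun t ht => hm _ (h2 t ht), by simp [h3], by simp [h4], rfl⟩
  exact h.contOn.comp h1 fun t ht => ⟨(h2 t ht).1, hU (h2 t ht).2⟩

theorem GermEq.inner {A B : Set C3} (hA0 : (0:C3) ∈ A) (h : GermEq A B) :
    InnerBilipschitzEquiv A B := by
  obtain ⟨φ, ψ, ⟨K1, ε1, h1⟩, ⟨K2, ε2, h2⟩⟩ := h
  have hK1 := h1.1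
  have he1 := h1.2.1
  have he2 := h2.2.1
  have hφ0 : φ 0 = 0 := h1.zero hA0
  set U : Set C3 := Metric.ball 0 (min ε1 (ε2 / K1)) with hUd
  have hUo : IsOpen U := Metric.isOpen_ball
  have hU1 : U ⊆ Metric.ball 0 ε1 := Metric.ball_subset_ball (min_le_left _ _)
  have hU0 : (0:C3) ∈ U := Metric.mem_ball_self (by positivity)
  obtain ⟨W, hWo, hW⟩ := (continuousOn_iff'.1 h2.contOn) U hUo
  set V : Set C3 := W ∩ Metric.ball 0 ε2 with hV
  have hVo : IsOpen V := hWo.inter Metric.isOpen_ball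
  have hmem : ∀ q ∈ B, ‖q‖ < ε2 → (ψ q ∈ U ↔ q ∈ V) := by
    intro q hq hqn
    have hb : q ∈ Metric.ball (0:C3) ε2 := by simpa using hqn
    have := Set.ext_iff.1 hW q
    simp only [mem_inter_iff, mem_preimage, hq, hb, and_self, and_true, true_and] at this
    rw [this, hV]
    simp [hqn]
  have hφm : ∀ p ∈ A ∩ U, φ p ∈ B ∩ V := by
    rintro p ⟨hp, hpU⟩
    have hpn : ‖p‖ < min ε1 (ε2 / K1) := by simpa [hUd] using hpU
    have hp2 : K1 * ‖p‖ < ε2 := by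
      have := lt_of_lt_of_le hpn (min_le_right _ _)
      rwa [lt_div_iff₀ hK1, mul_comm] at this
    obtain ⟨a1, a2, a3, -⟩ := h1.2.2 p hp (lt_of_lt_of_le hpn (min_le_left _ _))
    refine ⟨a1, (hmem _ a1 (a3.trans_lt hp2)).1 ?_⟩
    rwa [a2]
  have hV2 : V ⊆ Metric.ball 0 ε2 := inter_subset_right
  have hψm : ∀ q ∈ B ∩ V, ψ q ∈ A ∩ U := by
    rintro q ⟨hq, hqV⟩
    have hn : ‖q‖ < ε2 := by simpa using hV2 hqV
    exact ⟨(h2.2.2 q hq hn).1, (hmem q hq hn).2 hqV⟩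
  have hψφ : ∀ p ∈ A ∩ U, ψ (φ p) = p := fun p hp =>
    (h1.2.2 p hp.1 (by simpa using hU1 hp.2)).2.1
  have hφψ : ∀ q ∈ B ∩ V, φ (ψ q) = q := fun q hq =>
    (h2.2.2 q hq.1 (by simpa using hV2 hq.2)).2.1
  have hφc : ContinuousOn φ (A ∩ U) := h1.contOn.mono (inter_subset_inter_right _ hU1)
  have hψc : ContinuousOn ψ (B ∩ V) := h2.contOn.mono (inter_subset_inter_right _ hV2)
  refine ⟨U, V, hUo, hVo, hU0, (hφ0 ▸ (hφm 0 ⟨hA0, hU0⟩)).2,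
    { toFun := fun p => ⟨φ p, hφm p p.2⟩
      invFun := fun q => ⟨ψ q, hψm q q.2⟩
      left_inv := fun p => Subtype.ext (hψφ p p.2)
      right_inv := fun q => Subtype.ext (hφψ q q.2)
      continuous_toFun := (continuousOn_iff_continuous_domRestrict.1 hφc).subtype_mk _
      continuous_invFun := (continuousOn_iff_continuous_domRestrict.1 hψc).subtype_mk _ },
    fun p hp => by
      show φ p = 0
      rw [hp, hφ0], max 1 (max K1 K2), le_max_left _ _, fun p q => ?_⟩
  have e1 : innerDist (B ∩ V) (φ p) (φ q) ≤ ENNReal.ofReal K1 * innerDist (A ∩ U) p q :=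
    innerDist_le h1 hU1 hφm p q
  have e2 := innerDist_le h2 hV2 hψm (φ p) (φ q)
  rw [hψφ p p.2, hψφ q q.2] at e2
  constructor
  · show _ ≤ innerDist (B ∩ V) (φ p) (φ q)
    have hp : 0 < max 1 (max K1 K2) := by positivity
    rw [one_div, ENNReal.ofReal_inv_of_pos hp, mul_comm, ← div_eq_mul_inv, ENNReal.div_le_iff
      (by simpa using hp) ENNReal.ofReal_ne_top, mul_comm]
    refine e2.trans ?_
    gcongr
    exact (le_max_right _ _).trans (le_max_right _ _)
  · show innerDist (B ∩ V) (φ p) (φ q) ≤ _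
    refine e1.trans ?_
    gcongr
    exact (le_max_left _ _).trans (le_max_right _ _)

abbrev CC := ℂ × ℂ × ℂ

def LL {E F : Type*} [NormedAddCommGroup E] [NormedAddCommGroup F] (f : E → F) (p : E) : Prop :=
  ∃ K : ℝ, ∃ s ∈ 𝓝 p, ∀ q ∈ s, ∀ q' ∈ s, ‖f q - f q'‖ ≤ K * ‖q - q'‖

section
variable {E F G : Type*} [NormedAddCommGroup E] [NormedAddCommGroup F] [NormedAddCommGroup G]

theorem Half.of_linear [NormedSpace ℝ E] [NormedSpace ℝ F] (e : E ≃L[ℝ] F) {A : Set E} {B : Set F}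
    (h : ∀ p, p ∈ A → e p ∈ B) : ∃ K ε, Half A B e e.symm K ε := by
  refine ⟨‖(e : E →L[ℝ] F)‖ + 1, 1, by positivity, one_pos, fun p hp _ => ⟨h p hp, by simp, ?_,
    fun _ => ⟨univ, univ_mem, fun q _ q' _ => ?_⟩⟩⟩
  · have := (e : E →L[ℝ] F).le_opNorm p
    have h2 := norm_nonneg p
    simp only [ContinuousLinearEquiv.coe_coe] at this
    nlinarith
  · have := (e : E →L[ℝ] F).le_opNorm (q - q')
    have h2 := norm_nonneg (q - q')
    simp only [ContinuousLinearEquiv.coe_coe, map_sub] at this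
    nlinarith

theorem GermEq.of_linear [NormedSpace ℝ E] [NormedSpace ℝ F] (e : E ≃L[ℝ] F) {A : Set E} {B : Set F}
    (h : ∀ p, p ∈ A ↔ e p ∈ B) : GermEq A B :=
  ⟨e, e.symm, Half.of_linear e fun p => (h p).1, by
    simpa using Half.of_linear e.symm (A := B) (B := A) (fun q hq => (h _).2 (by simpa using hq))⟩

theorem LL.ca {f : E → F} {p : E} (h : LL f p) : ContinuousAt f p := by
  obtain ⟨K, s, hs, h⟩ := h
  have : LipAt K univ f p := ⟨s, by simpa using hs, h⟩
  simpa [continuousWithinAt_univ] using this.cont (mem_univ _)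

theorem LL.comp {g : F → G} {f : E → F} {p : E} (hg : LL g (f p)) (hf : LL f p) :
    LL (fun q => g (f q)) p := by
  have hc := hf.ca
  obtain ⟨K, s, hs, h⟩ := hf
  obtain ⟨L, t, ht, h2⟩ := hg
  refine ⟨|L| * K, s ∩ f ⁻¹' t, inter_mem hs (hc ht), ?_⟩
  rintro q ⟨hq, hq2⟩ q' ⟨hq', hq2'⟩
  calc _ ≤ L * ‖f q - f q'‖ := h2 _ hq2 _ hq2'
    _ ≤ |L| * ‖f q - f q'‖ := by gcongr; exact le_abs_self _
    _ ≤ |L| * (K * ‖q - q'‖) := by gcongr; exact h _ hq _ hq'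
    _ = _ := by ring

theorem LL.prodMk {f : E → F} {g : E → G} {p : E} (hf : LL f p) (hg : LL g p) :
    LL (fun q => (f q, g q)) p := by
  obtain ⟨K, s, hs, h⟩ := hf
  obtain ⟨L, t, ht, h2⟩ := hg
  refine ⟨max K L, s ∩ t, inter_mem hs ht, ?_⟩
  rintro q ⟨hq, hq2⟩ q' ⟨hq', hq2'⟩
  rw [Prod.norm_def]
  refine max_le ?_ ?_
  · exact (h q hq q' hq').trans (by gcongr; exact le_max_left _ _)
  · exact (h2 q hq2 q' hq2').trans (by gcongr; exact le_max_right _ _)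

theorem LL.of_lip {f : E → F} (K : ℝ) (h : ∀ q q', ‖f q - f q'‖ ≤ K * ‖q - q'‖) (p : E) : LL f p :=
  ⟨K, univ, univ_mem, fun q _ q' _ => h q q'⟩

theorem LL.const (a : F) (p : E) : LL (fun _ => a) p := LL.of_lip 0 (by simp) p
theorem LL.id (p : E) : LL (fun q => q) p := LL.of_lip 1 (by simp) p

theorem LL.congr {f g : E → F} {p : E} (hf : LL f p) (h : ∀ᶠ q in 𝓝 p, g q = f q) : LL g p := by
  obtain ⟨K, s, hs, hl⟩ := hf
  refine ⟨K, s ∩ {q | g q = f q}, inter_mem hs h, ?_⟩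
  rintro q ⟨hq, hq2⟩ q' ⟨hq', hq2'⟩
  rw [hq2, hq2']
  exact hl q hq q' hq'

theorem LL.of_contDiffAt [NormedSpace ℝ E] [NormedSpace ℝ F] {f : E → F} {p : E}
    (h : ContDiffAt ℝ 1 f p) : LL f p := by
  obtain ⟨K, t, ht, hl⟩ := h.exists_lipschitzOnWith
  refine ⟨K, t, ht, fun q hq q' hq' => ?_⟩
  have := hl.dist_le_mul q hq q' hq'
  simpa [dist_eq_norm] using this

theorem LL.fst {f : E → F × G} {p : E} (h : LL f p) : LL (fun q => (f q).1) p :=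
  LL.comp (g := Prod.fst) (LL.of_lip 1 (fun q q' => by
    rw [one_mul]; exact norm_fst_le (q - q')) _) h
theorem LL.snd {f : E → F × G} {p : E} (h : LL f p) : LL (fun q => (f q).2) p :=
  LL.comp (g := Prod.snd) (LL.of_lip 1 (fun q q' => by
    rw [one_mul]; exact norm_snd_le (q - q')) _) h

theorem LL.norm {f : E → F} {p : E} (h : LL f p) : LL (fun q => ‖f q‖) p :=
  LL.comp (g := fun x => ‖x‖) (LL.of_lip 1 (fun q q' => by
    rw [one_mul]; exact abs_norm_sub_norm_le q q') _) h

variable [NormedSpace ℝ F]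
theorem LL.add {f g : E → F} {p : E} (hf : LL f p) (hg : LL g p) : LL (fun q => f q + g q) p :=
  LL.comp (g := fun x : F × F => x.1 + x.2) (LL.of_contDiffAt (by fun_prop)) (hf.prodMk hg)
theorem LL.sub {f g : E → F} {p : E} (hf : LL f p) (hg : LL g p) : LL (fun q => f q - g q) p :=
  LL.comp (g := fun x : F × F => x.1 - x.2) (LL.of_contDiffAt (by fun_prop)) (hf.prodMk hg)
theorem LL.neg {f : E → F} {p : E} (hf : LL f p) : LL (fun q => - f q) p :=
  LL.comp (g := fun x : F => -x) (LL.of_contDiffAt (by fun_prop)) hf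
theorem LL.smul {f : E → ℝ} {g : E → F} {p : E} (hf : LL f p) (hg : LL g p) :
    LL (fun q => f q • g q) p :=
  LL.comp (g := fun x : ℝ × F => x.1 • x.2) (LL.of_contDiffAt (by fun_prop)) (hf.prodMk hg)
theorem LL.mul {R : Type*} [NormedRing R] [NormedAlgebra ℝ R] {f g : E → R} {p : E} (hf : LL f p)
    (hg : LL g p) : LL (fun q => f q * g q) p :=
  LL.comp (g := fun x : R × R => x.1 * x.2) (LL.of_contDiffAt (by fun_prop)) (hf.prodMk hg)
theorem LL.pow {R : Type*} [NormedRing R] [NormedAlgebra ℝ R] {f : E → R} {p : E} (hf : LL f p)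
    (n : ℕ) : LL (fun q => f q ^ n) p :=
  LL.comp (g := fun x : R => x ^ n) (LL.of_contDiffAt (by fun_prop)) hf
theorem LL.inv {R : Type*} [NormedField R] [NormedAlgebra ℝ R] {f : E → R} {p : E} (hf : LL f p)
    (h0 : f p ≠ 0) : LL (fun q => (f q)⁻¹) p :=
  LL.comp (g := fun x : R => x⁻¹) (LL.of_contDiffAt (contDiffAt_inv ℝ h0)) hf
theorem LL.div {R : Type*} [NormedField R] [NormedAlgebra ℝ R] {f g : E → R} {p : E} (hf : LL f p)
    (hg : LL g p) (h0 : g p ≠ 0) : LL (fun q => f q / g q) p := by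
  simpa only [div_eq_mul_inv] using hf.mul (hg.inv h0)
theorem LL.ofReal {f : E → ℝ} {p : E} (hf : LL f p) : LL (fun q => (f q : ℂ)) p :=
  LL.comp (g := fun x : ℝ => (x : ℂ)) (LL.of_lip 1 (fun q q' => by
    rw [← Complex.ofReal_sub, Complex.norm_real, one_mul]) _) hf
theorem LL.maxx {f g : E → ℝ} {p : E} (hf : LL f p) (hg : LL g p) :
    LL (fun q => max (f q) (g q)) p :=
  LL.comp (g := fun x : ℝ × ℝ => max x.1 x.2) (LL.of_lip 1 (fun q q' => by
    rw [one_mul]; exact abs_max_sub_max_le_max _ _ _ _) _) (hf.prodMk hg)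
theorem LL.minn {f g : E → ℝ} {p : E} (hf : LL f p) (hg : LL g p) :
    LL (fun q => min (f q) (g q)) p :=
  LL.comp (g := fun x : ℝ × ℝ => min x.1 x.2) (LL.of_lip 1 (fun q q' => by
    rw [one_mul]; exact abs_min_sub_min_le_max _ _ _ _) _) (hf.prodMk hg)
theorem LL.log {f : E → ℝ} {p : E} (hf : LL f p) (h0 : f p ≠ 0) :
    LL (fun q => Real.log (f q)) p :=
  LL.comp (g := Real.log) (LL.of_contDiffAt (Real.contDiffAt_log.2 h0)) hf
end

/-- homogeneous functions that are locally Lipschitz off the origin -/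
theorem homog_lip {E F : Type*} [NormedAddCommGroup E] [NormedSpace ℝ E] [ProperSpace E]
    [NormedAddCommGroup F] [NormedSpace ℝ F] {Φ : E → F} {Ω : Set E} (d : ℕ) (hΩ : IsClosed Ω)
    (hs : ∀ p ∈ Ω, ∀ t : ℝ, 0 < t → t • p ∈ Ω)
    (hh : ∀ p, ∀ t : ℝ, 0 < t → Φ (t • p) = t ^ d • Φ p)
    (hl : ∀ p ∈ Ω, p ≠ 0 → LL Φ p) :
    ∃ K : ℝ, 0 < K ∧ ∀ p ∈ Ω, p ≠ 0 → ‖Φ p‖ ≤ K * ‖p‖ ^ d ∧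
      ∃ s ∈ 𝓝 p, ∀ q ∈ s, ∀ q' ∈ s, ‖Φ q - Φ q'‖ * ‖p‖ ≤ K * ‖p‖ ^ d * ‖q - q'‖ := by
  have hc : IsCompact (Metric.sphere (0:E) 1 ∩ Ω) := (isCompact_sphere 0 1).inter_right hΩ
  have H : ∃ K : ℝ, 0 < K ∧ ∀ p ∈ Metric.sphere (0:E) 1 ∩ Ω, ‖Φ p‖ ≤ K ∧
      ∃ s ∈ 𝓝 p, ∀ q ∈ s, ∀ q' ∈ s, ‖Φ q - Φ q'‖ ≤ K * ‖q - q'‖ := by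
    refine hc.induction_on (p := fun S => ∃ K : ℝ, 0 < K ∧ ∀ p ∈ S, ‖Φ p‖ ≤ K ∧
      ∃ s ∈ 𝓝 p, ∀ q ∈ s, ∀ q' ∈ s, ‖Φ q - Φ q'‖ ≤ K * ‖q - q'‖) ?_ ?_ ?_ ?_
    · exact ⟨1, one_pos, by simp⟩
    · rintro S T hST ⟨K, hK, h⟩
      exact ⟨K, hK, fun p hp => h p (hST hp)⟩
    · rintro S T ⟨K, hK, h⟩ ⟨L, hL, h2⟩
      refine ⟨K + L, by positivity, ?_⟩
      rintro p (hp | hp)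
      · obtain ⟨a, s, b, e⟩ := h p hp
        refine ⟨by linarith, s, b, fun q hq q' hq' => (e q hq q' hq').trans ?_⟩
        have := norm_nonneg (q - q')
        nlinarith
      · obtain ⟨a, s, b, e⟩ := h2 p hp
        refine ⟨by linarith, s, b, fun q hq q' hq' => (e q hq q' hq').trans ?_⟩
        have := norm_nonneg (q - q')
        nlinarith
    · rintro p ⟨hp, hpΩ⟩
      have hp0 : p ≠ 0 := by
        rintro rfl
        simp at hp
      have hL := hl p hpΩ hp0
      have hca := hL.ca.norm
      obtain ⟨K, s, hs, h⟩ := hL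
      have hb := hca.eventually_lt_const (lt_add_one ‖Φ p‖)
      obtain ⟨t, hts, hto, hpt⟩ := mem_nhds_iff.1 (inter_mem hs hb)
      refine ⟨t, mem_nhdsWithin_of_mem_nhds (hto.mem_nhds hpt), |K| + ‖Φ p‖ + 1, by positivity,
        fun q hq => ⟨?_, t, hto.mem_nhds hq, fun a ha b hb => ?_⟩⟩
      · have := (hts hq).2
        simp only [mem_ofPred_eq] at this
        linarith [abs_nonneg K]
      · refine (h a (hts ha).1 b (hts hb).1).trans ?_
        gcongr
        linarith [le_abs_self K, norm_nonneg (Φ p)]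
  obtain ⟨K, hK, H⟩ := H
  refine ⟨K, hK, fun p hp hp0 => ?_⟩
  have hr : 0 < ‖p‖ := norm_pos_iff.2 hp0
  set r := ‖p‖ with hrd
  have hp1 : r⁻¹ • p ∈ Metric.sphere (0:E) 1 ∩ Ω :=
    ⟨by simp [norm_smul, ← hrd, abs_of_pos hr, hr.ne'], hs p hp _ (by positivity)⟩
  have hsc : ∀ q, Φ q = r ^ d • Φ (r⁻¹ • q) := by
    intro q
    rw [← hh _ r hr, smul_smul, mul_inv_cancel₀ hr.ne', one_smul]
  obtain ⟨a, s, hs', e⟩ := H _ hp1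
  refine ⟨?_, (fun q => r⁻¹ • q) ⁻¹' s, ?_, ?_⟩
  · rw [hsc p, norm_smul, norm_pow, Real.norm_of_nonneg hr.le, mul_comm]
    gcongr
  · exact (continuous_const_smul r⁻¹).continuousAt hs'
  · intro q hq q' hq'
    rw [hsc q, hsc q', ← smul_sub, norm_smul, norm_pow, Real.norm_of_nonneg hr.le]
    have := e _ hq _ hq'
    rw [← smul_sub, norm_smul, norm_inv, Real.norm_of_nonneg hr.le] at this
    calc _ ≤ r ^ d * (K * (r⁻¹ * ‖q - q'‖)) * r := by gcongr
      _ = _ := by field_simp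

theorem homog_lip1 {E F : Type*} [NormedAddCommGroup E] [NormedSpace ℝ E] [ProperSpace E]
    [NormedAddCommGroup F] [NormedSpace ℝ F] {Φ : E → F} {Ω : Set E} (hΩ : IsClosed Ω)
    (hs : ∀ p ∈ Ω, ∀ t : ℝ, 0 < t → t • p ∈ Ω)
    (hh : ∀ p, ∀ t : ℝ, 0 < t → Φ (t • p) = t • Φ p)
    (hl : ∀ p ∈ Ω, p ≠ 0 → LL Φ p) :
    ∃ K : ℝ, 0 < K ∧ ∀ p ∈ Ω, p ≠ 0 → ‖Φ p‖ ≤ K * ‖p‖ ∧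
      ∃ s ∈ 𝓝 p, ∀ q ∈ s, ∀ q' ∈ s, ‖Φ q - Φ q'‖ ≤ K * ‖q - q'‖ := by
  obtain ⟨K, hK, h⟩ := homog_lip 1 hΩ hs (by simpa using hh) hl
  refine ⟨K, hK, fun p hp hp0 => ?_⟩
  obtain ⟨a, s, hs, b⟩ := h p hp hp0
  refine ⟨by simpa using a, s, hs, fun q hq q' hq' => ?_⟩
  have := b q hq q' hq'
  have hr : 0 < ‖p‖ := norm_pos_iff.2 hp0
  rw [pow_one, mul_right_comm] at this
  exact le_of_mul_le_mul_right this hr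

def chi (n d : ℝ) : ℝ := max 0 (min 1 (2 - 4 * (n / d)))
def fac (u z : ℂ) (n : ℝ) : ℂ := 1 + chi n ‖z‖ * (u / z)

theorem chi_mem (n d : ℝ) : 0 ≤ chi n d ∧ chi n d ≤ 1 :=
  ⟨le_max_left _ _, max_le zero_le_one (min_le_left _ _)⟩

theorem chi_zero {n d : ℝ} (hd : 0 < d) (h : d ≤ 2 * n) : chi n d = 0 := by
  have : (1:ℝ) / 2 ≤ n / d := by rw [div_le_div_iff₀ (by norm_num) hd]; linarith
  unfold chi
  rw [max_eq_left]
  exact (min_le_right _ _).trans (by linarith)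

theorem chi_one {n d : ℝ} (hd : 0 < d) (h : 4 * n ≤ d) : chi n d = 1 := by
  have : n / d ≤ 1 / 4 := by rw [div_le_div_iff₀ hd (by norm_num)]; linarith
  unfold chi
  rw [min_eq_left (by linarith)]
  norm_num

theorem fac_bound {u z : ℂ} {n : ℝ} (h : ‖u‖ ≤ n) : 1/2 ≤ ‖fac u z n‖ ∧ ‖fac u z n‖ ≤ 3/2 := by
  have key : ‖(chi n ‖z‖ : ℂ) * (u / z)‖ ≤ 1/2 := by
    by_cases hz : z = 0
    · simp [hz]
    have hz' : 0 < ‖z‖ := norm_pos_iff.2 hz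
    by_cases hc : ‖z‖ ≤ 2 * n
    · simp [chi_zero hz' hc]
    · rw [norm_mul, Complex.norm_real, Real.norm_of_nonneg (chi_mem _ _).1, norm_div]
      have : ‖u‖ / ‖z‖ ≤ 1/2 := by rw [div_le_div_iff₀ hz' (by norm_num)]; linarith
      have h1 := chi_mem n ‖z‖
      have h2 : 0 ≤ ‖u‖ / ‖z‖ := by positivity
      nlinarith
  unfold fac
  constructor
  · have := norm_sub_le_norm_add (1:ℂ) ((chi n ‖z‖ : ℂ) * (u / z))
    rw [norm_one] at this
    linarith
  · have := norm_add_le (1:ℂ) ((chi n ‖z‖ : ℂ) * (u / z))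
    rw [norm_one] at this
    linarith

theorem fac_homog {α : ℂ} (hα : α ≠ 0) (u z : ℂ) (n : ℝ) :
    fac (α * u) (α * z) (‖α‖ * n) = fac u z n := by
  unfold fac chi
  rw [norm_mul, mul_div_mul_left _ _ hα, mul_div_mul_left _ _ (norm_ne_zero_iff.2 hα)]

theorem fac_LL {E : Type*} [NormedAddCommGroup E] {u z : E → ℂ} {n : E → ℝ} {p : E}
    (hu : LL u p) (hz : LL z p) (hn : LL n p) (h : z p ≠ 0 ∨ 0 < n p) :
    LL (fun q => fac (u q) (z q) (n q)) p := by
  by_cases h0 : z p = 0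
  · have hn0 : 0 < n p := by tauto
    refine (LL.const (1:ℂ) p).congr ?_
    have h1 : ContinuousAt (fun q => ‖z q‖ - 2 * n q) p :=
      hz.ca.norm.sub (hn.ca.const_mul 2)
    have := h1.eventually_lt_const (show ‖z p‖ - 2 * n p < 0 by simp [h0, hn0])
    filter_upwards [this] with q hq
    by_cases hq0 : z q = 0
    · simp [fac, hq0]
    · simp [fac, chi_zero (norm_pos_iff.2 hq0) (by linarith : ‖z q‖ ≤ 2 * n q)]
  · unfold fac chi
    refine (LL.const _ _).add (LL.mul (LL.ofReal ?_) (hu.div hz h0))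
    refine (LL.const _ _).maxx ((LL.const _ _).minn ((LL.const _ _).sub ((LL.const _ _).mul
      (hn.div hz.norm (norm_ne_zero_iff.2 h0)))))

def cfun (p : CC) : ℂ :=
  fac (p.1 + p.2.1) p.2.2 (‖p.1‖ + ‖p.2.1‖) * fac (p.2.1 + p.2.2) p.1 (‖p.2.1‖ + ‖p.2.2‖)

def mfun (p : CC) : ℂ := (p.1 + p.2.1 + p.2.2) / cfun p

theorem cfun_bound (p : CC) : 1/4 ≤ ‖cfun p‖ ∧ ‖cfun p‖ ≤ 9/4 := by
  have h1 := fac_bound (z := p.2.2) (norm_add_le p.1 p.2.1)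
  have h2 := fac_bound (z := p.1) (norm_add_le p.2.1 p.2.2)
  unfold cfun
  rw [norm_mul]
  constructor <;> nlinarith

theorem cfun_ne (p : CC) : cfun p ≠ 0 := by
  have := (cfun_bound p).1
  intro h
  rw [h, norm_zero] at this
  norm_num at this

theorem cfun_homog {α : ℂ} (hα : α ≠ 0) (p : CC) : cfun (α • p) = cfun p := by
  unfold cfun
  simp only [Prod.smul_fst, Prod.smul_snd, smul_eq_mul, norm_mul, ← mul_add, fac_homog hα]

theorem mfun_homog {α : ℂ} (hα : α ≠ 0) (p : CC) : mfun (α • p) = α * mfun p := by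
  unfold mfun
  rw [cfun_homog hα]
  simp only [Prod.smul_fst, Prod.smul_snd, smul_eq_mul]
  ring

theorem CC.le (p : CC) : ‖p.1‖ ≤ ‖p‖ ∧ ‖p.2.1‖ ≤ ‖p‖ ∧ ‖p.2.2‖ ≤ ‖p‖ :=
  ⟨norm_fst_le p, (norm_fst_le p.2).trans (norm_snd_le p), (norm_snd_le p.2).trans (norm_snd_le p)⟩

theorem CC.norm_le {p : CC} {b : ℝ} (h1 : ‖p.1‖ ≤ b) (h2 : ‖p.2.1‖ ≤ b) (h3 : ‖p.2.2‖ ≤ b) :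
    ‖p‖ ≤ b := by
  rw [Prod.norm_def, Prod.norm_def]
  exact max_le h1 (max_le h2 h3)

theorem mfun_bound (p : CC) : ‖mfun p‖ ≤ 12 * ‖p‖ := by
  unfold mfun
  obtain ⟨h1, h2, h3⟩ := CC.le p
  have := norm_add₃_le (a := p.1) (b := p.2.1) (c := p.2.2)
  have hc := (cfun_bound p).1
  rw [norm_div, div_le_iff₀ (by linarith)]
  nlinarith [norm_nonneg p]

theorem LLx (p : CC) : LL (fun q : CC => q.1) p := (LL.id p).fst
theorem LLy (p : CC) : LL (fun q : CC => q.2.1) p := (LL.id p).snd.fst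
theorem LLz (p : CC) : LL (fun q : CC => q.2.2) p := (LL.id p).snd.snd

theorem cfun_LL {p : CC} (hp : p ≠ 0) : LL cfun p := by
  unfold cfun
  have h : p.1 ≠ 0 ∨ p.2.1 ≠ 0 ∨ p.2.2 ≠ 0 := by
    by_contra hh
    push Not at hh
    exact hp (Prod.ext hh.1 (Prod.ext hh.2.1 hh.2.2))
  refine (fac_LL ((LLx p).add (LLy p)) (LLz p) ((LLx p).norm.add (LLy p).norm) ?_).mul
    (fac_LL ((LLy p).add (LLz p)) (LLx p) ((LLy p).norm.add (LLz p).norm) ?_)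
  · rcases h with h | h | h
    · right; positivity
    · right; positivity
    · exact Or.inl h
  · rcases h with h | h | h
    · exact Or.inl h
    · right; positivity
    · right; positivity

theorem mfun_LL {p : CC} (hp : p ≠ 0) : LL mfun p :=
  (((LLx p).add (LLy p)).add (LLz p)).div (cfun_LL hp) (cfun_ne p)

theorem mfun_z {p : CC} (h : 4 * (‖p.1‖ + ‖p.2.1‖) ≤ ‖p.2.2‖) : mfun p = p.2.2 := by
  by_cases hz : p.2.2 = 0
  · have h1 : ‖p.1‖ = 0 ∧ ‖p.2.1‖ = 0 := by
      rw [hz, norm_zero] at h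
      constructor <;> linarith [norm_nonneg p.1, norm_nonneg p.2.1]
    rw [norm_eq_zero, norm_eq_zero] at h1
    simp [mfun, h1.1, h1.2, hz]
  have hz' : 0 < ‖p.2.2‖ := norm_pos_iff.2 hz
  have f1 : fac (p.1 + p.2.1) p.2.2 (‖p.1‖ + ‖p.2.1‖) = (p.1 + p.2.1 + p.2.2) / p.2.2 := by
    rw [fac, chi_one hz' h]
    push_cast
    field_simp
    ring
  have f2 : fac (p.2.1 + p.2.2) p.1 (‖p.2.1‖ + ‖p.2.2‖) = 1 := by
    by_cases hx : p.1 = 0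
    · simp [fac, hx]
    rw [fac, chi_zero (norm_pos_iff.2 hx) (by linarith [norm_nonneg p.1, norm_nonneg p.2.1])]
    simp
  have hl : p.1 + p.2.1 + p.2.2 ≠ 0 := by
    intro h0
    have : p.2.2 = -(p.1 + p.2.1) := by linear_combination h0
    have h2 := norm_add_le p.1 p.2.1
    rw [this, norm_neg] at h hz'
    linarith
  rw [mfun, cfun, f1, f2]
  field_simp

theorem mfun_x {p : CC} (h : 4 * (‖p.2.1‖ + ‖p.2.2‖) ≤ ‖p.1‖) : mfun p = p.1 := by
  by_cases hz : p.1 = 0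
  · have h1 : ‖p.2.1‖ = 0 ∧ ‖p.2.2‖ = 0 := by
      rw [hz, norm_zero] at h
      constructor <;> linarith [norm_nonneg p.2.1, norm_nonneg p.2.2]
    rw [norm_eq_zero, norm_eq_zero] at h1
    simp [mfun, h1.1, h1.2, hz]
  have hz' : 0 < ‖p.1‖ := norm_pos_iff.2 hz
  have f1 : fac (p.2.1 + p.2.2) p.1 (‖p.2.1‖ + ‖p.2.2‖) = (p.1 + p.2.1 + p.2.2) / p.1 := by
    rw [fac, chi_one hz' h]
    push_cast
    field_simp
    ring
  have f2 : fac (p.1 + p.2.1) p.2.2 (‖p.1‖ + ‖p.2.1‖) = 1 := by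
    by_cases hx : p.2.2 = 0
    · simp [fac, hx]
    rw [fac, chi_zero (norm_pos_iff.2 hx) (by linarith [norm_nonneg p.2.2, norm_nonneg p.2.1])]
    simp
  have hl : p.1 + p.2.1 + p.2.2 ≠ 0 := by
    intro h0
    have : p.1 = -(p.2.1 + p.2.2) := by linear_combination h0
    have h2 := norm_add_le p.2.1 p.2.2
    rw [this, norm_neg] at h hz'
    linarith
  rw [mfun, cfun, f1, f2]
  field_simp

/-- The radial step. -/
theorem radial_half {A B : Set CC} {g : CC → ℂ} (κ : ℂ) (hκ : κ ≠ 0) (n : ℤ)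
    (hg : g = fun p => κ * cfun p ^ n)
    (hm : ∀ p ∈ A, (g p) • p ∈ B) :
    ∃ K ε, Half A B (fun p => g p • p) (fun p => (g p)⁻¹ • p) K ε := by
  have g0 : ∀ p, g p ≠ 0 := fun p => by
    rw [hg]; exact mul_ne_zero hκ (zpow_ne_zero _ (cfun_ne p))
  have ginv : ∀ {α : ℂ}, α ≠ 0 → ∀ p, g (α • p) = g p := fun hα p => by
    simp only [hg, cfun_homog hα]
  have gLL : ∀ p, p ≠ 0 → LL g p := fun p hp => by
    rw [hg]
    exact (LL.const _ _).mul (LL.comp (g := fun x : ℂ => x ^ n) (LL.of_contDiffAt (by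
      rcases n with n | n
      · simp only [Int.ofNat_eq_natCast, zpow_natCast]; fun_prop
      · simp only [zpow_negSucc]
        exact ContDiffAt.inv (by fun_prop) (pow_ne_zero _ (cfun_ne p)))) (cfun_LL hp))
  obtain ⟨K, hK, h⟩ := homog_lip1 (Φ := fun p : CC => g p • p) isClosed_univ (fun _ _ _ _ => mem_univ _)
    (fun p t ht => by
      have : t • p = (t : ℂ) • p := by ext <;> simp
      simp only [this]
      rw [ginv (by exact_mod_cast ht.ne'), smul_comm]
      ext <;> simp)
    (fun p _ hp => by
      have := ((gLL p hp).mul (LLx p)).prodMk (((gLL p hp).mul (LLy p)).prodMk ((gLL p hp).mul (LLz p)))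
      exact this)
  refine ⟨K, 1, hK, one_pos, fun p hp _ => ⟨hm p hp, ?_, ?_, fun hp0 => ?_⟩⟩
  · simp only
    rw [ginv (g0 p), smul_smul, inv_mul_cancel₀ (g0 p), one_smul]
  · by_cases hp0 : p = 0
    · simp [hp0]
    · exact (h p (mem_univ _) hp0).1
  · obtain ⟨s, hs, b⟩ := (h p (mem_univ _) hp0).2
    exact ⟨s, mem_nhdsWithin_of_mem_nhds hs, b⟩

theorem radial {f : CC → ℂ} (hf : ∀ (α : ℂ) p, f (α • p) = α ^ 6 * f p) (κ : ℂ) (hκ : κ ≠ 0) :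
    GermEq {p : CC | f p + (p.1 + p.2.1 + p.2.2) ^ 7 = 0} {p : CC | f p + κ * mfun p ^ 7 = 0} := by
  have hl : ∀ p, p.1 + p.2.1 + p.2.2 = cfun p * mfun p := fun p => by
    rw [mfun, mul_div_cancel₀ _ (cfun_ne p)]
  refine ⟨fun p => (κ⁻¹ * cfun p ^ (7:ℤ)) • p, fun p => (κ * cfun p ^ (-7:ℤ)) • p, ?_, ?_⟩
  · convert radial_half (A := {p : CC | f p + (p.1 + p.2.1 + p.2.2) ^ 7 = 0})
      (B := {p : CC | f p + κ * mfun p ^ 7 = 0}) κ⁻¹ (inv_ne_zero hκ) 7 rfl ?_ using 6 with K ε p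
    · rw [mul_inv, inv_inv, zpow_neg]
    · rintro p hp
      simp only [mem_ofPred_eq, hl] at hp ⊢
      have h0 : κ⁻¹ * cfun p ^ (7:ℤ) ≠ 0 :=
        mul_ne_zero (inv_ne_zero hκ) (zpow_ne_zero _ (cfun_ne p))
      rw [hf, mfun_homog h0]
      have e : κ * ((κ⁻¹ * cfun p ^ (7:ℤ)) ^ 6 * (κ⁻¹ * cfun p ^ (7:ℤ)) * mfun p ^ 7) =
        (κ⁻¹ * cfun p ^ (7:ℤ)) ^ 6 * (cfun p * mfun p) ^ 7 := by
        have : κ * κ⁻¹ = 1 := mul_inv_cancel₀ hκ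
        have e7 : cfun p ^ (7:ℤ) = cfun p ^ 7 := by norm_cast
        rw [e7]
        linear_combination ((κ⁻¹ * cfun p ^ 7) ^ 6 * cfun p ^ 7 * mfun p ^ 7) * this
      linear_combination e + (κ⁻¹ * cfun p ^ (7:ℤ)) ^ 6 * hp
  · convert radial_half (A := {p : CC | f p + κ * mfun p ^ 7 = 0})
      (B := {p : CC | f p + (p.1 + p.2.1 + p.2.2) ^ 7 = 0}) κ hκ (-7) rfl ?_ using 6 with K ε p
    · rw [mul_inv, zpow_neg, inv_inv]
    · rintro p hp
      simp only [mem_ofPred_eq, hl] at hp ⊢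
      have h0 : κ * cfun p ^ (-7:ℤ) ≠ 0 :=
        mul_ne_zero hκ (zpow_ne_zero _ (cfun_ne p))
      rw [hf, mfun_homog h0, cfun_homog h0]
      have e : cfun p ^ 7 * ((κ * cfun p ^ (-7:ℤ)) ^ 6 * (κ * cfun p ^ (-7:ℤ)) * mfun p ^ 7) =
        (κ * cfun p ^ (-7:ℤ)) ^ 6 * (κ * mfun p ^ 7) := by
        have e7 : cfun p ^ (-7:ℤ) * cfun p ^ 7 = 1 := by
          rw [zpow_neg]; norm_cast; exact inv_mul_cancel₀ (pow_ne_zero _ (cfun_ne p))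
        linear_combination ((κ * cfun p ^ (-7:ℤ)) ^ 6 * κ * mfun p ^ 7) * e7
      linear_combination e + (κ * cfun p ^ (-7:ℤ)) ^ 6 * hp

def Sset (a : CC → ℝ) : Set CC :=
  {p | (p.2.1 ^ 3 - p.2.2 ^ 2 * p.1) * ((a p : ℂ) * p.2.1 ^ 3 + p.2.2 ^ 2 * p.1) +
    ((1 + (a p : ℂ)) / 2) ^ 2 * mfun p ^ 7 = 0}

def toCC : C3 ≃ₗ[ℝ] CC where
  toFun p := (p 0, p 1, p 2)
  invFun q := !₂[q.1, q.2.1, q.2.2]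
  left_inv p := by ext i; fin_cases i <;> rfl
  right_inv q := by simp
  map_add' p q := by simp
  map_smul' t p := by simp

theorem XOne_germ : GermEq XOne (Sset fun _ => 1) := by
  have h := radial (f := fun p => (p.2.1 ^ 3 - p.2.2 ^ 2 * p.1) * (p.2.1 ^ 3 + p.2.2 ^ 2 * p.1))
    (fun α p => by simp only [Prod.smul_fst, Prod.smul_snd, smul_eq_mul]; ring) 1 one_ne_zero
  refine GermEq.trans (GermEq.of_linear toCC.toContinuousLinearEquiv ?_) (h.trans ?_)
  · intro p
    exact Iff.rfl
  · have : {p : CC | (p.2.1 ^ 3 - p.2.2 ^ 2 * p.1) * (p.2.1 ^ 3 + p.2.2 ^ 2 * p.1) + 1 * mfun p ^ 7 = 0}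
        = Sset fun _ => 1 := by
      ext p
      simp only [Sset, mem_ofPred_eq]
      push_cast
      norm_num
    rw [this]
    exact GermEq.of_linear (ContinuousLinearEquiv.refl ℝ CC) (by simp)

theorem XTwo_germ : GermEq XTwo (Sset fun _ => 1/2) := by
  have h := radial (f := fun p => (p.2.1 ^ 3 - p.2.2 ^ 2 * p.1) * (p.2.1 ^ 3 + 2 * p.2.2 ^ 2 * p.1))
    (fun α p => by simp only [Prod.smul_fst, Prod.smul_snd, smul_eq_mul]; ring) (9/8) (by norm_num)
  refine GermEq.trans (GermEq.of_linear toCC.toContinuousLinearEquiv ?_) (h.trans ?_)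
  · intro p
    exact Iff.rfl
  · refine GermEq.of_linear (ContinuousLinearEquiv.refl ℝ CC) fun p => ?_
    simp only [Sset, mem_ofPred_eq, ContinuousLinearEquiv.refl_apply]
    push_cast
    constructor
    · intro h; linear_combination (1/2) * h
    · intro h; linear_combination 2 * h

def afun (p : CC) : ℝ :=
  if p.2.1 = 0 then 1/2 else
    1 + max (-4) (min 0 (Real.log (8 * (‖p.2.1‖ / max ‖p.1‖ ‖p.2.2‖)))) / 8

theorem afun_mem (p : CC) : 1/2 ≤ afun p ∧ afun p ≤ 1 := by
  unfold afun
  split_ifs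
  · norm_num
  · constructor
    · linarith [le_max_left (-4:ℝ) (min 0 (Real.log (8 * (‖p.2.1‖ / max ‖p.1‖ ‖p.2.2‖))))]
    · have : max (-4:ℝ) (min 0 (Real.log (8 * (‖p.2.1‖ / max ‖p.1‖ ‖p.2.2‖)))) ≤ 0 :=
        max_le (by norm_num) (min_le_left _ _)
      linarith

theorem afun_one {p : CC} (h0 : p.2.1 ≠ 0) (h : max ‖p.1‖ ‖p.2.2‖ ≤ 8 * ‖p.2.1‖) : afun p = 1 := by
  unfold afun
  rw [if_neg h0]
  have hl : 0 ≤ Real.log (8 * (‖p.2.1‖ / max ‖p.1‖ ‖p.2.2‖)) := by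
    rcases (le_max_of_le_left (norm_nonneg p.1) : 0 ≤ max ‖p.1‖ ‖p.2.2‖).eq_or_lt with h1 | h1
    · rw [← h1]; simp
    · apply Real.log_nonneg
      rw [← mul_div_assoc, le_div_iff₀ h1]
      linarith
  rw [min_eq_left hl]
  norm_num

theorem afun_half {p : CC} (h : 500 * ‖p.2.1‖ ≤ max ‖p.1‖ ‖p.2.2‖) : afun p = 1/2 := by
  unfold afun
  split_ifs with h0
  · rfl
  have hy : 0 < ‖p.2.1‖ := norm_pos_iff.2 h0
  have h1 : 0 < max ‖p.1‖ ‖p.2.2‖ := by linarith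
  have hl : Real.log (8 * (‖p.2.1‖ / max ‖p.1‖ ‖p.2.2‖)) ≤ -4 := by
    rw [Real.log_le_iff_le_exp (by positivity), Real.exp_neg, ← mul_div_assoc, div_le_iff₀ h1]
    have e1 : Real.exp 4 ≤ 125/2 := by
      have h2 := Real.exp_one_lt_d9
      have : Real.exp 4 = Real.exp 1 ^ 4 := by rw [← Real.exp_nat_mul]; norm_num
      rw [this]
      calc Real.exp 1 ^ 4 ≤ 2.7182818286 ^ 4 := by gcongr
        _ ≤ _ := by norm_num
    have e2 : (2:ℝ)/125 ≤ (Real.exp 4)⁻¹ := by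
      rw [show (2:ℝ)/125 = (125/2)⁻¹ by norm_num]
      exact inv_anti₀ (Real.exp_pos _) e1
    nlinarith
  rw [min_eq_right (by linarith), max_eq_left hl]
  norm_num

theorem afun_homog (p : CC) {t : ℝ} (ht : 0 < t) : afun (t • p) = afun p := by
  have e : ∀ u : ℂ, ‖t • u‖ = t * ‖u‖ := fun u => by rw [norm_smul, Real.norm_of_nonneg ht.le]
  unfold afun
  simp only [Prod.smul_fst, Prod.smul_snd, e, smul_eq_zero, ht.ne', false_or]
  rw [← mul_max_of_nonneg _ _ ht.le, mul_div_mul_left _ _ ht.ne']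

theorem afun_LL {p : CC} (hp : p ≠ 0) : LL afun p := by
  have hs : LL (fun q : CC => max ‖q.1‖ ‖q.2.2‖) p := (LLx p).norm.maxx (LLz p).norm
  have hy := (LLy p)
  have hsn : 0 ≤ max ‖p.1‖ ‖p.2.2‖ := le_max_of_le_left (norm_nonneg p.1)
  by_cases hy0 : p.2.1 = 0
  · have hs0 : 0 < max ‖p.1‖ ‖p.2.2‖ := by
      rcases hsn.eq_or_lt with h | h
      · exfalso
        apply hp
        have h1 : ‖p.1‖ ≤ 0 := h ▸ le_max_left _ _
        have h2 : ‖p.2.2‖ ≤ 0 := h ▸ le_max_right _ _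
        exact Prod.ext (norm_le_zero_iff.1 h1) (Prod.ext hy0 (norm_le_zero_iff.1 h2))
      · exact h
    refine (LL.const (1/2:ℝ) p).congr ?_
    have h1 : ContinuousAt (fun q : CC => 500 * ‖q.2.1‖ - max ‖q.1‖ ‖q.2.2‖) p :=
      (hy.norm.ca.const_mul 500).sub hs.ca
    filter_upwards [h1.eventually_lt_const (show _ < (0:ℝ) by simp only [hy0, norm_zero]; linarith)] with q hq
    exact afun_half (by linarith)
  · have hy1 : 0 < ‖p.2.1‖ := norm_pos_iff.2 hy0
    rcases hsn.eq_or_lt with h | h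
    · refine (LL.const (1:ℝ) p).congr ?_
      have h1 : ContinuousAt (fun q : CC => 8 * ‖q.2.1‖ - max ‖q.1‖ ‖q.2.2‖) p :=
        (hy.norm.ca.const_mul 8).sub hs.ca
      filter_upwards [h1.eventually_const_lt (show (0:ℝ) < _ by simp only [← h]; linarith),
        hy.ca.eventually_ne hy0] with q hq hq0
      exact afun_one hq0 (by linarith)
    · have : LL (fun q : CC => 1 + max (-4) (min 0 (Real.log (8 * (‖q.2.1‖ / max ‖q.1‖ ‖q.2.2‖)))) / 8) p :=
        (LL.const _ _).add (((LL.const _ _).maxx ((LL.const _ _).minn (LL.log ((LL.const _ _).mul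
          (hy.norm.div hs h.ne')) (by positivity)))).div (LL.const _ _) (by norm_num))
      refine this.congr ?_
      filter_upwards [hy.ca.eventually_ne hy0] with q hq0
      rw [afun, if_neg hq0]

def eps0 : ℝ := 1 / (10 ^ 9 * 12 ^ 7)
theorem eps0_pos : 0 < eps0 := by unfold eps0; positivity

theorem loc0 {b : CC → ℝ} (hb : ∀ p, 1/2 ≤ b p ∧ b p ≤ 1) {p : CC} (hp : p ∈ Sset b)
    (hn : ‖p‖ < eps0) :
    ‖p.2.1 ^ 3 - p.2.2 ^ 2 * p.1‖ * ‖(b p : ℂ) * p.2.1 ^ 3 + p.2.2 ^ 2 * p.1‖ ≤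
      1 / 10 ^ 9 * ‖p‖ ^ 6 := by
  have h1 : (p.2.1 ^ 3 - p.2.2 ^ 2 * p.1) * ((b p : ℂ) * p.2.1 ^ 3 + p.2.2 ^ 2 * p.1) =
    - (((1 + (b p : ℂ)) / 2) ^ 2 * mfun p ^ 7) := by
    have : _ = _ := hp
    linear_combination this
  rw [← norm_mul, h1, norm_neg, norm_mul, norm_pow, norm_pow]
  have h2 : ‖(1 + (b p : ℂ)) / 2‖ ≤ 1 := by
    have : (1 + (b p : ℂ)) / 2 = (((1 + b p) / 2 : ℝ) : ℂ) := by push_cast; ring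
    rw [this, Complex.norm_real, Real.norm_of_nonneg (by linarith [(hb p).1])]
    linarith [(hb p).2]
  calc _ ≤ 1 ^ 2 * (12 * ‖p‖) ^ 7 := by gcongr; exact mfun_bound p
    _ = 12 ^ 7 * ‖p‖ * ‖p‖ ^ 6 := by ring
    _ ≤ 12 ^ 7 * eps0 * ‖p‖ ^ 6 := by gcongr
    _ = _ := by unfold eps0; norm_num

theorem loc1 {b : CC → ℝ} (hb : ∀ p, 1/2 ≤ b p ∧ b p ≤ 1) {p : CC} (hp : p ∈ Sset b)
    (hn : ‖p‖ < eps0) :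
    |‖p.2.1‖ ^ 3 - ‖p.2.2‖ ^ 2 * ‖p.1‖| * max (‖p.2.2‖ ^ 2 * ‖p.1‖ - ‖p.2.1‖ ^ 3)
      (‖p.2.1‖ ^ 3 / 2 - ‖p.2.2‖ ^ 2 * ‖p.1‖) ≤ 1 / 10 ^ 9 * ‖p‖ ^ 6 := by
  refine le_trans ?_ (loc0 hb hp hn)
  have hY : ‖p.2.1 ^ 3‖ = ‖p.2.1‖ ^ 3 := norm_pow _ _
  have hZ : ‖p.2.2 ^ 2 * p.1‖ = ‖p.2.2‖ ^ 2 * ‖p.1‖ := by rw [norm_mul, norm_pow]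
  have hbY : ‖(b p : ℂ) * p.2.1 ^ 3‖ = b p * ‖p.2.1‖ ^ 3 := by
    rw [norm_mul, Complex.norm_real, Real.norm_of_nonneg (by linarith [(hb p).1]), norm_pow]
  have hy3 : 0 ≤ ‖p.2.1‖ ^ 3 := by positivity
  have h1 := abs_norm_sub_norm_le (p.2.1 ^ 3) (p.2.2 ^ 2 * p.1)
  rw [hY, hZ] at h1
  have h2 := norm_sub_le_norm_add ((b p : ℂ) * p.2.1 ^ 3) (p.2.2 ^ 2 * p.1)
  have h3 := norm_sub_le_norm_add (p.2.2 ^ 2 * p.1) ((b p : ℂ) * p.2.1 ^ 3)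
  rw [hbY, hZ] at h2 h3
  rw [add_comm] at h3
  obtain ⟨hb1, hb2⟩ := hb p
  have h4 : max (‖p.2.2‖ ^ 2 * ‖p.1‖ - ‖p.2.1‖ ^ 3) (‖p.2.1‖ ^ 3 / 2 - ‖p.2.2‖ ^ 2 * ‖p.1‖) ≤
      ‖(b p : ℂ) * p.2.1 ^ 3 + p.2.2 ^ 2 * p.1‖ := by
    apply max_le
    · nlinarith
    · nlinarith
  exact (mul_le_mul_of_nonneg_left h4 (abs_nonneg _)).trans
    (mul_le_mul_of_nonneg_right h1 (norm_nonneg _))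

theorem locZ {b : CC → ℝ} (hb : ∀ p, 1/2 ≤ b p ∧ b p ≤ 1) {p : CC} (hp : p ∈ Sset b)
    (hn : ‖p‖ < eps0) (h : ‖p.1‖ ≤ ‖p.2.2‖) :
    ‖p.2.1‖ ≤ 2 * ‖p.2.2‖ ∧ (8 * ‖p.2.1‖ ≤ ‖p.2.2‖ → 16 * ‖p.1‖ ≤ ‖p.2.2‖) := by
  have L := loc1 hb hp hn
  constructor
  · by_contra hc
    push Not at hc
    have hr : ‖p‖ ≤ ‖p.2.1‖ := CC.norm_le (by linarith [norm_nonneg p.2.2]) le_rfl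
      (by linarith [norm_nonneg p.2.2])
    have hZ : ‖p.2.2‖ ^ 2 * ‖p.1‖ ≤ ‖p.2.1‖ ^ 3 / 8 := by
      calc _ ≤ (‖p.2.1‖ / 2) ^ 2 * (‖p.2.1‖ / 2) := by gcongr <;> linarith
        _ = _ := by ring
    have hY : 0 < ‖p.2.1‖ ^ 3 := by
      have : 0 < ‖p.2.1‖ := by linarith [norm_nonneg p.2.2]
      positivity
    have : 7/8 * ‖p.2.1‖ ^ 3 * (3/8 * ‖p.2.1‖ ^ 3) ≤ 1 / 10 ^ 9 * ‖p.2.1‖ ^ 6 := by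
      refine le_trans ?_ (L.trans (by gcongr))
      gcongr
      · rw [abs_of_nonneg (by linarith)]; linarith
      · exact le_max_of_le_right (by linarith)
    nlinarith [pow_pos hY 2]
  · intro hy
    by_contra hc
    push Not at hc
    have hz0 : 0 < ‖p.2.2‖ := by
      rcases (norm_nonneg p.2.2).eq_or_lt with h0 | h0
      · linarith [norm_nonneg p.1]
      · exact h0
    have hr : ‖p‖ ≤ ‖p.2.2‖ := CC.norm_le h (by linarith) le_rfl
    have hZ : ‖p.2.2‖ ^ 3 / 16 ≤ ‖p.2.2‖ ^ 2 * ‖p.1‖ := by nlinarith [pow_pos hz0 2]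
    have hY : ‖p.2.1‖ ^ 3 ≤ ‖p.2.2‖ ^ 3 / 512 := by
      calc _ ≤ (‖p.2.2‖ / 8) ^ 3 := by gcongr; linarith
        _ = _ := by ring
    have hz3 : 0 < ‖p.2.2‖ ^ 3 := by positivity
    have : ‖p.2.2‖ ^ 3 / 32 * (‖p.2.2‖ ^ 3 / 32) ≤ 1 / 10 ^ 9 * ‖p.2.2‖ ^ 6 := by
      refine le_trans ?_ (L.trans (by gcongr))
      gcongr
      · rw [abs_of_nonpos (by linarith)]; linarith
      · exact le_max_of_le_left (by linarith)
    nlinarith [pow_pos hz3 2]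

theorem locX {b : CC → ℝ} (hb : ∀ p, 1/2 ≤ b p ∧ b p ≤ 1) {p : CC} (hp : p ∈ Sset b)
    (hn : ‖p‖ < eps0) (h : ‖p.2.2‖ ≤ ‖p.1‖) :
    ‖p.2.1‖ ≤ 2 * ‖p.1‖ ∧ (8 * ‖p.2.1‖ ≤ ‖p.1‖ → 16 * ‖p.2.2‖ ≤ ‖p.1‖) := by
  have L := loc1 hb hp hn
  constructor
  · by_contra hc
    push Not at hc
    have hr : ‖p‖ ≤ ‖p.2.1‖ := CC.norm_le (by linarith [norm_nonneg p.1]) le_rfl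
      (by linarith [norm_nonneg p.1])
    have hZ : ‖p.2.2‖ ^ 2 * ‖p.1‖ ≤ ‖p.2.1‖ ^ 3 / 8 := by
      calc _ ≤ (‖p.2.1‖ / 2) ^ 2 * (‖p.2.1‖ / 2) := by gcongr <;> linarith
        _ = _ := by ring
    have hY : 0 < ‖p.2.1‖ ^ 3 := by
      have : 0 < ‖p.2.1‖ := by linarith [norm_nonneg p.1]
      positivity
    have : 7/8 * ‖p.2.1‖ ^ 3 * (3/8 * ‖p.2.1‖ ^ 3) ≤ 1 / 10 ^ 9 * ‖p.2.1‖ ^ 6 := by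
      refine le_trans ?_ (L.trans (by gcongr))
      gcongr
      · rw [abs_of_nonneg (by linarith)]; linarith
      · exact le_max_of_le_right (by linarith)
    nlinarith [pow_pos hY 2]
  · intro hy
    by_contra hc
    push Not at hc
    have hz0 : 0 < ‖p.1‖ := by
      rcases (norm_nonneg p.1).eq_or_lt with h0 | h0
      · linarith [norm_nonneg p.2.2]
      · exact h0
    have hr : ‖p‖ ≤ ‖p.1‖ := CC.norm_le le_rfl (by linarith) h
    have hZ : ‖p.1‖ ^ 3 / 256 ≤ ‖p.2.2‖ ^ 2 * ‖p.1‖ := by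
      calc _ = (‖p.1‖ / 16) ^ 2 * ‖p.1‖ := by ring
        _ ≤ _ := by gcongr; linarith
    have hY : ‖p.2.1‖ ^ 3 ≤ ‖p.1‖ ^ 3 / 512 := by
      calc _ ≤ (‖p.1‖ / 8) ^ 3 := by gcongr; linarith
        _ = _ := by ring
    have hz3 : 0 < ‖p.1‖ ^ 3 := by positivity
    have : ‖p.1‖ ^ 3 / 512 * (‖p.1‖ ^ 3 / 512) ≤ 1 / 10 ^ 9 * ‖p.1‖ ^ 6 := by
      refine le_trans ?_ (L.trans (by gcongr))
      gcongr
      · rw [abs_of_nonpos (by linarith)]; linarith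
      · exact le_max_of_le_left (by linarith)
    nlinarith [pow_pos hz3 2]

def Hz (α β : ℝ → ℝ) (p : CC) : CC :=
  ((α (afun p) : ℂ) * p.1 + (β (afun p) : ℂ) * (p.2.1 ^ 3 / p.2.2 ^ 2), p.2.1, p.2.2)

def zmap (α β : ℝ → ℝ) (p : CC) : CC := if ‖p.1‖ ≤ ‖p.2.2‖ then Hz α β p else p

def az (p : CC) : ℝ := if ‖p.1‖ ≤ ‖p.2.2‖ then afun p else 1

theorem az_mem (p : CC) : 1/2 ≤ az p ∧ az p ≤ 1 := by
  unfold az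
  split_ifs
  · exact afun_mem p
  · norm_num

theorem zero_mem_Sset (a : CC → ℝ) : (0:CC) ∈ Sset a := by simp [Sset, mfun]

theorem afun_congr {p q : CC} (h1 : p.2.1 = q.2.1) (h2 : max ‖p.1‖ ‖p.2.2‖ = max ‖q.1‖ ‖q.2.2‖) :
    afun p = afun q := by
  unfold afun; rw [h1, h2]

theorem Hz_homog (α β : ℝ → ℝ) (p : CC) (t : ℝ) (ht : 0 < t) : Hz α β (t • p) = t • Hz α β p := by
  have ht' : (t:ℂ) ≠ 0 := by exact_mod_cast ht.ne'
  unfold Hz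
  rw [afun_homog p ht]
  simp only [Prod.smul_fst, Prod.smul_snd, Complex.real_smul, Prod.smul_mk]
  congr 1
  have : ((t:ℂ) * p.2.1) ^ 3 / ((t:ℂ) * p.2.2) ^ 2 = t * (p.2.1 ^ 3 / p.2.2 ^ 2) := by
    rw [mul_pow, mul_pow, show (t:ℂ) ^ 3 = t ^ 2 * t by ring, mul_assoc,
      mul_div_mul_left _ _ (pow_ne_zero _ ht'), mul_div_assoc]
  rw [this]
  ring

theorem zhalf {b : CC → ℝ} (hb : ∀ p, 1/2 ≤ b p ∧ b p ≤ 1) {B : Set CC} {α β α' β' : ℝ → ℝ}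
    (h0B : (0:CC) ∈ B)
    (hα : ∀ t, 1/2 ≤ t → t ≤ 1 → ContDiffAt ℝ 1 α t ∧ ContDiffAt ℝ 1 β t ∧ |α t| ≤ 4/3 ∧
      |β t| ≤ 1/3 ∧ α' t * α t = 1 ∧ α' t * β t + β' t = 0)
    (h1 : α 1 = 1 ∧ β 1 = 0)
    (hm : ∀ p ∈ Sset b, p.2.2 ≠ 0 → 8 * ‖p.2.1‖ ≤ ‖p.2.2‖ → 16 * ‖p.1‖ ≤ ‖p.2.2‖ → Hz α β p ∈ B)
    (hm2 : ∀ p ∈ Sset b, (‖p.2.2‖ < ‖p.1‖ ∨ afun p = 1) → p ∈ B) :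
    ∃ K ε, Half (Sset b) B (zmap α β) (zmap α' β') K ε := by
  set Ω : Set CC := {p | ‖p.1‖ ≤ ‖p.2.2‖} ∩ {p | ‖p.2.1‖ ≤ 2 * ‖p.2.2‖} with hΩ
  have hΩc : IsClosed Ω := (isClosed_le (by fun_prop) (by fun_prop)).inter
    (isClosed_le (by fun_prop) (by fun_prop))
  have Hid : ∀ p, afun p = 1 → Hz α β p = p := fun p hp => by
    unfold Hz; rw [hp, h1.1, h1.2]; ext <;> simp
  obtain ⟨K, hK, H⟩ := homog_lip1 (Φ := Hz α β) hΩc (by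
    rintro p ⟨h1, h2⟩ t ht
    simp only [mem_ofPred_eq] at h1 h2
    constructor
    · simp only [mem_ofPred_eq, Prod.smul_fst, Prod.smul_snd, norm_smul]
      gcongr
    · simp only [mem_ofPred_eq, Prod.smul_fst, Prod.smul_snd, norm_smul]
      calc _ ≤ ‖t‖ * (2 * ‖p.2.2‖) := by gcongr
        _ = _ := by ring) (Hz_homog α β) (by
    rintro p ⟨h1, h2⟩ hp0
    simp only [mem_ofPred_eq] at h1 h2
    have hz : p.2.2 ≠ 0 := by
      intro h
      rw [h, norm_zero] at h1 h2
      exact hp0 (Prod.ext (norm_le_zero_iff.1 h1) (Prod.ext (norm_le_zero_iff.1 (by linarith)) h))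
    have ha := afun_LL hp0
    obtain ⟨c1, c2, -⟩ := hα _ (afun_mem p).1 (afun_mem p).2
    exact ((((LL.of_contDiffAt c1).comp ha).ofReal.mul (LLx p)).add
      (((LL.of_contDiffAt c2).comp ha).ofReal.mul (((LLy p).pow 3).div ((LLz p).pow 2)
        (pow_ne_zero 2 hz)))).prodMk ((LLy p).prodMk (LLz p)))
  refine ⟨max 1 K, eps0, by positivity, eps0_pos, fun p hp hpn => ?_⟩
  by_cases hp0 : p = 0
  · subst hp0
    have e : ∀ α β, zmap α β 0 = 0 := fun α β => by
      unfold zmap Hz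
      split_ifs <;> simp
    rw [e, e]
    simp [h0B]
  -- p nonzero
  have hK1 : ∀ r : ℝ, 0 ≤ r → r ≤ max 1 K * r := fun r hr => by
    nlinarith [le_max_left (1:ℝ) K]
  have hKK : ∀ r : ℝ, 0 ≤ r → K * r ≤ max 1 K * r := fun r hr => by
    gcongr; exact le_max_right _ _
  have Lid : (∀ᶠ q in 𝓝 p, zmap α β q = q) → LipAt (max 1 K) (Sset b) (zmap α β) p := fun h => by
    refine ⟨_, mem_nhdsWithin_of_mem_nhds h, fun q hq q' hq' => ?_⟩
    simp only [mem_ofPred_eq] at hq hq'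
    rw [hq, hq']
    exact hK1 _ (norm_nonneg _)
  by_cases hxz : ‖p.1‖ ≤ ‖p.2.2‖
  · obtain ⟨l1, l2⟩ := locZ hb hp hpn hxz
    have hz : p.2.2 ≠ 0 := by
      intro h
      rw [h, norm_zero] at hxz l1
      exact hp0 (Prod.ext (norm_le_zero_iff.1 hxz) (Prod.ext (norm_le_zero_iff.1 (by linarith)) h))
    have hz' : 0 < ‖p.2.2‖ := norm_pos_iff.2 hz
    have hzm : zmap α β p = Hz α β p := if_pos hxz
    have hmax : max ‖p.1‖ ‖p.2.2‖ = ‖p.2.2‖ := max_eq_right hxz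
    have part1 : zmap α β p ∈ B ∧ zmap α' β' (zmap α β p) = p := by
      by_cases hy : ‖p.2.2‖ ≤ 8 * ‖p.2.1‖
      · have ha : afun p = 1 := afun_one (by
          intro h
          rw [h, norm_zero] at hy
          linarith) (by rw [hmax]; exact hy)
        rw [hzm, Hid p ha]
        refine ⟨hm2 p hp (Or.inr ha), ?_⟩
        unfold zmap Hz
        rw [if_pos hxz, ha]
        obtain ⟨-, -, -, -, e1, e2⟩ := hα 1 (by norm_num) le_rfl
        rw [h1.1, mul_one] at e1
        rw [h1.2, mul_zero, zero_add] at e2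
        rw [e1, e2]
        ext <;> simp
      · push Not at hy
        have hx16 := l2 hy.le
        rw [hzm]
        refine ⟨hm p hp hz hy.le hx16, ?_⟩
        obtain ⟨-, -, b1, b2, e1, e2⟩ := hα _ (afun_mem p).1 (afun_mem p).2
        have hq : ‖(Hz α β p).1‖ ≤ ‖p.2.2‖ := by
          have hyz : ‖p.2.1 ^ 3 / p.2.2 ^ 2‖ ≤ ‖p.2.2‖ := by
            rw [norm_div, norm_pow, norm_pow, div_le_iff₀ (by positivity)]
            calc ‖p.2.1‖ ^ 3 ≤ ‖p.2.2‖ ^ 3 := by gcongr; linarith [norm_nonneg p.2.1]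
              _ = _ := by ring
          unfold Hz
          calc _ ≤ ‖(α (afun p) : ℂ) * p.1‖ + ‖(β (afun p) : ℂ) * (p.2.1 ^ 3 / p.2.2 ^ 2)‖ := norm_add_le _ _
            _ ≤ 4/3 * (‖p.2.2‖/16) + 1/3 * ‖p.2.2‖ := by
              rw [norm_mul, norm_mul, Complex.norm_real, Complex.norm_real, Real.norm_eq_abs, Real.norm_eq_abs]
              gcongr
              linarith
            _ ≤ _ := by linarith
        have hqa : afun (Hz α β p) = afun p := afun_congr rfl (by
          rw [hmax]; exact max_eq_right hq)
        have e1' : (α' (afun p) : ℂ) * α (afun p) = 1 := by exact_mod_cast e1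
        have e2' : (α' (afun p) : ℂ) * β (afun p) + β' (afun p) = 0 := by exact_mod_cast e2
        have hq' : ‖(Hz α β p).1‖ ≤ ‖(Hz α β p).2.2‖ := hq
        rw [zmap, if_pos hq', Hz, hqa]
        refine Prod.ext ?_ rfl
        simp only [Hz]
        linear_combination p.1 * e1' + (p.2.1 ^ 3 / p.2.2 ^ 2) * e2'
    refine ⟨part1.1, part1.2, ?_, fun _ => ?_⟩
    · rw [hzm]
      exact (H p ⟨hxz, l1⟩ hp0).1.trans (hKK _ (norm_nonneg _))
    · rcases hxz.lt_or_eq with hlt | heq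
      · obtain ⟨s, hs, h⟩ := (H p ⟨hxz, l1⟩ hp0).2
        have hev : ∀ᶠ q : CC in 𝓝 p, ‖q.1‖ < ‖q.2.2‖ :=
          (LLx p).norm.ca.eventually_lt (LLz p).norm.ca hlt
        refine ⟨_, mem_nhdsWithin_of_mem_nhds (inter_mem hs hev), ?_⟩
        rintro q ⟨hq, hq2⟩ q' ⟨hq', hq2'⟩
        simp only [mem_ofPred_eq] at hq2 hq2'
        rw [zmap, zmap, if_pos hq2.le, if_pos hq2'.le]
        exact (h q hq q' hq').trans (hKK _ (norm_nonneg _))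
      · have hy : ‖p.2.2‖ < 8 * ‖p.2.1‖ := by
          by_contra hc
          push Not at hc
          linarith [l2 hc]
        apply Lid
        have hev : ∀ᶠ q : CC in 𝓝 p, max ‖q.1‖ ‖q.2.2‖ < 8 * ‖q.2.1‖ :=
          ((LLx p).norm.maxx (LLz p).norm).ca.eventually_lt ((LLy p).norm.ca.const_mul 8)
            (by simpa only [hmax] using hy)
        filter_upwards [hev] with q hq
        have : afun q = 1 := afun_one (by
          intro h
          rw [h, norm_zero, mul_zero] at hq
          linarith [(norm_nonneg q.1).trans (le_max_left _ ‖q.2.2‖)]) hq.le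
        unfold zmap
        rw [Hid q this, ite_self]
  · push Not at hxz
    have e : zmap α β p = p := if_neg (not_le.2 hxz)
    rw [e]
    refine ⟨hm2 p hp (Or.inl hxz), if_neg (not_le.2 hxz), hK1 _ (norm_nonneg _), fun _ => Lid ?_⟩
    have hev : ∀ᶠ q : CC in 𝓝 p, ‖q.2.2‖ < ‖q.1‖ :=
      (LLz p).norm.ca.eventually_lt (LLx p).norm.ca hxz
    filter_upwards [hev] with q hq
    exact if_neg (not_le.2 hq)

theorem Zstep : GermEq (Sset fun _ => 1) (Sset az) := by
  have key : ∀ (Y Z m : ℂ) (a : ℝ), (Y - ((((1 + a)/2 : ℝ):ℂ) * Z + (((1 - a)/2:ℝ):ℂ) * Y)) *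
      ((a:ℂ) * Y + ((((1 + a)/2:ℝ):ℂ) * Z + (((1 - a)/2:ℝ):ℂ) * Y)) + ((1 + (a:ℂ))/2) ^ 2 * m =
      ((1 + (a:ℂ))/2) ^ 2 * ((Y - Z) * (Y + Z) + m) := by
    intro Y Z m a
    push_cast
    ring
  have inv : ∀ (k n X W : ℂ), k ≠ 0 → k * (k⁻¹ * X + (-n / k) * W) + n * W = X := by
    intro k n X W hk
    field_simp
    ring
  refine ⟨zmap (fun a => (1 + a)/2) (fun a => (1 - a)/2),
    zmap (fun a => ((1 + a)/2)⁻¹) (fun a => - ((1 - a)/2) / ((1 + a)/2)), ?_, ?_⟩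
  · refine zhalf (by norm_num) (zero_mem_Sset _) ?_ (by norm_num) ?_ ?_
    · intro t h1 h2
      refine ⟨by fun_prop, by fun_prop, ?_, ?_, ?_, ?_⟩
      · rw [abs_of_nonneg (by linarith)]; linarith
      · rw [abs_of_nonneg (by linarith)]; linarith
      · field_simp
      · have : (1 + t) ≠ 0 := by linarith
        field_simp; ring
    · intro p hp hz hy hx
      have hz' : 0 < ‖p.2.2‖ := norm_pos_iff.2 hz
      set q := Hz (fun a => (1 + a)/2) (fun a => (1 - a)/2) p with hq
      have hq1 : ‖q.1‖ ≤ ‖p.2.2‖ / 8 := by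
        have hyz : ‖p.2.1 ^ 3 / p.2.2 ^ 2‖ ≤ ‖p.2.2‖ / 512 := by
          rw [norm_div, norm_pow, norm_pow, div_le_iff₀ (by positivity)]
          calc ‖p.2.1‖ ^ 3 ≤ (‖p.2.2‖ / 8) ^ 3 := by gcongr; linarith
            _ = _ := by ring
        obtain ⟨a1, a2⟩ := afun_mem p
        calc _ ≤ ‖(((1 + afun p)/2 : ℝ) : ℂ) * p.1‖ + ‖(((1 - afun p)/2 : ℝ) : ℂ) * (p.2.1 ^ 3 / p.2.2 ^ 2)‖ := norm_add_le _ _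
            _ ≤ 1 * (‖p.2.2‖/16) + 1 * (‖p.2.2‖ / 512) := by
              rw [norm_mul, norm_mul, Complex.norm_real, Complex.norm_real, Real.norm_of_nonneg (by linarith), Real.norm_of_nonneg (by linarith)]
              gcongr <;> linarith
            _ ≤ _ := by linarith
      have hqz2 : ‖q.1‖ ≤ ‖q.2.2‖ := show ‖q.1‖ ≤ ‖p.2.2‖ by linarith
      have hqa : afun q = afun p := afun_congr rfl (by
        rw [max_eq_right (by linarith [norm_nonneg p.1] : ‖p.1‖ ≤ ‖p.2.2‖)]
        exact max_eq_right (hqz2))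
      have hqz : az q = afun p := by
        rw [az, if_pos hqz2, hqa]
      have mp : mfun p = p.2.2 := mfun_z (by linarith)
      have mq : mfun q = p.2.2 := mfun_z (p := q) (show 4 * (‖q.1‖ + ‖p.2.1‖) ≤ ‖p.2.2‖ by linarith)
      have hp' : (p.2.1 ^ 3 - p.2.2 ^ 2 * p.1) * (p.2.1 ^ 3 + p.2.2 ^ 2 * p.1) + p.2.2 ^ 7 = 0 := by
        have : _ = _ := hp
        rw [mp] at this
        push_cast at this
        linear_combination this
      show _ = _
      rw [hqz, mq]
      have hZ : q.2.2 ^ 2 * q.1 = (((1 + afun p)/2 : ℝ):ℂ) * (p.2.2 ^ 2 * p.1) + (((1 - afun p)/2:ℝ):ℂ) * p.2.1 ^ 3 := by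
        simp only [hq, Hz]
        field_simp
      rw [hZ, show q.2.1 = p.2.1 from rfl, key, hp', mul_zero]
    · intro p hp h
      have : az p = 1 := by
        unfold az
        split_ifs with h1
        · exact h.resolve_left (not_lt.2 h1)
        · rfl
      show _ = _
      rw [this]
      exact hp
  · refine zhalf az_mem (zero_mem_Sset _) ?_ (by norm_num) ?_ ?_
    · intro t h1 h2
      have ht : (1 + t) / 2 ≠ 0 := by linarith
      refine ⟨ContDiffAt.inv (by fun_prop) ht, ContDiffAt.div (by fun_prop) (by fun_prop) ht, ?_, ?_, ?_, ?_⟩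
      · rw [abs_of_nonneg (by positivity), inv_le_comm₀ (by linarith) (by norm_num)]; linarith
      · rw [neg_div, abs_neg, abs_of_nonneg (div_nonneg (by linarith) (by linarith)), div_le_iff₀ (by linarith)]
        linarith
      · exact mul_inv_cancel₀ ht
      · rw [mul_div_cancel₀ _ ht]; ring
    · intro p hp hz hy hx
      have hz' : 0 < ‖p.2.2‖ := norm_pos_iff.2 hz
      set q := Hz (fun a => ((1 + a)/2)⁻¹) (fun a => - ((1 - a)/2) / ((1 + a)/2)) p with hq
      obtain ⟨a1, a2⟩ := afun_mem p
      have hq1 : ‖q.1‖ ≤ ‖p.2.2‖ / 8 := by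
        have hyz : ‖p.2.1 ^ 3 / p.2.2 ^ 2‖ ≤ ‖p.2.2‖ / 512 := by
          rw [norm_div, norm_pow, norm_pow, div_le_iff₀ (by positivity)]
          calc ‖p.2.1‖ ^ 3 ≤ (‖p.2.2‖ / 8) ^ 3 := by gcongr; linarith
            _ = _ := by ring
        calc _ ≤ ‖((((1 + afun p)/2)⁻¹ : ℝ) : ℂ) * p.1‖ + ‖((-((1 - afun p)/2) / ((1 + afun p)/2) : ℝ) : ℂ) * (p.2.1 ^ 3 / p.2.2 ^ 2)‖ := norm_add_le _ _
            _ ≤ 4/3 * (‖p.2.2‖/16) + 1/3 * (‖p.2.2‖ / 512) := by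
              rw [norm_mul, norm_mul, Complex.norm_real, Complex.norm_real]
              gcongr
              · rw [Real.norm_of_nonneg (by positivity), inv_le_comm₀ (by linarith) (by norm_num)]; linarith
              · linarith
              · rw [neg_div, norm_neg, Real.norm_of_nonneg (div_nonneg (by linarith) (by linarith)), div_le_iff₀ (by linarith)]
                linarith
            _ ≤ _ := by linarith
      have mp : mfun p = p.2.2 := mfun_z (by linarith)
      have mq : mfun q = p.2.2 := mfun_z (p := q) (show 4 * (‖q.1‖ + ‖p.2.1‖) ≤ ‖p.2.2‖ by linarith)
      have ap : az p = afun p := if_pos (by linarith [norm_nonneg p.1])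
      have hk : (((1 + afun p)/2 : ℝ):ℂ) ≠ 0 := by
        have : (1 + afun p)/2 ≠ 0 := by linarith
        exact_mod_cast this
      have hk' : (1 + (afun p:ℂ))/2 ≠ 0 := by
        have := hk; push_cast at this; exact this
      have hZ : p.2.2 ^ 2 * p.1 = (((1 + afun p)/2 : ℝ):ℂ) * (q.2.2 ^ 2 * q.1) + (((1 - afun p)/2:ℝ):ℂ) * p.2.1 ^ 3 := by
        have := inv (((1 + afun p)/2 : ℝ):ℂ) (((1 - afun p)/2:ℝ):ℂ) p.1 (p.2.1 ^ 3 / p.2.2 ^ 2) hk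
        simp only [hq, Hz, Complex.ofReal_div (-((1 - afun p)/2)), Complex.ofReal_neg, Complex.ofReal_inv]
        have e : p.2.2 ^ 2 * (p.2.1 ^ 3 / p.2.2 ^ 2) = p.2.1 ^ 3 := by field_simp
        linear_combination (-(p.2.2 ^ 2)) * this + (((1 - afun p)/2:ℝ):ℂ) * e
      have hp' : _ = _ := hp
      rw [ap, hZ, mp, key] at hp'
      have := (mul_eq_zero.1 hp').resolve_left (pow_ne_zero 2 hk')
      show _ = _
      rw [mq, show q.2.1 = p.2.1 from rfl]
      push_cast
      linear_combination this
    · intro p hp h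
      have : az p = 1 := by
        unfold az
        split_ifs with h1
        · exact h.resolve_left (not_lt.2 h1)
        · rfl
      have hp' : _ = _ := hp
      rw [this] at hp'
      exact hp'

theorem LL.compact {f : ℂ × ℂ → ℂ} {Q : Set (ℂ × ℂ)} (hQ : IsCompact Q) (h : ∀ p ∈ Q, LL f p) :
    ∃ M : ℝ, 0 < M ∧ (∀ p ∈ Q, ‖f p‖ ≤ M) ∧ ∀ p ∈ Q, ∀ q ∈ Q, ‖f p - f q‖ ≤ M * ‖p - q‖ := by
  have h1 : LocallyLipschitzOn Q f := by
    intro p hp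
    obtain ⟨K, s, hs, H⟩ := h p hp
    refine ⟨K.toNNReal, s, mem_nhdsWithin_of_mem_nhds hs, LipschitzOnWith.of_dist_le_mul ?_⟩
    intro x hx y hy
    rw [dist_eq_norm, dist_eq_norm]
    refine (H x hx y hy).trans ?_
    gcongr
    exact Real.le_coe_toNNReal K
  obtain ⟨K, hK⟩ := h1.exists_lipschitzOnWith_of_compact hQ
  obtain ⟨C, hC⟩ := hQ.exists_bound_of_continuousOn (f := f)
    (fun p hp => (h p hp).ca.continuousWithinAt)
  refine ⟨max 1 (max C K), by positivity, fun p hp => (hC p hp).trans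
    ((le_max_left _ _).trans (le_max_right _ _)), fun p hp q hq => ?_⟩
  have := hK.dist_le_mul p hp q hq
  rw [dist_eq_norm, dist_eq_norm] at this
  refine this.trans ?_
  gcongr
  exact (le_max_right _ _).trans (le_max_right _ _)

theorem contr {N : Set ℂ} (hN : IsCompact N) {c : ℂ} {B G : ℂ × ℂ → ℂ}
    (hB : ∀ w ∈ Metric.closedBall c (3/10), ∀ t ∈ N, LL B (w, t))
    (hG : ∀ w ∈ Metric.closedBall c (3/10), ∀ t ∈ N, LL G (w, t))
    (hc : ∀ w ∈ Metric.closedBall c (3/10), ∀ t ∈ N, ‖B (w, t) - c‖ ≤ 1/4)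
    (hl : ∀ w ∈ Metric.closedBall c (3/10), ∀ w' ∈ Metric.closedBall c (3/10), ∀ t ∈ N,
      ‖B (w, t) - B (w', t)‖ ≤ 3/10 * ‖w - w'‖) :
    ∃ (ε K : ℝ) (W : ℂ → ℂ → ℂ), 0 < ε ∧ 0 < K ∧ (∀ t ∈ N, ∀ z, ‖z‖ ≤ ε →
      W t z ∈ Metric.closedBall c (3/10) ∧ W t z = B (W t z, t) + z * G (W t z, t) ∧
      ∀ w ∈ Metric.closedBall c (3/10), w = B (w, t) + z * G (w, t) → w = W t z) ∧
      ∀ t ∈ N, ∀ z, ‖z‖ ≤ ε → ∀ t' ∈ N, ∀ z', ‖z'‖ ≤ ε →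
        ‖W t z - W t' z'‖ ≤ K * (‖t - t'‖ + ‖z - z'‖) := by
  set D := Metric.closedBall c (3/10) with hD
  have hQ : IsCompact (D ×ˢ N) := (isCompact_closedBall c (3/10)).prod hN
  obtain ⟨M, hM, -, hBl⟩ := LL.compact hQ (f := B) (fun p hp => hB p.1 hp.1 p.2 hp.2)
  obtain ⟨R, hR, hRb, hGl⟩ := LL.compact hQ (f := G) (fun p hp => hG p.1 hp.1 p.2 hp.2)
  set ε := 1 / (20 * R + 1) with hε
  have hε0 : 0 < ε := by positivity
  have hεR : ε * R ≤ 1/20 := by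
    rw [hε, div_mul_eq_mul_div, div_le_iff₀ (by positivity)]; linarith
  have hε1 : ε ≤ 1 := by
    rw [hε, div_le_iff₀ (by positivity)]; linarith
  have hw : ∀ t ∈ N, ∀ z : ℂ, ‖z‖ ≤ ε → ∀ w ∈ D, ∀ w' ∈ D,
      ‖(B (w, t) + z * G (w, t)) - (B (w', t) + z * G (w', t))‖ ≤ 1/2 * ‖w - w'‖ := by
    intro t ht z hz w hw w' hw'
    have e1 := hl w hw w' hw' t ht
    have e2 := hGl (w, t) ⟨hw, ht⟩ (w', t) ⟨hw', ht⟩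
    have e3 : ‖((w, t) : ℂ × ℂ) - (w', t)‖ = ‖w - w'‖ := by simp [Prod.norm_def]
    rw [e3] at e2
    calc _ = ‖(B (w, t) - B (w', t)) + z * (G (w, t) - G (w', t))‖ := by congr 1; ring
      _ ≤ ‖B (w, t) - B (w', t)‖ + ‖z‖ * ‖G (w, t) - G (w', t)‖ :=
        (norm_add_le _ _).trans (by rw [norm_mul])
      _ ≤ 3/10 * ‖w - w'‖ + ε * (R * ‖w - w'‖) := by gcongr
      _ ≤ _ := by nlinarith [norm_nonneg (w - w')]
  have hex : ∀ t ∈ N, ∀ z : ℂ, ‖z‖ ≤ ε → ∃ w ∈ D, w = B (w, t) + z * G (w, t) := by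
    intro t ht z hz
    have hms : MapsTo (fun w => B (w, t) + z * G (w, t)) D D := by
      intro w hw
      rw [hD, Metric.mem_closedBall, dist_eq_norm]
      calc _ = ‖(B (w, t) - c) + z * G (w, t)‖ := by congr 1; ring
        _ ≤ ‖B (w, t) - c‖ + ‖z‖ * ‖G (w, t)‖ := (norm_add_le _ _).trans (by rw [norm_mul])
        _ ≤ 1/4 + ε * R := by
          gcongr
          · exact hc w hw t ht
          · exact hRb (w, t) ⟨hw, ht⟩
        _ ≤ _ := by linarith
    have hcon : ContractingWith (1/2) (hms.restrict (fun w => B (w, t) + z * G (w, t)) D D) := by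
      refine ⟨by norm_num, LipschitzWith.of_dist_le_mul ?_⟩
      rintro ⟨x, hx⟩ ⟨y, hy⟩
      have := hw t ht z hz x hx y hy
      rw [← dist_eq_norm, ← dist_eq_norm] at this
      simpa [Subtype.dist_eq] using this
    obtain ⟨y, hy, hfix, -⟩ := hcon.exists_fixedPoint' (Metric.isClosed_closedBall.isComplete) hms
      (Metric.mem_closedBall_self (by norm_num)) (edist_ne_top _ _)
    exact ⟨y, hy, hfix.symm⟩
  choose! W hWD hWe using hex
  refine ⟨ε, 2 * (M + R + R), W, hε0, by positivity, fun t ht z hz => ⟨hWD t ht z hz, hWe t ht z hz,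
    fun w hwD hwe => ?_⟩, ?_⟩
  · have := hw t ht z hz w hwD _ (hWD t ht z hz)
    rw [← hwe, ← hWe t ht z hz] at this
    have h0 : ‖w - W t z‖ ≤ 0 := by linarith [norm_nonneg (w - W t z)]
    exact sub_eq_zero.1 (norm_le_zero_iff.1 h0)
  · intro t ht z hz t' ht' z' hz'
    have a := hWD t ht z hz
    have b := hWD t' ht' z' hz'
    set w := W t z
    set w' := W t' z'
    have e1 := hw t ht z hz w a w' b
    have e2 := hBl (w', t) ⟨b, ht⟩ (w', t') ⟨b, ht'⟩
    have e3 := hGl (w', t) ⟨b, ht⟩ (w', t') ⟨b, ht'⟩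
    have e4 := hRb (w', t') ⟨b, ht'⟩
    have e5 : ‖((w', t) : ℂ × ℂ) - (w', t')‖ = ‖t - t'‖ := by simp [Prod.norm_def]
    rw [e5] at e2 e3
    have key : w - w' = ((B (w, t) + z * G (w, t)) - (B (w', t) + z * G (w', t))) +
        (B (w', t) - B (w', t')) + z * (G (w', t) - G (w', t')) + (z - z') * G (w', t') := by
      linear_combination hWe t ht z hz - hWe t' ht' z' hz'
    have : ‖w - w'‖ ≤ 1/2 * ‖w - w'‖ + M * ‖t - t'‖ + 1 * (R * ‖t - t'‖) + ‖z - z'‖ * R := by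
      calc ‖w - w'‖ = _ := by rw [key]
        _ ≤ _ := norm_add₃_le.trans (add_le_add_left (add_le_add_left (norm_add_le _ _) _) _)
        _ ≤ _ := by
          rw [norm_mul, norm_mul]
          gcongr
          exact hz.trans hε1
    nlinarith [norm_nonneg (t - t'), norm_nonneg (z - z'), mul_nonneg hM.le (norm_nonneg (z - z')),
      mul_nonneg hR.le (norm_nonneg (z - z'))]

structure Good (a : CC → ℝ) : Prop where
  mem : ∀ p, 1/2 ≤ a p ∧ a p ≤ 1
  hom : ∀ (z : ℂ) (p : CC), z ≠ 0 → a (z • p) = a p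
  ll : ∀ p : CC, p ≠ 0 → LL a p
  lip : ∀ t w w' : ℂ, 9/20 ≤ ‖w‖ → 9/20 ≤ ‖w'‖ →
    |a (t ^ 3 * w, t, 1) - a (t ^ 3 * w', t, 1)| ≤ 3/10 * ‖w - w'‖
  half : ∀ p : CC, 500 * ‖p.2.1‖ ≤ max ‖p.1‖ ‖p.2.2‖ → a p = 1/2

theorem good_half : Good (fun _ => 1/2) :=
  ⟨by norm_num, by simp, fun p _ => LL.const _ _, fun t w w' _ _ => by simp, fun _ _ => rfl⟩

theorem log_lip {c s t : ℝ} (hc : 0 < c) (hs : c ≤ s) (ht : c ≤ t) :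
    |Real.log s - Real.log t| ≤ |s - t| / c := by
  have aux : ∀ s t : ℝ, c ≤ s → c ≤ t → Real.log s - Real.log t ≤ |s - t| / c := by
    intro s t hs ht
    have hs0 : 0 < s := by linarith
    have ht0 : 0 < t := by linarith
    rw [← Real.log_div hs0.ne' ht0.ne']
    calc _ ≤ s / t - 1 := Real.log_le_sub_one_of_pos (by positivity)
      _ = (s - t) / t := by field_simp
      _ ≤ |s - t| / t := by gcongr; exact le_abs_self _
      _ ≤ _ := by gcongr
  rw [abs_le]
  constructor
  · have := aux t s ht hs
    rw [abs_sub_comm] at this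
    linarith
  · exact aux s t hs ht

theorem clip_lip (u v : ℝ) : |max (-4) (min 0 u) - max (-4) (min 0 v)| ≤ |u - v| := by
  refine (abs_max_sub_max_le_max _ _ _ _).trans ?_
  simp only [sub_self, abs_zero]
  refine max_le (abs_nonneg _) ((abs_min_sub_min_le_max _ _ _ _).trans ?_)
  simp

theorem good_afun : Good afun := by
  refine ⟨afun_mem, ?_, fun p hp => afun_LL hp, ?_, fun p h => afun_half h⟩
  · intro z p hz
    have hz' : 0 < ‖z‖ := norm_pos_iff.2 hz
    unfold afun
    simp only [Prod.smul_fst, Prod.smul_snd, smul_eq_mul, norm_mul, mul_eq_zero, hz, false_or]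
    rw [← mul_max_of_nonneg _ _ hz'.le, mul_div_mul_left _ _ hz'.ne']
  · intro t w w' hw hw'
    unfold afun
    simp only
    split_ifs with ht
    · simp
    have ht' : 0 < ‖t‖ := norm_pos_iff.2 ht
    have hw0 : 0 < ‖w‖ := by linarith
    have hw0' : 0 < ‖w'‖ := by linarith
    have e : ∀ w : ℂ, 0 < ‖w‖ → Real.log (8 * (‖t‖ / max ‖t ^ 3 * w‖ ‖(1:ℂ)‖)) =
        Real.log (8 * ‖t‖) - max (Real.log (‖t‖ ^ 3) + Real.log ‖w‖) 0 := by
      intro w hw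
      have h1 : (0:ℝ) < max ‖t ^ 3 * w‖ ‖(1:ℂ)‖ := lt_max_of_lt_right (by simp)
      rw [← mul_div_assoc, Real.log_div (by positivity) h1.ne']
      congr 1
      rw [Real.strictMonoOn_log.monotoneOn.map_max, norm_mul, norm_pow,
        Real.log_mul (by positivity) (by positivity)]
      · simp
      · rw [norm_mul, norm_pow]; exact mem_Ioi.2 (by positivity)
      · simp
    rw [e w hw0, e w' hw0']
    set u := Real.log (8 * ‖t‖) - max (Real.log (‖t‖ ^ 3) + Real.log ‖w‖) 0
    set v := Real.log (8 * ‖t‖) - max (Real.log (‖t‖ ^ 3) + Real.log ‖w'‖) 0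
    have h1 : |u - v| ≤ |Real.log ‖w‖ - Real.log ‖w'‖| := by
      have : u - v = max (Real.log (‖t‖ ^ 3) + Real.log ‖w'‖) 0 -
        max (Real.log (‖t‖ ^ 3) + Real.log ‖w‖) 0 := by ring
      rw [this]
      refine (abs_max_sub_max_le_max _ _ _ _).trans ?_
      simp only [sub_self, abs_zero, add_sub_add_left_eq_sub]
      rw [abs_sub_comm]
      exact max_le le_rfl (abs_nonneg _)
    have h2 := log_lip (by norm_num : (0:ℝ) < 9/20) hw hw'
    have h3 := abs_norm_sub_norm_le w w'
    have h4 := clip_lip u v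
    rw [show (1 + max (-4) (min 0 u) / 8 - (1 + max (-4) (min 0 v) / 8)) =
      (max (-4) (min 0 u) - max (-4) (min 0 v)) / 8 by ring, abs_div, abs_of_pos (by norm_num : (0:ℝ) < 8)]
    have h5 : |‖w‖ - ‖w'‖| / (9/20) ≤ ‖w - w'‖ / (9/20) := by gcongr
    linarith [norm_nonneg (w - w')]

def SE (a : CC → ℝ) (t z w : ℂ) : Prop :=
  t ^ 6 * ((1 - w) * ((a (t ^ 3 * w, t, 1) : ℂ) + w)) +
    ((1 + (a (t ^ 3 * w, t, 1) : ℂ)) / 2) ^ 2 * (z * mfun (t ^ 3 * w, t, 1) ^ 7) = 0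

theorem SE_iff {a : CC → ℝ} (ha : Good a) {t z w : ℂ} (hz : z ≠ 0) :
    (z * (t ^ 3 * w), z * t, z) ∈ Sset a ↔ SE a t z w := by
  have e : ((z * (t ^ 3 * w), z * t, z) : CC) = z • ((t ^ 3 * w, t, 1) : CC) := by
    simp
  have h1 := ha.hom z (t ^ 3 * w, t, 1) hz
  have h2 := mfun_homog hz (t ^ 3 * w, t, 1)
  rw [← e] at h1 h2
  simp only [Sset, SE, mem_ofPred_eq, h1, h2]
  rw [← mul_right_inj' (pow_ne_zero 6 hz) (b := t ^ 6 * _ + _), mul_zero]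
  constructor <;> intro h <;> linear_combination h

def NN : Set ℂ := {t | 1/1000 ≤ ‖t‖ ∧ ‖t‖ ≤ 100}

theorem NN_compact : IsCompact NN := by
  refine (isCompact_closedBall (0:ℂ) 100).of_isClosed_subset ?_ ?_
  · exact (isClosed_le continuous_const continuous_norm).inter
      (isClosed_le continuous_norm continuous_const)
  · rintro t ⟨-, h⟩
    simpa using h

def Sheet (a : CC → ℝ) (c : ℂ) (ε K : ℝ) (W : ℂ → ℂ → ℂ) : Prop :=
  (∀ t ∈ NN, ∀ z, ‖z‖ ≤ ε →
      W t z ∈ Metric.closedBall c (3/10) ∧ SE a t z (W t z) ∧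
      ∀ w ∈ Metric.closedBall c (3/10), SE a t z w → w = W t z) ∧
      ∀ t ∈ NN, ∀ z, ‖z‖ ≤ ε → ∀ t' ∈ NN, ∀ z', ‖z'‖ ≤ ε →
        ‖W t z - W t' z'‖ ≤ K * (‖t - t'‖ + ‖z - z'‖)

theorem NN_ne {t : ℂ} (h : t ∈ NN) : t ≠ 0 := by
  intro h0
  have := h.1
  rw [h0, norm_zero] at this
  norm_num at this

theorem LLq (w t : ℂ) : LL (fun q : ℂ × ℂ => ((q.2 ^ 3 * q.1, q.2, 1) : CC)) (w, t) :=
  (((LL.id (w, t)).snd.pow 3).mul (LL.id (w, t)).fst).prodMk ((LL.id (w, t)).snd.prodMk (LL.const _ _))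

theorem q_ne (w t : ℂ) : ((t ^ 3 * w, t, 1) : CC) ≠ 0 := by
  intro h
  have := congrArg (fun p : CC => p.2.2) h
  simp at this

theorem plus_re {w : ℂ} (h : w ∈ Metric.closedBall (1:ℂ) (3/10)) : 7/10 ≤ w.re := by
  rw [Metric.mem_closedBall, dist_eq_norm] at h
  have := (abs_le.1 ((Complex.abs_re_le_norm (w - 1)).trans h)).1
  simp at this
  linarith

theorem minus_re {w : ℂ} (h : w ∈ Metric.closedBall (-3/4:ℂ) (3/10)) : w.re ≤ -9/20 := by
  rw [Metric.mem_closedBall, dist_eq_norm] at h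
  have := (abs_le.1 ((Complex.abs_re_le_norm (w - (-3/4))).trans h)).2
  have e : (-3/4 : ℂ) = ((-3/4 : ℝ) : ℂ) := by push_cast; ring
  rw [e, Complex.sub_re, Complex.ofReal_re] at this
  linarith

theorem sheet_plus {a : CC → ℝ} (ha : Good a) :
    ∃ (ε K : ℝ) (W : ℂ → ℂ → ℂ), 0 < ε ∧ 0 < K ∧ Sheet a 1 ε K W := by
  have hden : ∀ w ∈ Metric.closedBall (1:ℂ) (3/10), ∀ t : ℂ, (a (t ^ 3 * w, t, 1) : ℂ) + w ≠ 0 := by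
    intro w hw t h
    have h1 := congrArg Complex.re h
    rw [Complex.add_re, Complex.ofReal_re, Complex.zero_re] at h1
    linarith [plus_re hw, (ha.mem (t ^ 3 * w, t, 1)).1]
  obtain ⟨ε, K, W, h1, h2, h3, h4⟩ := contr NN_compact (c := 1) (B := fun _ => 1)
    (G := fun q => ((1 + (a (q.2 ^ 3 * q.1, q.2, 1) : ℂ)) / 2) ^ 2 * mfun (q.2 ^ 3 * q.1, q.2, 1) ^ 7 /
      (q.2 ^ 6 * ((a (q.2 ^ 3 * q.1, q.2, 1) : ℂ) + q.1)))
    (fun w _ t _ => LL.const _ _) (by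
      intro w hw t ht
      have l1 : LL (fun q : ℂ × ℂ => (a (q.2 ^ 3 * q.1, q.2, 1) : ℂ)) (w, t) :=
        (LL.comp (g := a) (f := fun q : ℂ × ℂ => ((q.2 ^ 3 * q.1, q.2, 1) : CC)) (ha.ll _ (q_ne w t)) (LLq w t)).ofReal
      have l2 : LL (fun q : ℂ × ℂ => mfun (q.2 ^ 3 * q.1, q.2, 1)) (w, t) :=
        LL.comp (g := mfun) (mfun_LL (q_ne w t)) (LLq w t)
      exact ((((((LL.const _ _).add l1).div (LL.const _ _) two_ne_zero).pow 2).mul (l2.pow 7)).div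
        (((LL.id (w, t)).snd.pow 6).mul (l1.add (LL.id (w, t)).fst))
        (mul_ne_zero (pow_ne_zero 6 (NN_ne ht)) (hden w hw t)))) (by intros; norm_num)
      (by intros; simp)
  have key : ∀ w ∈ Metric.closedBall (1:ℂ) (3/10), ∀ t ∈ NN, ∀ z : ℂ, (SE a t z w ↔ w = 1 + z *
      (((1 + (a (t ^ 3 * w, t, 1) : ℂ)) / 2) ^ 2 * mfun (t ^ 3 * w, t, 1) ^ 7 /
      (t ^ 6 * ((a (t ^ 3 * w, t, 1) : ℂ) + w)))) := by
    intro w hw t ht z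
    have d1 := hden w hw t
    have d2 := NN_ne ht
    unfold SE
    rw [← mul_div_assoc, ← sub_eq_iff_eq_add', eq_div_iff (by positivity)]
    constructor <;> intro h <;> linear_combination -h
  refine ⟨ε, K, W, h1, h2, fun t ht z hz => ?_, h4⟩
  obtain ⟨g1, g2, g3⟩ := h3 t ht z hz
  exact ⟨g1, (key _ g1 t ht z).2 g2, fun w hw hs => g3 w hw ((key w hw t ht z).1 hs)⟩

theorem sheet_minus {a : CC → ℝ} (ha : Good a) :
    ∃ (ε K : ℝ) (W : ℂ → ℂ → ℂ), 0 < ε ∧ 0 < K ∧ Sheet a (-3/4) ε K W := by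
  have hden : ∀ w ∈ Metric.closedBall (-3/4:ℂ) (3/10), 1 - w ≠ 0 := by
    intro w hw h
    have h1 := congrArg Complex.re h
    simp at h1
    linarith [minus_re hw]
  have hnw : ∀ w ∈ Metric.closedBall (-3/4:ℂ) (3/10), 9/20 ≤ ‖w‖ := by
    intro w hw
    have := (abs_le.1 (Complex.abs_re_le_norm w)).1
    linarith [minus_re hw]
  obtain ⟨ε, K, W, h1, h2, h3, h4⟩ := contr NN_compact (c := -3/4)
    (B := fun q => -(a (q.2 ^ 3 * q.1, q.2, 1) : ℂ))
    (G := fun q => -(((1 + (a (q.2 ^ 3 * q.1, q.2, 1) : ℂ)) / 2) ^ 2 * mfun (q.2 ^ 3 * q.1, q.2, 1) ^ 7 /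
      (q.2 ^ 6 * (1 - q.1))))
    (by
      intro w hw t ht
      exact (LL.comp (g := a) (f := fun q : ℂ × ℂ => ((q.2 ^ 3 * q.1, q.2, 1) : CC)) (ha.ll _ (q_ne w t)) (LLq w t)).ofReal.neg) (by
      intro w hw t ht
      have l1 : LL (fun q : ℂ × ℂ => (a (q.2 ^ 3 * q.1, q.2, 1) : ℂ)) (w, t) :=
        (LL.comp (g := a) (f := fun q : ℂ × ℂ => ((q.2 ^ 3 * q.1, q.2, 1) : CC)) (ha.ll _ (q_ne w t)) (LLq w t)).ofReal
      have l2 : LL (fun q : ℂ × ℂ => mfun (q.2 ^ 3 * q.1, q.2, 1)) (w, t) :=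
        LL.comp (g := mfun) (mfun_LL (q_ne w t)) (LLq w t)
      exact ((((((LL.const _ _).add l1).div (LL.const _ _) two_ne_zero).pow 2).mul (l2.pow 7)).div
        (((LL.id (w, t)).snd.pow 6).mul ((LL.const _ _).sub (LL.id (w, t)).fst))
        (mul_ne_zero (pow_ne_zero 6 (NN_ne ht)) (hden w hw))).neg) (by
      intro w hw t ht
      have e : -(a (t ^ 3 * w, t, 1) : ℂ) - (-3/4) = ((3/4 - a (t ^ 3 * w, t, 1) : ℝ) : ℂ) := by
        push_cast; ring
      show ‖-(a (t ^ 3 * w, t, 1) : ℂ) - (-3/4)‖ ≤ 1/4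
      rw [e, Complex.norm_real, Real.norm_eq_abs, abs_le]
      have := ha.mem (t ^ 3 * w, t, 1)
      constructor <;> linarith)
      (by
        intro w hw w' hw' t ht
        have := ha.lip t w w' (hnw w hw) (hnw w' hw')
        show ‖-(a (t ^ 3 * w, t, 1) : ℂ) - (-(a (t ^ 3 * w', t, 1) : ℂ))‖ ≤ _
        rw [neg_sub_neg, ← Complex.ofReal_sub, Complex.norm_real, Real.norm_eq_abs, abs_sub_comm]
        exact this)
  have key : ∀ w ∈ Metric.closedBall (-3/4:ℂ) (3/10), ∀ t ∈ NN, ∀ z : ℂ, (SE a t z w ↔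
      w = -(a (t ^ 3 * w, t, 1) : ℂ) + z *
      -(((1 + (a (t ^ 3 * w, t, 1) : ℂ)) / 2) ^ 2 * mfun (t ^ 3 * w, t, 1) ^ 7 /
      (t ^ 6 * (1 - w)))) := by
    intro w hw t ht z
    have d1 := hden w hw
    have d2 := NN_ne ht
    unfold SE
    rw [mul_neg, ← mul_div_assoc, ← sub_eq_iff_eq_add', ← neg_div, eq_div_iff (by positivity)]
    constructor <;> intro h <;> linear_combination h
  refine ⟨ε, K, W, h1, h2, fun t ht z hz => ?_, h4⟩
  obtain ⟨g1, g2, g3⟩ := h3 t ht z hz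
  exact ⟨g1, (key _ g1 t ht z).2 g2, fun w hw hs => g3 w hw ((key w hw t ht z).1 hs)⟩

def Mid (p : CC) : Prop := ‖p.2.2‖ < 1000 * ‖p.2.1‖ ∧ ‖p.2.1‖ < 100 * ‖p.2.2‖ ∧ ‖p.1‖ < 10 ^ 6 * ‖p.2.2‖

def wof (p : CC) : ℂ := p.2.2 ^ 2 * p.1 / p.2.1 ^ 3

open Classical in
def s2map (Wp Wm : ℂ → ℂ → ℂ) (p : CC) : CC :=
  if Mid p then (p.2.2 * ((p.2.1 / p.2.2) ^ 3 * (if 0 < (wof p).re then Wp (p.2.1 / p.2.2) p.2.2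
    else Wm (p.2.1 / p.2.2) p.2.2)), p.2.1, p.2.2) else p

theorem Mid.z {p : CC} (h : Mid p) : p.2.2 ≠ 0 := by
  intro h0
  have := h.2.1
  rw [h0, norm_zero] at this
  linarith [norm_nonneg p.2.1]

theorem Mid.y {p : CC} (h : Mid p) : p.2.1 ≠ 0 := by
  intro h0
  have := h.1
  rw [h0, norm_zero] at this
  linarith [norm_nonneg p.2.2]

theorem Mid.t {p : CC} (h : Mid p) : p.2.1 / p.2.2 ∈ NN := by
  have hz := norm_pos_iff.2 h.z
  refine ⟨?_, ?_⟩
  · rw [norm_div, le_div_iff₀ hz]; linarith [h.1]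
  · rw [norm_div, div_le_iff₀ hz]; linarith [h.2.1]

theorem Mid.eq {p : CC} (h : Mid p) :
    p = (p.2.2 * ((p.2.1 / p.2.2) ^ 3 * wof p), p.2.2 * (p.2.1 / p.2.2), p.2.2) := by
  have hz := h.z
  have hy := h.y
  refine Prod.ext ?_ (Prod.ext ?_ rfl)
  · simp only [wof]; field_simp
  · simp only; field_simp

theorem loc00 {b : CC → ℝ} (hb : ∀ p, 1/2 ≤ b p ∧ b p ≤ 1) {p : CC} (hp : p ∈ Sset b) :
    ‖p.2.1 ^ 3 - p.2.2 ^ 2 * p.1‖ * ‖(b p : ℂ) * p.2.1 ^ 3 + p.2.2 ^ 2 * p.1‖ ≤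
      12 ^ 7 * ‖p‖ * ‖p‖ ^ 6 := by
  have h1 : (p.2.1 ^ 3 - p.2.2 ^ 2 * p.1) * ((b p : ℂ) * p.2.1 ^ 3 + p.2.2 ^ 2 * p.1) =
    - (((1 + (b p : ℂ)) / 2) ^ 2 * mfun p ^ 7) := by
    have : _ = _ := hp
    linear_combination this
  rw [← norm_mul, h1, norm_neg, norm_mul, norm_pow, norm_pow]
  have h2 : ‖(1 + (b p : ℂ)) / 2‖ ≤ 1 := by
    have : (1 + (b p : ℂ)) / 2 = (((1 + b p) / 2 : ℝ) : ℂ) := by push_cast; ring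
    rw [this, Complex.norm_real, Real.norm_of_nonneg (by linarith [(hb p).1])]
    linarith [(hb p).2]
  calc _ ≤ 1 ^ 2 * (12 * ‖p‖) ^ 7 := by gcongr; exact mfun_bound p
    _ = 12 ^ 7 * ‖p‖ * ‖p‖ ^ 6 := by ring

def eps1 : ℝ := 1 / (12 ^ 7 * 10 ^ 57)
theorem eps1_pos : 0 < eps1 := by unfold eps1; positivity

theorem locM {b : CC → ℝ} (hb : ∀ p, 1/2 ≤ b p ∧ b p ≤ 1) {p : CC} (hp : p ∈ Sset b)
    (hn : ‖p‖ < eps1) (hm : Mid p) : wof p ∈ Metric.closedBall (1:ℂ) (3/10) ∨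
      wof p ∈ Metric.closedBall (-3/4:ℂ) (3/10) := by
  have h := loc00 hb hp
  have hy := norm_pos_iff.2 hm.y
  have hy0 := hm.y
  have hpn : ‖p‖ ≤ 10 ^ 9 * ‖p.2.1‖ := by
    obtain ⟨h1, h2, h3⟩ := hm
    exact CC.norm_le (by linarith) (by linarith) (by linarith)
  have e1 : p.2.1 ^ 3 - p.2.2 ^ 2 * p.1 = p.2.1 ^ 3 * (1 - wof p) := by
    unfold wof; field_simp
  have e2 : (b p : ℂ) * p.2.1 ^ 3 + p.2.2 ^ 2 * p.1 = p.2.1 ^ 3 * (b p + wof p) := by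
    unfold wof; field_simp
  rw [e1, e2, norm_mul, norm_mul, norm_pow] at h
  have h2 : ‖1 - wof p‖ * ‖(b p : ℂ) + wof p‖ * ‖p.2.1‖ ^ 6 ≤ 1/1000 * ‖p.2.1‖ ^ 6 := by
    calc _ = ‖p.2.1‖ ^ 3 * ‖1 - wof p‖ * (‖p.2.1‖ ^ 3 * ‖(b p : ℂ) + wof p‖) := by ring
      _ ≤ _ := h
      _ ≤ 12 ^ 7 * eps1 * (10 ^ 9 * ‖p.2.1‖) ^ 6 := by
        have := eps1_pos
        gcongr
      _ = _ := by unfold eps1; rw [mul_pow]; norm_num; ring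
  have h3 := le_of_mul_le_mul_right h2 (by positivity)
  by_cases hw : ‖1 - wof p‖ ≤ 3/10
  · left
    rwa [Metric.mem_closedBall, dist_comm, dist_eq_norm]
  · right
    push Not at hw
    have h4 : ‖(b p : ℂ) + wof p‖ ≤ 1/20 := by
      by_contra hc
      push Not at hc
      nlinarith
    rw [Metric.mem_closedBall, dist_eq_norm]
    have h5 : ‖((3/4 - b p : ℝ) : ℂ)‖ ≤ 1/4 := by
      rw [Complex.norm_real, Real.norm_eq_abs, abs_le]
      constructor <;> linarith [(hb p).1, (hb p).2]
    calc _ = ‖((b p : ℂ) + wof p) + ((3/4 - b p : ℝ) : ℂ)‖ := by congr 1; push_cast; ring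
      _ ≤ _ := norm_add_le _ _
      _ ≤ _ := by linarith

theorem locN {b : CC → ℝ} (hb : ∀ p, 1/2 ≤ b p ∧ b p ≤ 1) {p : CC} (hp : p ∈ Sset b)
    (hn : ‖p‖ < eps1) (hp0 : p ≠ 0) (hm : ¬ Mid p) : 500 * ‖p.2.1‖ < max ‖p.1‖ ‖p.2.2‖ := by
  by_contra hc
  push Not at hc
  have hx := (le_max_left _ _).trans hc
  have hz := (le_max_right _ _).trans hc
  have hy0 : p.2.1 ≠ 0 := by
    intro h0
    rw [h0, norm_zero, mul_zero] at hx hz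
    exact hp0 (Prod.ext (norm_le_zero_iff.1 hx) (Prod.ext h0 (norm_le_zero_iff.1 hz)))
  have hy := norm_pos_iff.2 hy0
  have hyz : 100 * ‖p.2.2‖ ≤ ‖p.2.1‖ := by
    by_contra h
    push Not at h
    exact hm ⟨by linarith, h, by linarith⟩
  have h := loc00 hb hp
  have hpn : ‖p‖ ≤ 500 * ‖p.2.1‖ := CC.norm_le (by linarith) (by linarith) (by linarith)
  have hZ : ‖p.2.2 ^ 2 * p.1‖ ≤ 1/20 * ‖p.2.1‖ ^ 3 := by
    rw [norm_mul, norm_pow]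
    calc _ ≤ (‖p.2.1‖/100) ^ 2 * (500 * ‖p.2.1‖) := by gcongr; linarith
      _ = _ := by ring
  have h1 : 19/20 * ‖p.2.1‖ ^ 3 ≤ ‖p.2.1 ^ 3 - p.2.2 ^ 2 * p.1‖ := by
    have := norm_sub_norm_le (p.2.1 ^ 3) (p.2.2 ^ 2 * p.1)
    rw [norm_pow] at this
    linarith
  have h2 : 9/20 * ‖p.2.1‖ ^ 3 ≤ ‖(b p : ℂ) * p.2.1 ^ 3 + p.2.2 ^ 2 * p.1‖ := by
    have := norm_sub_le_norm_add ((b p : ℂ) * p.2.1 ^ 3) (p.2.2 ^ 2 * p.1)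
    rw [norm_mul, norm_pow, Complex.norm_real, Real.norm_of_nonneg (by linarith [(hb p).1])] at this
    have h5 := mul_le_mul_of_nonneg_right (hb p).1 (by positivity : 0 ≤ ‖p.2.1‖ ^ 3)
    linarith
  have h3 : 4/10 * ‖p.2.1‖ ^ 6 ≤ 1/10 * ‖p.2.1‖ ^ 6 := by
    calc _ ≤ (19/20 * ‖p.2.1‖ ^ 3) * (9/20 * ‖p.2.1‖ ^ 3) := by nlinarith [pow_pos hy 6]
      _ ≤ _ := mul_le_mul h1 h2 (by positivity) (by positivity)
      _ ≤ _ := h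
      _ ≤ 12 ^ 7 * eps1 * (500 * ‖p.2.1‖) ^ 6 := by
        have := eps1_pos
        gcongr
      _ ≤ _ := by
        rw [mul_pow, ← mul_assoc]
        gcongr
        unfold eps1; norm_num
  linarith [pow_pos hy 6]

theorem s2fix {b : CC → ℝ} (hb : Good b) {Wp Wm : ℂ → ℂ → ℂ} {ε K : ℝ} (hp : Sheet b 1 ε K Wp)
    (hm : Sheet b (-3/4) ε K Wm) {p : CC} (h : p ∈ Sset b) (hn : ‖p‖ < eps1) (hn' : ‖p‖ ≤ ε) :
    s2map Wp Wm p = p := by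
  by_cases hM : Mid p
  · have hz : ‖p.2.2‖ ≤ ε := (CC.le p).2.2.trans hn'
    have hs : SE b (p.2.1 / p.2.2) p.2.2 (wof p) := by
      rw [hM.eq] at h
      exact (SE_iff hb hM.z).1 h
    have : s2map Wp Wm p = (p.2.2 * ((p.2.1 / p.2.2) ^ 3 * wof p), p.2.2 * (p.2.1 / p.2.2), p.2.2) := by
      unfold s2map
      rw [if_pos hM, mul_div_cancel₀ _ hM.z]
      rcases locM hb.mem h hn hM with hw | hw
      · rw [if_pos (by linarith [plus_re hw]), ← (hp.1 _ hM.t _ hz).2.2 _ hw hs]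
      · rw [if_neg (by linarith [minus_re hw]), ← (hm.1 _ hM.t _ hz).2.2 _ hw hs]
    exact this.trans hM.eq.symm
  · exact if_neg hM

theorem Mid_open {p : CC} (h : Mid p) : ∀ᶠ q in 𝓝 p, Mid q := by
  have h1 := (LLx p).norm.ca
  have h2 := (LLy p).norm.ca
  have h3 := (LLz p).norm.ca
  exact (h3.eventually_lt (h2.const_mul 1000) h.1).and
    ((h2.eventually_lt (h3.const_mul 100) h.2.1).and (h1.eventually_lt (h3.const_mul (10 ^ 6)) h.2.2))

theorem lip_graph {z z' t t' w w' : ℂ} {D d K : ℝ} (ht : ‖t‖ ≤ 100) (ht' : ‖t'‖ ≤ 100) (hw : ‖w‖ ≤ 2)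
    (hw' : ‖w'‖ ≤ 2) (h1 : ‖z - z'‖ ≤ d) (h2 : ‖z'‖ * ‖t - t'‖ ≤ 101 * d) (hz : ‖z'‖ ≤ 1) (hK : 0 ≤ K)
    (h3 : ‖w - w'‖ ≤ K * (‖t - t'‖ + ‖z - z'‖)) :
    ‖z * (t ^ 3 * w) - z' * (t' ^ 3 * w')‖ ≤ 10 ^ 9 * (1 + K) * d := by
  have hd : 0 ≤ d := (norm_nonneg _).trans h1
  have e : z * (t ^ 3 * w) - z' * (t' ^ 3 * w') = (z - z') * (t ^ 3 * w) +
    z' * (t - t') * ((t ^ 2 + t * t' + t' ^ 2) * w) + t' ^ 3 * (z' * (w - w')) := by ring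
  have h4 : ‖z' * (w - w')‖ ≤ K * (102 * d) := by
    rw [norm_mul]
    calc _ ≤ ‖z'‖ * (K * (‖t - t'‖ + ‖z - z'‖)) := by gcongr
      _ = K * (‖z'‖ * ‖t - t'‖ + ‖z'‖ * ‖z - z'‖) := by ring
      _ ≤ K * (101 * d + 1 * d) := by gcongr
      _ = _ := by ring
  have h5 : ‖t ^ 2 + t * t' + t' ^ 2‖ ≤ 30000 := by
    refine norm_add₃_le.trans ?_
    rw [norm_pow, norm_pow, norm_mul]
    calc _ ≤ (100:ℝ) ^ 2 + 100 * 100 + 100 ^ 2 := by gcongr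
      _ = _ := by norm_num
  rw [e]
  refine norm_add₃_le.trans ?_
  rw [norm_mul, norm_mul, norm_mul (z' * (t - t')), norm_mul z', norm_mul _ w, norm_mul (t' ^ 3), norm_pow, norm_pow]
  calc _ ≤ d * (100 ^ 3 * 2) + 101 * d * (30000 * 2) + 100 ^ 3 * (K * (102 * d)) := by gcongr
    _ ≤ _ := by nlinarith [mul_nonneg hK hd]

theorem s2half {b b' : CC → ℝ} (hb : Good b) (hb' : Good b') {Wp Wm Wp' Wm' : ℂ → ℂ → ℂ} {ε K : ℝ}
    (hε : 0 < ε) (hK : 0 < K)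
    (hp : Sheet b 1 ε K Wp) (hm : Sheet b (-3/4) ε K Wm)
    (hp' : Sheet b' 1 ε K Wp') (hm' : Sheet b' (-3/4) ε K Wm') :
    ∃ K ε, Half (Sset b) (Sset b') (s2map Wp' Wm') (s2map Wp Wm) K ε := by
  refine ⟨10 ^ 9 * (1 + K), min 1 (min ε eps1), by positivity,
    lt_min one_pos (lt_min hε eps1_pos), fun p hpS hn => ?_⟩
  have hn1 : ‖p‖ < 1 := hn.trans_le (min_le_left _ _)
  have hnε : ‖p‖ < ε := hn.trans_le ((min_le_right _ _).trans (min_le_left _ _))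
  have hne : ‖p‖ < eps1 := hn.trans_le ((min_le_right _ _).trans (min_le_right _ _))
  have hK1 : ∀ r : ℝ, 0 ≤ r → r ≤ 10 ^ 9 * (1 + K) * r := fun r hr => by
    nlinarith [mul_nonneg hK.le hr]
  -- where a = 1/2
  have hsame : ∀ q ∈ Sset b, 500 * ‖q.2.1‖ ≤ max ‖q.1‖ ‖q.2.2‖ → q ∈ Sset b' := by
    intro q hq h
    have e1 := hb.half q h
    have e2 := hb'.half q h
    simp only [Sset, mem_ofPred_eq] at hq ⊢
    rw [e1] at hq
    rw [e2]
    exact hq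
  have hid : 500 * ‖p.2.1‖ ≤ max ‖p.1‖ ‖p.2.2‖ → s2map Wp' Wm' p ∈ Sset b' ∧
      s2map Wp Wm (s2map Wp' Wm' p) = p := by
    intro h
    have h1 := hsame p hpS h
    rw [s2fix hb' hp' hm' h1 hne hnε.le]
    exact ⟨h1, s2fix hb hp hm hpS hne hnε.le⟩
  by_cases hM : Mid p
  · have hz : ‖p.2.2‖ ≤ ε := (CC.le p).2.2.trans hnε.le
    have hz0 := hM.z
    have hw := locM hb.mem hpS hne hM
    have bp : ∀ w ∈ Metric.closedBall (1:ℂ) (3/10), ‖w‖ ≤ 2 := by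
      intro w hw
      rw [Metric.mem_closedBall, dist_eq_norm] at hw
      have := norm_le_norm_add_norm_sub' w 1
      rw [norm_one] at this
      linarith
    have bm : ∀ w ∈ Metric.closedBall (-3/4:ℂ) (3/10), ‖w‖ ≤ 2 := by
      intro w hw
      rw [Metric.mem_closedBall, dist_eq_norm] at hw
      have := norm_le_norm_add_norm_sub' w (-3/4)
      have e : ‖(-3/4:ℂ)‖ = 3/4 := by norm_num
      rw [e] at this
      linarith
    -- the local description
    obtain ⟨W, W2, c, hcs, hW, hW2, hwD, hsg⟩ : ∃ (W W2 : ℂ → ℂ → ℂ) (c : ℂ), (∀ w ∈ Metric.closedBall c (3/10), ‖w‖ ≤ 2)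
        ∧ Sheet b' c ε K W ∧ Sheet b c ε K W2 ∧
        wof p ∈ Metric.closedBall c (3/10) ∧ ∃ P : ℂ → Prop, (∀ᶠ q in 𝓝 p, P (wof q)) ∧
        (∀ w ∈ Metric.closedBall c (3/10), P w) ∧ ∀ q, Mid q → P (wof q) → s2map Wp' Wm' q =
          (q.2.2 * ((q.2.1 / q.2.2) ^ 3 * W (q.2.1 / q.2.2) q.2.2), q.2.1, q.2.2) ∧
          s2map Wp Wm q =
          (q.2.2 * ((q.2.1 / q.2.2) ^ 3 * W2 (q.2.1 / q.2.2) q.2.2), q.2.1, q.2.2) := by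
      have hca : ContinuousAt (fun q => (wof q).re) p := by
        refine Complex.continuous_re.continuousAt.comp ?_
        exact (((LLz p).pow 2).mul (LLx p) |>.div ((LLy p).pow 3) (pow_ne_zero 3 hM.y)).ca
      rcases hw with hw | hw
      · refine ⟨Wp', Wp, 1, bp, hp', hp, hw, fun w => 0 < w.re, hca.eventually_const_lt (by linarith [plus_re hw]),
          fun w hw => by linarith [plus_re hw], fun q hq hs => ?_⟩
        unfold s2map
        rw [if_pos hq, if_pos hs, if_pos hq, if_pos hs]
        exact ⟨rfl, rfl⟩
      · refine ⟨Wm', Wm, -3/4, bm, hm', hm, hw, fun w => w.re < 0, hca.eventually_lt_const (by linarith [minus_re hw]),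
          fun w hw => by linarith [minus_re hw], fun q hq hs => ?_⟩
        unfold s2map
        rw [if_pos hq, if_neg hs.not_gt, if_pos hq, if_neg hs.not_gt]
        exact ⟨rfl, rfl⟩
    obtain ⟨P, hP1, hP2, hP3⟩ := hsg
    have hφ := (hP3 p hM (hP2 _ hwD)).1
    have hWp := hW.1 _ hM.t _ hz
    have hnt := hM.t.2
    have hWn := hcs _ hWp.1
    have part1 : s2map Wp' Wm' p ∈ Sset b' ∧ s2map Wp Wm (s2map Wp' Wm' p) = p := by
      by_cases h5 : 500 * ‖p.2.1‖ ≤ max ‖p.1‖ ‖p.2.2‖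
      · exact hid h5
      push Not at h5
      have hx5 := (le_max_left _ _).trans_lt h5
      have hwlow : 9/20 ≤ ‖wof p‖ := by
        rcases hw with hw | hw
        · have := Complex.re_le_norm (wof p)
          linarith [plus_re hw]
        · have := (abs_le.1 (Complex.abs_re_le_norm (wof p))).1
          linarith [minus_re hw]
      have hzp : 0 < ‖p.2.2‖ := norm_pos_iff.2 hz0
      have hx' : ‖p.2.2 * ((p.2.1 / p.2.2) ^ 3 * W (p.2.1 / p.2.2) p.2.2)‖ < 10 ^ 6 * ‖p.2.2‖ := by
        have e1 : ‖p.1‖ = ‖p.2.2‖ * (‖p.2.1 / p.2.2‖ ^ 3 * ‖wof p‖) := by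
          rw [← norm_pow, ← norm_mul, ← norm_mul]
          exact congrArg (fun q : CC => ‖q.1‖) hM.eq
        have hy2 := hM.2.1
        rw [norm_mul, norm_mul, norm_pow]
        calc _ ≤ ‖p.2.2‖ * (‖p.2.1 / p.2.2‖ ^ 3 * (5 * ‖wof p‖)) := by gcongr; linarith
          _ = 5 * ‖p.1‖ := by rw [e1]; ring
          _ < _ := by linarith
      have hφ2 : s2map Wp' Wm' p = (p.2.2 * ((p.2.1 / p.2.2) ^ 3 * W (p.2.1 / p.2.2) p.2.2),
          p.2.2 * (p.2.1 / p.2.2), p.2.2) := by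
        rw [hφ, mul_div_cancel₀ _ hz0]
      refine ⟨by rw [hφ2]; exact (SE_iff hb' hz0).2 hWp.2.1, ?_⟩
      have hM' : Mid (s2map Wp' Wm' p) := by
        rw [hφ]; exact ⟨hM.1, hM.2.1, hx'⟩
      have hwof : wof (s2map Wp' Wm' p) = W (p.2.1 / p.2.2) p.2.2 := by
        rw [hφ]; unfold wof
        simp only
        have := hM.y
        field_simp
      rw [(hP3 _ hM' (by rw [hwof]; exact hP2 _ hWp.1)).2, hφ]
      simp only
      have hs : SE b (p.2.1 / p.2.2) p.2.2 (wof p) := by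
        have h := hpS
        rw [hM.eq] at h
        exact (SE_iff hb hM.z).1 h
      rw [← (hW2.1 _ hM.t _ hz).2.2 _ hwD hs]
      have := hM.eq
      rw [mul_div_cancel₀ _ hz0] at this
      exact this.symm
    refine ⟨part1.1, part1.2, ?_, fun _ => ?_⟩
    · rw [hφ]
      refine CC.norm_le ?_ ((CC.le p).2.1.trans (hK1 _ (norm_nonneg _)))
        ((CC.le p).2.2.trans (hK1 _ (norm_nonneg _)))
      rw [norm_mul, norm_mul, norm_pow]
      calc _ ≤ ‖p‖ * (100 ^ 3 * 2) := by gcongr; exact (CC.le p).2.2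
        _ ≤ _ := by nlinarith [mul_nonneg hK.le (norm_nonneg p), norm_nonneg p]
    · have hev : ∀ᶠ q : CC in 𝓝 p, ‖q‖ < min 1 ε :=
        continuous_norm.continuousAt.eventually_lt_const (lt_min hn1 hnε)
      refine ⟨_, mem_nhdsWithin_of_mem_nhds (hev.and ((Mid_open hM).and hP1)), ?_⟩
      rintro q ⟨hq1, hq2, hq3⟩ q' ⟨hq1', hq2', hq3'⟩
      have hqz : ‖q.2.2‖ ≤ ε := (CC.le q).2.2.trans (hq1.le.trans (min_le_right _ _))
      have hqz' : ‖q'.2.2‖ ≤ ε := (CC.le q').2.2.trans (hq1'.le.trans (min_le_right _ _))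
      rw [(hP3 q hq2 hq3).1, (hP3 q' hq2' hq3').1]
      have d := CC.le (q - q')
      refine CC.norm_le ?_ (d.2.1.trans (hK1 _ (norm_nonneg _))) (d.2.2.trans (hK1 _ (norm_nonneg _)))
      refine lip_graph (D := 0) hq2.t.2 hq2'.t.2 (hcs _ (hW.1 _ hq2.t _ hqz).1) (hcs _ (hW.1 _ hq2'.t _ hqz').1)
        d.2.2 ?_ ((CC.le q').2.2.trans (hq1'.le.trans (min_le_left _ _))) hK.le
        (hW.2 _ hq2.t _ hqz _ hq2'.t _ hqz')
      rw [← norm_mul]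
      have hz1 := hq2.z
      have hz2 := hq2'.z
      have e : q'.2.2 * (q.2.1 / q.2.2 - q'.2.1 / q'.2.2) =
          (q - q').2.1 - (q.2.1 / q.2.2) * (q - q').2.2 := by
        simp only [Prod.snd_sub, Prod.fst_sub]
        field_simp
        ring
      rw [e]
      refine (norm_sub_le _ _).trans ?_
      rw [norm_mul]
      calc _ ≤ ‖q - q'‖ + 100 * ‖q - q'‖ := by
            gcongr
            · exact d.2.1
            · exact hq2.t.2
            · exact d.2.2
        _ = _ := by ring
  · by_cases hp0 : p = 0
    · subst hp0
      have e : ∀ Wp Wm, s2map Wp Wm 0 = 0 := fun Wp Wm => if_neg (by simp [Mid])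
      rw [e, e]
      simp [zero_mem_Sset]
    have h5 := locN hb.mem hpS hne hp0 hM
    have e : s2map Wp' Wm' p = p := if_neg hM
    refine ⟨(hid h5.le).1, (hid h5.le).2, by rw [e]; exact hK1 _ (norm_nonneg _), fun _ => ?_⟩
    have hev : ∀ᶠ q : CC in 𝓝 p, 500 * ‖q.2.1‖ < max ‖q.1‖ ‖q.2.2‖ :=
      ((LLy p).norm.ca.const_mul 500).eventually_lt ((LLx p).norm.maxx (LLz p).norm).ca h5
    have hev2 : ∀ᶠ q : CC in 𝓝 p, ‖q‖ < min ε eps1 :=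
        continuous_norm.continuousAt.eventually_lt_const (lt_min hnε hne)
    have hI : ∀ q ∈ Sset b, 500 * ‖q.2.1‖ < max ‖q.1‖ ‖q.2.2‖ → ‖q‖ < min ε eps1 →
        s2map Wp' Wm' q = q := fun q hq h1 h2 =>
      s2fix hb' hp' hm' (hsame q hq h1.le) (h2.trans_le (min_le_right _ _)) (h2.le.trans (min_le_left _ _))
    refine ⟨_, inter_mem (mem_nhdsWithin_of_mem_nhds (hev.and hev2)) self_mem_nhdsWithin, ?_⟩
    rintro q ⟨⟨a1, a2⟩, a3⟩ q' ⟨⟨b1, b2⟩, b3⟩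
    rw [hI q a3 a1 a2, hI q' b3 b1 b2]
    exact hK1 _ (norm_nonneg _)

theorem Sheet.mono {a : CC → ℝ} {c : ℂ} {ε ε' K K' : ℝ} {W : ℂ → ℂ → ℂ} (h : Sheet a c ε K W)
    (h1 : ε' ≤ ε) (h2 : K ≤ K') : Sheet a c ε' K' W :=
  ⟨fun t ht z hz => h.1 t ht z (hz.trans h1), fun t ht z hz t' ht' z' hz' =>
    (h.2 t ht z (hz.trans h1) t' ht' z' (hz'.trans h1)).trans (by gcongr)⟩

theorem S2step : GermEq (Sset afun) (Sset fun _ => 1/2) := by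
  obtain ⟨e1, K1, W1, he1, hK1, h1⟩ := sheet_plus good_afun
  obtain ⟨e2, K2, W2, he2, hK2, h2⟩ := sheet_minus good_afun
  obtain ⟨e3, K3, W3, he3, hK3, h3⟩ := sheet_plus good_half
  obtain ⟨e4, K4, W4, he4, hK4, h4⟩ := sheet_minus good_half
  set e := min (min e1 e2) (min e3 e4)
  set K := max (max K1 K2) (max K3 K4)
  have he : 0 < e := lt_min (lt_min he1 he2) (lt_min he3 he4)
  have hK : 0 < K := lt_max_of_lt_left (lt_max_of_lt_left hK1)
  have h1' := h1.mono (ε' := e) (K' := K) (by simp [e]) (by simp [K])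
  have h2' := h2.mono (ε' := e) (K' := K) (by simp [e]) (by simp [K])
  have h3' := h3.mono (ε' := e) (K' := K) (by simp [e]) (by simp [K])
  have h4' := h4.mono (ε' := e) (K' := K) (by simp [e]) (by simp [K])
  exact ⟨s2map W3 W4, s2map W1 W2, s2half good_afun good_half he hK h1' h2' h3' h4',
    s2half good_half good_afun he hK h3' h4' h1' h2'⟩

def csq (A : ℂ) : ℂ := Complex.exp (Complex.log A / 2)

theorem csq_sq {A : ℂ} (h : A ≠ 0) : csq A ^ 2 = A := by
  rw [csq, ← Complex.exp_nat_mul, Nat.cast_ofNat, mul_div_cancel₀ _ two_ne_zero, Complex.exp_log h]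

theorem csq_one : csq 1 = 1 := by simp [csq]

theorem csq_ne (A : ℂ) : csq A ≠ 0 := Complex.exp_ne_zero _

theorem re_slit {A : ℂ} (h : 0 < A.re) : A ∈ Complex.slitPlane := Or.inl h

theorem csq_inv {A : ℂ} (h : 0 < A.re) : csq A * csq A⁻¹ = 1 := by
  have : Complex.log A⁻¹ = - Complex.log A := Complex.log_inv _ (Complex.slitPlane_arg_ne_pi (re_slit h))
  rw [csq, csq, this, ← Complex.exp_add]
  ring_nf
  exact Complex.exp_zero

theorem csq_real_mul {r : ℝ} (hr : 0 < r) {A : ℂ} (hA : A ≠ 0) : csq ((r ^ 2 : ℝ) * A) = r * csq A := by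
  rw [csq, Complex.log_ofReal_mul (by positivity) hA, csq, add_div, Complex.exp_add, Real.log_pow]
  congr 1
  rw [show (((2:ℕ) * Real.log r : ℝ) : ℂ) / 2 = ((Real.log r : ℝ):ℂ) by push_cast; ring, ← Complex.ofReal_exp,
    Real.exp_log hr]

theorem csq_LL {A : ℂ} (h : 0 < A.re) : LL csq A := by
  apply LL.of_contDiffAt
  unfold csq
  have h1 : ContDiffAt ℂ 1 (fun A => Complex.exp (Complex.log A / 2)) A :=
    ((Complex.contDiffAt_log (re_slit h)).div_const 2).cexp
  exact h1.restrict_scalars ℝ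

def mu (n : ℕ) (r : ℝ) : ℝ := (min (10 * r) 1) ^ n

theorem mu_nonneg (n : ℕ) {r : ℝ} (h : 0 ≤ r) : 0 ≤ mu n r := by
  have : 0 ≤ min (10 * r) 1 := le_min (by linarith) zero_le_one
  unfold mu; positivity

theorem mu_le_one (n : ℕ) {r : ℝ} (h : 0 ≤ r) : mu n r ≤ 1 :=
  pow_le_one₀ (le_min (by linarith) zero_le_one) (min_le_right _ _)

theorem mu_one (n : ℕ) {r : ℝ} (h : 1/10 ≤ r) : mu n r = 1 := by
  rw [mu, min_eq_right (by linarith), one_pow]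

theorem mu_mono (n : ℕ) {a b : ℝ} (hb : 0 ≤ b) (h : b ≤ a) : mu n b ≤ mu n a := by
  unfold mu
  have : 0 ≤ min (10 * b) 1 := le_min (by linarith) zero_le_one
  gcongr

theorem mu_cont (n : ℕ) : Continuous (mu n) := by unfold mu; fun_prop

theorem mu_diff (n : ℕ) {a b : ℝ} (hb : 0 ≤ b) (h : b ≤ a) :
    b * (mu n a - mu n b) ≤ n * mu n a * (a - b) := by
  by_cases hb1 : 1/10 ≤ b
  · rw [mu_one n hb1, mu_one n (hb1.trans h)]
    simp; nlinarith
  push Not at hb1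
  unfold mu
  have ht : min (10 * b) 1 = 10 * b := min_eq_left (by linarith)
  set s := min (10 * a) 1
  set t := 10 * b
  have ht0 : 0 ≤ t := by positivity
  have hts : t ≤ s := le_min (by linarith) (by linarith)
  have hsa : s ≤ 10 * a := min_le_left _ _
  rw [ht]
  have h1 : s ^ n - t ^ n ≤ n * s ^ (n - 1) * (s - t) := by
    have := abs_pow_sub_pow_le (a := s) (b := t) (n := n)
    rw [abs_of_nonneg (ht0.trans hts), abs_of_nonneg ht0, max_eq_left hts, abs_of_nonneg (sub_nonneg.2 hts)] at this
    linarith [le_abs_self (s ^ n - t ^ n)]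
  rcases n with _ | n
  · simp
  · simp only [Nat.add_sub_cancel] at h1
    calc b * (s ^ (n+1) - t ^ (n+1)) ≤ b * (((n+1:ℕ):ℝ) * s ^ n * (s - t)) := by gcongr
      _ ≤ (s / 10) * (((n+1:ℕ):ℝ) * s ^ n * (10 * (a - b))) := by
        have hs0 := ht0.trans hts
        have h5 : 0 ≤ s - t := by linarith
        have h6 : b ≤ s / 10 := by linarith
        have h7 : s - t ≤ 10 * (a - b) := by linarith
        gcongr
      _ = _ := by ring

def rad (n : ℕ) (δ : ℝ) (v : ℂ) : ℂ := (((mu n ‖v‖ + δ) / (1 + δ) : ℝ) : ℂ) * v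

theorem rad_aux (n : ℕ) {δ : ℝ} (hδ : 0 < δ) {v w : ℂ} (h : ‖w‖ ≤ ‖v‖) :
    ‖rad n δ v - rad n δ w‖ ≤ (n + 1) * (mu n ‖v‖ + δ) * ‖v - w‖ ∧
    (mu n ‖w‖ + δ) * ‖v - w‖ ≤ (1 + δ) * ‖rad n δ v - rad n δ w‖ := by
  have hm := mu_mono n (norm_nonneg w) h
  have hw := mu_nonneg n (norm_nonneg w)
  have hv := mu_nonneg n (norm_nonneg v)
  have hd := mu_diff n (norm_nonneg w) h
  set a := mu n ‖v‖
  set b := mu n ‖w‖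
  set D : ℂ := ((a + δ : ℝ) : ℂ) * v - ((b + δ : ℝ) : ℂ) * w with hD
  have e1 : rad n δ v - rad n δ w = ((1 / (1 + δ) : ℝ) : ℂ) * D := by
    simp only [rad, hD]; push_cast; ring
  have e2 : ‖rad n δ v - rad n δ w‖ = 1 / (1 + δ) * ‖D‖ := by
    rw [e1, norm_mul, Complex.norm_real, Real.norm_of_nonneg (by positivity)]
  have e3 : (1 + δ) * ‖rad n δ v - rad n δ w‖ = ‖D‖ := by
    rw [e2]; field_simp
  have htri : ‖v‖ - ‖w‖ ≤ ‖v - w‖ := norm_sub_norm_le _ _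
  constructor
  · have h1 : ‖D‖ ≤ (n + 1) * (a + δ) * ‖v - w‖ := by
      have : D = ((a + δ : ℝ) : ℂ) * (v - w) + ((a - b : ℝ) : ℂ) * w := by rw [hD]; push_cast; ring
      rw [this]
      refine (norm_add_le _ _).trans ?_
      rw [norm_mul, norm_mul, Complex.norm_real, Complex.norm_real, Real.norm_of_nonneg (by positivity),
        Real.norm_of_nonneg (by linarith)]
      have h3 : (n:ℝ) * a * (‖v‖ - ‖w‖) ≤ n * (a + δ) * ‖v - w‖ := by
        have : 0 ≤ ‖v‖ - ‖w‖ := by linarith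
        gcongr; linarith
      nlinarith
    have h2 : 0 ≤ ‖rad n δ v - rad n δ w‖ := norm_nonneg _
    nlinarith
  · rw [e3]
    have h1 : (b + δ) * ‖v - w‖ ^ 2 ≤ (D * (starRingEnd ℂ) (v - w)).re := by
      have : D = ((b + δ : ℝ) : ℂ) * (v - w) + ((a - b : ℝ) : ℂ) * v := by rw [hD]; push_cast; ring
      have e5 : (D * (starRingEnd ℂ) (v - w)).re = (b + δ) * ‖v - w‖ ^ 2 +
          (a - b) * (‖v‖ ^ 2 - (v * (starRingEnd ℂ) w).re) := by
        rw [this, ← Complex.normSq_eq_norm_sq, ← Complex.normSq_eq_norm_sq]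
        simp only [Complex.normSq_apply, Complex.mul_re, Complex.add_re, Complex.mul_im, Complex.add_im,
          Complex.sub_re, Complex.sub_im, Complex.conj_re, Complex.conj_im, Complex.ofReal_re, Complex.ofReal_im]
        ring
      rw [e5]
      have h4 : (v * (starRingEnd ℂ) w).re ≤ ‖v‖ ^ 2 := by
        refine (Complex.re_le_norm _).trans ?_
        rw [norm_mul, RCLike.norm_conj, sq]
        gcongr
      have : 0 ≤ (a - b) * (‖v‖ ^ 2 - (v * (starRingEnd ℂ) w).re) := mul_nonneg (by linarith) (by linarith)
      linarith
    have h2 : (D * (starRingEnd ℂ) (v - w)).re ≤ ‖D‖ * ‖v - w‖ := by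
      refine (Complex.re_le_norm _).trans ?_
      rw [norm_mul, RCLike.norm_conj]
    rcases (norm_nonneg (v - w)).eq_or_lt with h0 | h0
    · rw [← h0]; simp
    · have : (b + δ) * ‖v - w‖ * ‖v - w‖ ≤ ‖D‖ * ‖v - w‖ := by nlinarith
      exact le_of_mul_le_mul_right this h0

theorem rad_eq (n : ℕ) {δ : ℝ} (hδ : 0 < δ) {v : ℂ} (h : 1/10 ≤ ‖v‖) : rad n δ v = v := by
  rw [rad, mu_one n h, div_self (by positivity)]; simp

theorem rad_odd (n : ℕ) (δ : ℝ) (v : ℂ) : rad n δ (-v) = - rad n δ v := by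
  simp [rad]

theorem rad_zero (n : ℕ) (δ : ℝ) : rad n δ 0 = 0 := by simp [rad]

theorem rad_norm (n : ℕ) {δ : ℝ} (hδ : 0 < δ) (v : ℂ) :
    ‖rad n δ v‖ = (mu n ‖v‖ + δ) / (1 + δ) * ‖v‖ := by
  have := mu_nonneg n (norm_nonneg v)
  rw [rad, norm_mul, Complex.norm_real, Real.norm_of_nonneg (by positivity)]

theorem rad_le (n : ℕ) {δ : ℝ} (hδ : 0 < δ) (v : ℂ) : ‖rad n δ v‖ ≤ ‖v‖ := by
  rw [rad_norm n hδ]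
  have h1 := mu_le_one n (norm_nonneg v)
  have : (mu n ‖v‖ + δ) / (1 + δ) ≤ 1 := by rw [div_le_one (by positivity)]; linarith
  nlinarith [norm_nonneg v]

theorem rad_delta (n : ℕ) {δ δ' : ℝ} (hδ : 0 < δ) (hδ' : 0 < δ') (v : ℂ) :
    ‖rad n δ v - rad n δ' v‖ ≤ |δ - δ'| := by
  by_cases h : 1/10 ≤ ‖v‖
  · rw [rad_eq n hδ h, rad_eq n hδ' h]; simp
  push Not at h
  have h1 := mu_le_one n (norm_nonneg v)
  have h0 := mu_nonneg n (norm_nonneg v)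
  set a := mu n ‖v‖ with ha
  have e : rad n δ v - rad n δ' v = (((1 - a) * (δ - δ') / ((1 + δ) * (1 + δ')) : ℝ) : ℂ) * v := by
    rw [rad, rad, ← ha, ← sub_mul, ← Complex.ofReal_sub]
    congr 2
    field_simp
    ring
  rw [e, norm_mul, Complex.norm_real, Real.norm_eq_abs, abs_div, abs_mul, abs_of_nonneg (by linarith : 0 ≤ 1 - a),
    abs_of_pos (by positivity : 0 < (1 + δ) * (1 + δ'))]
  have h5 : (1 - a) * |δ - δ'| / ((1 + δ) * (1 + δ')) ≤ |δ - δ'| := by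
    rw [div_le_iff₀ (by positivity)]
    have := abs_nonneg (δ - δ')
    have h6 : 1 ≤ (1 + δ) * (1 + δ') := by nlinarith
    nlinarith
  have := norm_nonneg v
  have := abs_nonneg (δ - δ')
  nlinarith

theorem rad_up (n : ℕ) {δ0 : ℝ} (hδ : 0 < δ0) (v0 : ℂ) : ∃ s ∈ 𝓝 (δ0, v0), ∀ q ∈ s, ∀ q' ∈ s,
    ‖rad n q.1 q.2 - rad n q'.1 q'.2‖ ≤ 2 * (n + 1) * ((mu n ‖v0‖ + δ0) * ‖q.2 - q'.2‖ + |q.1 - q'.1|) ∧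
    (mu n ‖v0‖ + δ0) * ‖q.2 - q'.2‖ ≤
      2 * (1 + 2 * δ0) * (‖rad n q.1 q.2 - rad n q'.1 q'.2‖ + |q.1 - q'.1|) := by
  have h0 := mu_nonneg n (norm_nonneg v0)
  set m0 := mu n ‖v0‖ + δ0 with hm0
  have hc : Continuous fun q : ℝ × ℂ => mu n ‖q.2‖ + q.1 := by
    have := mu_cont n; fun_prop
  have hmp : 0 < m0 := by positivity
  refine ⟨{q | 0 < q.1 ∧ q.1 < 2 * δ0 ∧ |mu n ‖q.2‖ + δ0 - m0| < m0 / 4 ∧ |q.1 - δ0| < δ0 / 4}, ?_, ?_⟩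
  · apply IsOpen.mem_nhds
    · have := mu_cont n
      apply IsOpen.and (isOpen_lt (by fun_prop) (by fun_prop))
      apply IsOpen.and (isOpen_lt (by fun_prop) (by fun_prop))
      apply IsOpen.and (isOpen_lt (by fun_prop) (by fun_prop)) (isOpen_lt (by fun_prop) (by fun_prop))
    · refine ⟨hδ, by simp; linarith, ?_, ?_⟩
      · simp [← hm0, hmp]
      · simp [hδ]
  rintro ⟨δ, v⟩ ⟨h1, h2, h3, h4⟩ ⟨δ', w⟩ ⟨h1', h2', h3', h4'⟩
  simp only at *
  rw [abs_lt] at h3 h4 h3' h4'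
  have hlow : m0 / 2 ≤ mu n ‖v‖ + δ := by linarith
  have hup : mu n ‖v‖ + δ ≤ 2 * m0 := by linarith
  have hlow' : m0 / 2 ≤ mu n ‖w‖ + δ := by linarith
  have hup' : mu n ‖w‖ + δ ≤ 2 * m0 := by linarith
  have hδd := rad_delta n h1 h1' w
  have hN := norm_nonneg (v - w)
  have hA := abs_nonneg (δ - δ')
  have key : ‖rad n δ v - rad n δ w‖ ≤ (n + 1) * (2 * m0) * ‖v - w‖ ∧
      m0 / 2 * ‖v - w‖ ≤ (1 + δ) * ‖rad n δ v - rad n δ w‖ := by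
    rcases le_total ‖w‖ ‖v‖ with h | h
    · obtain ⟨k1, k2⟩ := rad_aux n h1 h
      exact ⟨k1.trans (by gcongr), le_trans (by gcongr) k2⟩
    · obtain ⟨k1, k2⟩ := rad_aux n h1 h
      rw [norm_sub_rev, norm_sub_rev v]
      exact ⟨k1.trans (by gcongr), le_trans (by gcongr) k2⟩
  have t1 : ‖rad n δ v - rad n δ' w‖ ≤ ‖rad n δ v - rad n δ w‖ + |δ - δ'| :=
    (norm_sub_le_norm_sub_add_norm_sub _ (rad n δ w) _).trans (by gcongr)
  have t2 : ‖rad n δ v - rad n δ w‖ ≤ ‖rad n δ v - rad n δ' w‖ + |δ - δ'| :=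
    (norm_sub_le_norm_sub_add_norm_sub _ (rad n δ' w) _).trans (by gcongr; rw [norm_sub_rev]; exact hδd)
  constructor
  · have : (0:ℝ) ≤ n * |δ - δ'| := by positivity
    nlinarith [key.1]
  · have h9 : (1 + δ) * ‖rad n δ v - rad n δ w‖ ≤ (1 + 2 * δ0) * (‖rad n δ v - rad n δ' w‖ + |δ - δ'|) := by
      gcongr
    linarith [key.2]

theorem rad_surj (n : ℕ) {δ : ℝ} (hδ : 0 < δ) (w : ℂ) : ∃ v, rad n δ v = w := by
  by_cases h : 1/10 ≤ ‖w‖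
  · exact ⟨w, rad_eq n hδ h⟩
  push Not at h
  by_cases hw : w = 0
  · exact ⟨0, by rw [hw, rad_zero]⟩
  have hw0 := norm_pos_iff.2 hw
  have hc : Continuous fun r : ℝ => (mu n r + δ) / (1 + δ) * r := by have := mu_cont n; fun_prop
  have hm := intermediate_value_Icc (a := (0:ℝ)) (b := 1) zero_le_one hc.continuousOn
  have : ‖w‖ ∈ Icc ((mu n 0 + δ) / (1 + δ) * 0) ((mu n 1 + δ) / (1 + δ) * 1) := by
    rw [mu_one n (r := 1) (by norm_num), div_self (by positivity)]
    exact ⟨by simp, by linarith⟩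
  obtain ⟨r, hr, hr2⟩ := hm this
  refine ⟨((r / ‖w‖ : ℝ) : ℂ) * w, ?_⟩
  have hn : ‖((r / ‖w‖ : ℝ) : ℂ) * w‖ = r := by
    rw [norm_mul, Complex.norm_real, Real.norm_of_nonneg (div_nonneg hr.1 hw0.le), div_mul_cancel₀ _ hw0.ne']
  simp only at hr2
  rw [rad, hn, ← mul_assoc, ← Complex.ofReal_mul, ← mul_div_assoc, hr2, div_self hw0.ne']
  simp

def radinv (n : ℕ) (δ : ℝ) (w : ℂ) : ℂ := if h : 0 < δ then (rad_surj n h w).choose else w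

theorem rad_radinv (n : ℕ) {δ : ℝ} (hδ : 0 < δ) (w : ℂ) : rad n δ (radinv n δ w) = w := by
  rw [radinv, dif_pos hδ]; exact (rad_surj n hδ w).choose_spec

theorem rad_inj (n : ℕ) {δ : ℝ} (hδ : 0 < δ) : Function.Injective (rad n δ) := by
  have key : ∀ v w : ℂ, ‖w‖ ≤ ‖v‖ → rad n δ v = rad n δ w → v = w := by
    intro v w hn h
    have := (rad_aux n hδ hn).2
    rw [h, sub_self, norm_zero, mul_zero] at this
    have h0 := mu_nonneg n (norm_nonneg w)
    have : ‖v - w‖ = 0 := by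
      by_contra h9
      have : 0 < ‖v - w‖ := lt_of_le_of_ne (norm_nonneg _) (Ne.symm h9)
      have : 0 < (mu n ‖w‖ + δ) * ‖v - w‖ := by positivity
      linarith
    exact sub_eq_zero.1 (norm_eq_zero.1 this)
  intro v w h
  rcases le_total ‖w‖ ‖v‖ with h1 | h1
  · exact key v w h1 h
  · exact (key w v h1 h.symm).symm

theorem radinv_rad (n : ℕ) {δ : ℝ} (hδ : 0 < δ) (v : ℂ) : radinv n δ (rad n δ v) = v :=
  rad_inj n hδ (rad_radinv n hδ _)

theorem radinv_eq (n : ℕ) {δ : ℝ} (hδ : 0 < δ) {v : ℂ} (h : 1/10 ≤ ‖v‖) : radinv n δ v = v := by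
  apply rad_inj n hδ; rw [rad_radinv n hδ, rad_eq n hδ h]

theorem radinv_odd (n : ℕ) {δ : ℝ} (hδ : 0 < δ) (v : ℂ) : radinv n δ (-v) = - radinv n δ v := by
  apply rad_inj n hδ; rw [rad_radinv n hδ, rad_odd, rad_radinv n hδ]

theorem radinv_lt (n : ℕ) {δ : ℝ} (hδ : 0 < δ) {v : ℂ} (h : ‖v‖ < 1/10) : ‖radinv n δ v‖ < 1/10 := by
  by_contra h2
  push Not at h2
  have := rad_eq n hδ h2
  rw [rad_radinv n hδ] at this
  rw [← this] at h2
  linarith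

theorem radinv_cont (n : ℕ) {δ0 : ℝ} (hδ : 0 < δ0) (w0 : ℂ) :
    ContinuousAt (fun q : ℝ × ℂ => radinv n q.1 q.2) (δ0, w0) := by
  have hb : ∀ᶠ q : ℝ × ℂ in 𝓝 (δ0, w0), ‖radinv n q.1 q.2 - radinv n δ0 w0‖ ≤
      (1 + δ0) / δ0 * (‖q.2 - w0‖ + |q.1 - δ0|) := by
    have : ∀ᶠ q : ℝ × ℂ in 𝓝 (δ0, w0), 0 < q.1 := continuousAt_fst.eventually (lt_mem_nhds hδ)
    filter_upwards [this] with q hq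
    set v := radinv n q.1 q.2 with hv
    set v0 := radinv n δ0 w0 with hv0
    have e1 : rad n q.1 v = q.2 := rad_radinv n hq _
    have e0 : rad n δ0 v0 = w0 := rad_radinv n hδ _
    have k : δ0 * ‖v - v0‖ ≤ (1 + δ0) * ‖rad n δ0 v - rad n δ0 v0‖ := by
      rcases le_total ‖v0‖ ‖v‖ with h1 | h1
      · refine le_trans ?_ (rad_aux n hδ h1).2
        have := mu_nonneg n (norm_nonneg v0); gcongr; linarith
      · rw [norm_sub_rev, norm_sub_rev (rad n δ0 v)]
        refine le_trans ?_ (rad_aux n hδ h1).2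
        have := mu_nonneg n (norm_nonneg v); gcongr; linarith
    have t : ‖rad n δ0 v - rad n δ0 v0‖ ≤ ‖q.2 - w0‖ + |q.1 - δ0| := by
      have := norm_sub_le_norm_sub_add_norm_sub (rad n δ0 v) (rad n q.1 v) (rad n δ0 v0)
      have h3 := rad_delta n hδ hq v
      rw [e1, e0] at this
      rw [e1] at h3
      rw [e0, abs_sub_comm]
      linarith
    rw [div_mul_eq_mul_div, le_div_iff₀ hδ, mul_comm]
    exact k.trans (by gcongr)
  rw [ContinuousAt, tendsto_iff_norm_sub_tendsto_zero]
  refine squeeze_zero' (Eventually.of_forall fun _ => norm_nonneg _) hb ?_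
  have : Continuous fun q : ℝ × ℂ => (1 + δ0) / δ0 * (‖q.2 - w0‖ + |q.1 - δ0|) := by fun_prop
  have := this.tendsto (δ0, w0)
  simpa using this

def glue (E : Finset ℂ) (f : ℂ → ℂ) (χ : ℂ) : ℂ := χ + ∑ e ∈ E, (f (χ - e) - (χ - e))

structure GoodE (E : Finset ℂ) : Prop where
  sep : ∀ e ∈ E, ∀ e' ∈ E, e ≠ e' → 1/2 ≤ ‖e - e'‖
  ne : E.Nonempty
  symm : ∀ e ∈ E, -e ∈ E
  bd : ∀ e ∈ E, ‖e‖ ≤ 3/5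

theorem glue_near {E : Finset ℂ} (hE : GoodE E) {f : ℂ → ℂ} (hf : ∀ v, 1/10 ≤ ‖v‖ → f v = v) {e χ : ℂ}
    (he : e ∈ E) (h : ‖χ - e‖ ≤ 4/10) : glue E f χ = e + f (χ - e) := by
  rw [glue, Finset.sum_eq_single e]
  · ring
  · intro e' he' hne
    rw [hf, sub_self]
    have h1 := hE.sep e' he' e he hne
    have h2 : ‖e' - e‖ ≤ ‖χ - e‖ + ‖χ - e'‖ := by
      rw [show e' - e = (χ - e) - (χ - e') by ring]; exact norm_sub_le _ _
    linarith
  · intro h; exact absurd he h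

theorem glue_far {E : Finset ℂ} {f : ℂ → ℂ} (hf : ∀ v, 1/10 ≤ ‖v‖ → f v = v) {χ : ℂ}
    (h : ∀ e ∈ E, 1/10 ≤ ‖χ - e‖) : glue E f χ = χ := by
  rw [glue, Finset.sum_eq_zero, add_zero]
  intro e he
  rw [hf _ (h e he), sub_self]

theorem glue_odd {E : Finset ℂ} (hE : GoodE E) {f : ℂ → ℂ} (hf : ∀ v, f (-v) = - f v) (χ : ℂ) :
    glue E f (-χ) = - glue E f χ := by
  rw [glue, glue, neg_add, ← Finset.sum_neg_distrib]
  congr 1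
  refine Finset.sum_nbij' (fun e => -e) (fun e => -e) (fun e he => hE.symm e he) (fun e he => hE.symm e he)
    (by simp) (by simp) ?_
  intro e _
  rw [show -χ - e = -(χ - -e) by ring, hf]
  ring

theorem glue_inv {E : Finset ℂ} (hE : GoodE E) {f g : ℂ → ℂ} (hf : ∀ v, 1/10 ≤ ‖v‖ → f v = v)
    (hg : ∀ v, 1/10 ≤ ‖v‖ → g v = v) (hf2 : ∀ v, ‖v‖ < 1/10 → ‖f v‖ < 1/10) (hgf : ∀ v, g (f v) = v) (χ : ℂ) :
    glue E g (glue E f χ) = χ := by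
  by_cases h : ∀ e ∈ E, 1/10 ≤ ‖χ - e‖
  · rw [glue_far hf h, glue_far hg h]
  · push Not at h
    obtain ⟨e, he, h⟩ := h
    rw [glue_near hE hf he (by linarith), glue_near hE hg he, add_sub_cancel_left, hgf]
    · ring
    · rw [add_sub_cancel_left]; linarith [hf2 _ h]

theorem glue_big {E : Finset ℂ} (hE : GoodE E) {f : ℂ → ℂ} (hf : ∀ v, 1/10 ≤ ‖v‖ → f v = v) {χ : ℂ}
    (h : 7/10 ≤ ‖χ‖) : glue E f χ = χ := by
  apply glue_far hf
  intro e he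
  have h1 := hE.bd e he
  have := norm_sub_norm_le χ e
  linarith

theorem glue_small {E : Finset ℂ} (hE : GoodE E) {f : ℂ → ℂ} (hf : ∀ v, 1/10 ≤ ‖v‖ → f v = v)
    (hf2 : ∀ v, ‖v‖ < 1/10 → ‖f v‖ < 1/10) {χ : ℂ} (h : ‖χ‖ < 7/10) : ‖glue E f χ‖ < 7/10 := by
  by_cases h2 : ∀ e ∈ E, 1/10 ≤ ‖χ - e‖
  · rw [glue_far hf h2]; exact h
  · push Not at h2
    obtain ⟨e, he, h2⟩ := h2
    rw [glue_near hE hf he (by linarith)]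
    have h1 := hE.bd e he
    have := norm_add_le e (f (χ - e))
    linarith [hf2 _ h2]

theorem glue_loc {E : Finset ℂ} (hE : GoodE E) (χ0 : ℂ) : ∃ e ∈ E, (∀ e' ∈ E, ‖χ0 - e‖ ≤ ‖χ0 - e'‖) ∧
    ∀ f : ℂ → ℂ, (∀ v, 1/10 ≤ ‖v‖ → f v = v) → ∀ χ, ‖χ - χ0‖ < 1/20 → glue E f χ = e + f (χ - e) := by
  obtain ⟨e, he, hm⟩ := E.exists_min_image (fun e => ‖χ0 - e‖) hE.ne
  refine ⟨e, he, hm, fun f hf χ hχ => ?_⟩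
  have h0 : ∀ e, ‖χ0 - e‖ ≤ ‖χ - e‖ + ‖χ - χ0‖ := fun e => by
    rw [show χ0 - e = (χ - e) - (χ - χ0) by ring]; exact norm_sub_le _ _
  by_cases h : ‖χ - e‖ ≤ 4/10
  · exact glue_near hE hf he h
  · push Not at h
    have h1 : ‖χ - e‖ ≤ ‖χ0 - e‖ + ‖χ - χ0‖ := by
      rw [show χ - e = (χ0 - e) + (χ - χ0) by ring]; exact norm_add_le _ _
    rw [glue_far hf, hf _ (by linarith)]
    · ring
    · intro e' he'
      have := hm e' he'
      have := h0 e'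
      linarith

def PP (b χ : ℂ) : ℝ := ‖χ‖ * ‖χ ^ 2 - b‖

theorem PP_nonneg (b χ : ℂ) : 0 ≤ PP b χ := by unfold PP; positivity

structure RPack (b : ℂ) (R S : ℝ → ℂ → ℂ) : Prop where
  inv1 : ∀ δ, 0 < δ → ∀ w, R δ (S δ w) = w
  inv2 : ∀ δ, 0 < δ → ∀ w, S δ (R δ w) = w
  odd1 : ∀ δ, 0 < δ → ∀ w, R δ (-w) = - R δ w
  odd2 : ∀ δ, 0 < δ → ∀ w, S δ (-w) = - S δ w
  cont : ∀ δ, 0 < δ → ∀ w, ContinuousAt (fun q : ℝ × ℂ => S q.1 q.2) (δ, w)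
  big1 : ∀ δ, 0 < δ → ∀ w, 7/10 ≤ ‖w‖ → R δ w = w
  big2 : ∀ δ, 0 < δ → ∀ w, 7/10 ≤ ‖w‖ → S δ w = w
  small1 : ∀ δ, 0 < δ → ∀ w, ‖w‖ < 7/10 → ‖R δ w‖ < 7/10
  small2 : ∀ δ, 0 < δ → ∀ w, ‖w‖ < 7/10 → ‖S δ w‖ < 7/10
  est : ∃ C : ℝ, 0 < C ∧ ∀ δ0, 0 < δ0 → δ0 < 1 → ∀ χ0 : ℂ, ‖χ0‖ ≤ 2 → ∃ s ∈ 𝓝 (δ0, χ0), ∀ q ∈ s, ∀ q' ∈ s,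
    ‖R q.1 q.2 - R q'.1 q'.2‖ ≤ C * ((PP b χ0 + δ0) * ‖q.2 - q'.2‖ + |q.1 - q'.1|) ∧
    (PP b χ0 + δ0) * ‖q.2 - q'.2‖ ≤ C * (‖R q.1 q.2 - R q'.1 q'.2‖ + |q.1 - q'.1|)

theorem RPack.mk' {n : ℕ} {E : Finset ℂ} (hE : GoodE E) {b : ℂ} {C : ℝ} (hC : 0 < C)
    (hcmp : ∀ e ∈ E, ∀ χ, ‖χ‖ ≤ 2 → (∀ e' ∈ E, ‖χ - e‖ ≤ ‖χ - e'‖) →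
      PP b χ ≤ C * mu n ‖χ - e‖ ∧ mu n ‖χ - e‖ ≤ C * PP b χ) :
    RPack b (fun δ => glue E (rad n δ)) (fun δ => glue E (radinv n δ)) where
  inv1 δ hδ w := glue_inv hE (fun v => radinv_eq n hδ) (fun v => rad_eq n hδ) (fun v => radinv_lt n hδ)
    (rad_radinv n hδ) w
  inv2 δ hδ w := glue_inv hE (fun v => rad_eq n hδ) (fun v => radinv_eq n hδ)
    (fun v hv => (rad_le n hδ v).trans_lt hv) (radinv_rad n hδ) w
  odd1 δ hδ w := glue_odd hE (rad_odd n δ) w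
  odd2 δ hδ w := glue_odd hE (radinv_odd n hδ) w
  big1 δ hδ w hw := glue_big hE (fun v => rad_eq n hδ) hw
  big2 δ hδ w hw := glue_big hE (fun v => radinv_eq n hδ) hw
  small1 δ hδ w hw := glue_small hE (fun v => rad_eq n hδ) (fun v hv => (rad_le n hδ v).trans_lt hv) hw
  small2 δ hδ w hw := glue_small hE (fun v => radinv_eq n hδ) (fun v => radinv_lt n hδ) hw
  cont δ hδ w := by
    obtain ⟨e, he, -, hl⟩ := glue_loc hE w
    have h1 : ∀ᶠ q : ℝ × ℂ in 𝓝 (δ, w), 0 < q.1 := continuousAt_fst.eventually (lt_mem_nhds hδ)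
    have h2 : ∀ᶠ q : ℝ × ℂ in 𝓝 (δ, w), ‖q.2 - w‖ < 1/20 := by
      have : ContinuousAt (fun q : ℝ × ℂ => ‖q.2 - w‖) (δ, w) := by fun_prop
      exact this.eventually (gt_mem_nhds (by simp))
    have h3 : (fun q : ℝ × ℂ => glue E (radinv n q.1) q.2) =ᶠ[𝓝 (δ, w)]
        fun q => e + radinv n q.1 (q.2 - e) := by
      filter_upwards [h1, h2] with q hq1 hq2
      exact hl _ (fun v => radinv_eq n hq1) _ hq2
    refine ContinuousAt.congr ?_ h3.symm
    refine continuousAt_const.add ?_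
    have := radinv_cont n hδ (w - e)
    exact ContinuousAt.comp (f := fun q : ℝ × ℂ => (q.1, q.2 - e)) (x := (δ, w)) this (by fun_prop)
  est := by
    refine ⟨(2 * (n + 1) + 6) * (C + 1), by positivity, fun δ0 hδ hδ1 χ0 hχ => ?_⟩
    obtain ⟨e, he, hmin, hl⟩ := glue_loc hE χ0
    obtain ⟨c1, c2⟩ := hcmp e he χ0 hχ hmin
    obtain ⟨s, hs, H⟩ := rad_up n hδ (χ0 - e)
    have h1 : ∀ᶠ q : ℝ × ℂ in 𝓝 (δ0, χ0), 0 < q.1 := continuousAt_fst.eventually (lt_mem_nhds hδ)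
    have h2 : ∀ᶠ q : ℝ × ℂ in 𝓝 (δ0, χ0), ‖q.2 - χ0‖ < 1/20 := by
      have : ContinuousAt (fun q : ℝ × ℂ => ‖q.2 - χ0‖) (δ0, χ0) := by fun_prop
      exact this.eventually (gt_mem_nhds (by simp))
    have h3 : ∀ᶠ q : ℝ × ℂ in 𝓝 (δ0, χ0), (q.1, q.2 - e) ∈ s := by
      have : ContinuousAt (fun q : ℝ × ℂ => (q.1, q.2 - e)) (δ0, χ0) := by fun_prop
      exact this hs
    refine ⟨_, (h1.and (h2.and h3)), ?_⟩
    rintro q ⟨hq1, hq2, hq3⟩ q' ⟨hq1', hq2', hq3'⟩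
    obtain ⟨k1, k2⟩ := H _ hq3 _ hq3'
    rw [hl _ (fun v => rad_eq n hq1) _ hq2, hl _ (fun v => rad_eq n hq1') _ hq2', add_sub_add_left_eq_sub]
    simp only [sub_sub_sub_cancel_right] at k1 k2
    have hP := PP_nonneg b χ0
    have hm := mu_nonneg n (norm_nonneg (χ0 - e))
    have hN := norm_nonneg (q.2 - q'.2)
    have hA := abs_nonneg (q.1 - q'.1)
    constructor
    · have : (mu n ‖χ0 - e‖ + δ0) ≤ (C + 1) * (PP b χ0 + δ0) := by nlinarith
      calc _ ≤ _ := k1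
        _ ≤ (2 * (n + 1) + 6) * ((C + 1) * (PP b χ0 + δ0) * ‖q.2 - q'.2‖ + (C + 1) * |q.1 - q'.1|) := by
          gcongr
          · linarith
          · nlinarith
        _ = _ := by ring
    · have : (PP b χ0 + δ0) ≤ (C + 1) * (mu n ‖χ0 - e‖ + δ0) := by nlinarith
      have hz : (0:ℝ) ≤ n := Nat.cast_nonneg n
      calc _ ≤ (C + 1) * (mu n ‖χ0 - e‖ + δ0) * ‖q.2 - q'.2‖ := by gcongr
        _ ≤ (C + 1) * (2 * (1 + 2 * δ0) * (‖rad n q.1 (q.2 - e) - rad n q'.1 (q'.2 - e)‖ + |q.1 - q'.1|)) := by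
          rw [mul_assoc]; gcongr
        _ ≤ (C + 1) * ((2 * (n + 1) + 6) * (‖rad n q.1 (q.2 - e) - rad n q'.1 (q'.2 - e)‖ + |q.1 - q'.1|)) := by
          gcongr
          linarith
        _ = _ := by ring

theorem exists_R1 : ∃ R S, RPack 0 R S := by
  have hE : GoodE {0} := ⟨by simp, by simp, by simp, by norm_num⟩
  refine ⟨_, _, RPack.mk' (n := 3) hE (b := 0) (C := 1000) (by norm_num) ?_⟩
  intro e he χ hχ _
  rw [Finset.mem_singleton] at he
  subst he
  have e1 : PP 0 χ = ‖χ‖ ^ 3 := by rw [PP, sub_zero, norm_pow]; ring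
  rw [e1, sub_zero, mu]
  have h0 := norm_nonneg χ
  constructor
  · have : ‖χ‖ ≤ 2 * min (10 * ‖χ‖) 1 := by
      rcases min_cases (10 * ‖χ‖) 1 with ⟨h, _⟩ | ⟨h, _⟩ <;> rw [h] <;> linarith
    have h2 : ‖χ‖ ^ 3 ≤ (2 * min (10 * ‖χ‖) 1) ^ 3 := by gcongr
    have : 0 ≤ min (10 * ‖χ‖) 1 ^ 3 := by have : 0 ≤ min (10 * ‖χ‖) 1 := le_min (by linarith) zero_le_one
                                          positivity
    nlinarith
  · have : 0 ≤ min (10 * ‖χ‖) 1 := le_min (by linarith) zero_le_one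
    have h2 : min (10 * ‖χ‖) 1 ^ 3 ≤ (10 * ‖χ‖) ^ 3 := by gcongr; exact min_le_left _ _
    nlinarith

theorem prod3 {x d2 d3 : ℝ} (h0 : 0 ≤ x) (hx : x ≤ 3) (h2 : 1/4 ≤ d2) (h3 : 1/4 ≤ d3) (h2' : d2 ≤ 3) (h3' : d3 ≤ 3) :
    x * d2 * d3 ≤ 1000 * mu 1 x ∧ mu 1 x ≤ 1000 * (x * d2 * d3) := by
  simp only [mu, pow_one]
  have k1 : d2 * d3 ≤ 9 := by nlinarith
  have k2 : 1/16 ≤ d2 * d3 := by nlinarith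
  rw [mul_assoc]
  constructor
  · have : x ≤ 3 * min (10 * x) 1 := by
      rcases min_cases (10 * x) 1 with ⟨h, _⟩ | ⟨h, _⟩ <;> rw [h] <;> linarith
    nlinarith
  · refine (min_le_left _ _).trans ?_
    nlinarith

theorem exists_R2 : ∃ R S, RPack (1/3) R S := by
  obtain ⟨c, hc0, hc⟩ : ∃ c : ℝ, 0 < c ∧ c ^ 2 = 1/3 := ⟨√(1/3), by positivity, Real.sq_sqrt (by norm_num)⟩
  have hcu : c ≤ 3/5 := by nlinarith
  have hcl : 1/2 ≤ c := by nlinarith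
  have hn : ‖(c:ℂ)‖ = c := by simp [hc0.le]
  have hE : GoodE {0, (c:ℂ), -(c:ℂ)} := by
    constructor
    · have e1 : ‖(c:ℂ) - -c‖ = 2 * c := by
        rw [show (c:ℂ) - -c = ((2 * c : ℝ):ℂ) by push_cast; ring, Complex.norm_real, Real.norm_of_nonneg (by positivity)]
      have e2 : ‖-(c:ℂ) - c‖ = 2 * c := by rw [norm_sub_rev, e1]
      simp only [Finset.mem_insert, Finset.mem_singleton]
      rintro e (rfl | rfl | rfl) e' (rfl | rfl | rfl) hne <;>
        first
        | exact absurd rfl hne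
        | (rw [e1]; linarith)
        | (rw [e2]; linarith)
        | (simp only [zero_sub, sub_zero, norm_neg, hn]; linarith)
    · simp
    · simp only [Finset.mem_insert, Finset.mem_singleton]
      rintro e (rfl | rfl | rfl) <;> simp
    · simp only [Finset.mem_insert, Finset.mem_singleton]
      rintro e (rfl | rfl | rfl)
      · norm_num
      · rw [hn]; exact hcu
      · rw [norm_neg, hn]; exact hcu
  refine ⟨_, _, RPack.mk' (n := 1) hE (b := 1/3) (C := 1000) (by norm_num) ?_⟩
  intro e he χ hχ hmin
  have hP : PP (1/3) χ = ‖χ - 0‖ * ‖χ - c‖ * ‖χ - -c‖ := by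
    have : (1/3 : ℂ) = (c:ℂ) ^ 2 := by rw [← Complex.ofReal_pow, hc]; norm_num
    rw [PP, this, mul_assoc, ← norm_mul (χ - c), sub_zero]; congr 2; ring
  have h3 : ∀ e' ∈ ({0, (c:ℂ), -(c:ℂ)} : Finset ℂ), ‖χ - e'‖ ≤ 3 := by
    intro e' he'
    have := norm_sub_le χ e'
    have := hE.bd e' he'
    linarith
  have h4 : ∀ e' ∈ ({0, (c:ℂ), -(c:ℂ)} : Finset ℂ), e' ≠ e → 1/4 ≤ ‖χ - e'‖ := by
    intro e' he' hne
    have h1 := hE.sep e' he' e he hne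
    have h2 : ‖e' - e‖ ≤ ‖χ - e‖ + ‖χ - e'‖ := by
      rw [show e' - e = (χ - e) - (χ - e') by ring]; exact norm_sub_le _ _
    have := hmin e' he'
    linarith
  have m0 : (0:ℂ) ∈ ({0, (c:ℂ), -(c:ℂ)} : Finset ℂ) := by simp
  have m1 : (c:ℂ) ∈ ({0, (c:ℂ), -(c:ℂ)} : Finset ℂ) := by simp
  have m2 : (-c:ℂ) ∈ ({0, (c:ℂ), -(c:ℂ)} : Finset ℂ) := by simp
  have hcne : (c:ℂ) ≠ 0 := by exact_mod_cast hc0.ne'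
  have n1 : (c:ℂ) ≠ -c := fun h => hcne (by linear_combination h / 2)
  rw [hP]
  have he' := he
  simp only [Finset.mem_insert, Finset.mem_singleton] at he'
  rcases he' with rfl | rfl | rfl
  · exact prod3 (norm_nonneg _) (h3 _ m0) (h4 _ m1 hcne) (h4 _ m2 (neg_ne_zero.2 hcne)) (h3 _ m1) (h3 _ m2)
  · rw [mul_comm ‖χ - 0‖]
    exact prod3 (norm_nonneg _) (h3 _ m1) (h4 _ m0 hcne.symm) (h4 _ m2 n1.symm) (h3 _ m0) (h3 _ m2)
  · rw [mul_comm, ← mul_assoc]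
    exact prod3 (norm_nonneg _) (h3 _ m2) (h4 _ m0 (neg_ne_zero.2 hcne).symm) (h4 _ m1 n1) (h3 _ m0) (h3 _ m1)

def cutf (r : ℝ) : ℝ := min (max ((r - 1/2) * (5/2)) 0) 1

theorem cutf_lip (a b : ℝ) : |cutf a - cutf b| ≤ 5/2 * |a - b| := by
  unfold cutf
  have h1 := abs_min_sub_min_le_max (max ((a - 1/2) * (5/2)) 0) 1 (max ((b - 1/2) * (5/2)) 0) 1
  have h2 := abs_max_sub_max_le_max ((a - 1/2) * (5/2)) 0 ((b - 1/2) * (5/2)) 0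
  rw [sub_self, abs_zero] at h1 h2
  replace h1 := h1.trans (max_le le_rfl (abs_nonneg _))
  replace h2 := h2.trans (max_le le_rfl (abs_nonneg _))
  rw [show (a - 1/2) * (5/2) - (b - 1/2) * (5/2) = 5/2 * (a - b) by ring, abs_mul,
    abs_of_pos (by norm_num : (0:ℝ) < 5/2)] at h2
  exact h1.trans h2

theorem cutf_nonneg (r : ℝ) : 0 ≤ cutf r := le_min (le_max_right _ _) zero_le_one
theorem cutf_le (r : ℝ) : cutf r ≤ 1 := min_le_right _ _
theorem cutf_zero {r : ℝ} (h : r ≤ 1/2) : cutf r = 0 := by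
  rw [cutf, max_eq_right (by linarith), min_eq_left zero_le_one]
theorem cutf_one {r : ℝ} (h : 9/10 ≤ r) : cutf r = 1 := by
  rw [cutf, min_eq_right]; exact le_max_of_le_left (by linarith)
theorem cutf_ge {r : ℝ} (h : r ≤ 9/10) : (r - 1/2) * (5/2) ≤ cutf r := by
  rw [cutf]; exact le_min (le_max_left _ _) (by linarith)

def tT (g : ℂ) : ℂ := g + ((cutf ‖g‖ / 3 : ℝ) : ℂ)

theorem tT_pert (g g' : ℂ) : ‖((cutf ‖g‖ / 3 : ℝ) : ℂ) - ((cutf ‖g'‖ / 3 : ℝ) : ℂ)‖ ≤ 5/6 * ‖g - g'‖ := by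
  rw [← Complex.ofReal_sub, Complex.norm_real, Real.norm_eq_abs, ← sub_div, abs_div,
    abs_of_pos (by norm_num : (0:ℝ) < 3)]
  have h1 := cutf_lip ‖g‖ ‖g'‖
  have h2 := abs_norm_sub_norm_le g g'
  linarith

theorem tT_surj (w : ℂ) : ∃ g, tT g = w := by
  let f : ℂ → ℂ := fun g => w - ((cutf ‖g‖ / 3 : ℝ) : ℂ)
  have hf : ContractingWith (5/6 : NNReal) f := by
    refine ⟨by rw [← NNReal.coe_lt_coe]; norm_num, LipschitzWith.of_dist_le_mul fun g g' => ?_⟩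
    rw [dist_eq_norm, dist_eq_norm]
    simp only [f]
    rw [sub_sub_sub_cancel_left, norm_sub_rev]
    refine (tT_pert g g').trans (le_of_eq ?_)
    norm_num
  refine ⟨hf.fixedPoint f, ?_⟩
  have := hf.fixedPoint_isFixedPt
  have h2 : f (hf.fixedPoint f) = hf.fixedPoint f := this
  simp only [f] at h2 ⊢
  rw [tT]; nth_rw 1 [← h2]; ring

theorem tT_low (g g' : ℂ) : ‖g - g'‖ ≤ 6 * ‖tT g - tT g'‖ := by
  have h1 := tT_pert g g'
  have : g - g' = (tT g - tT g') - (((cutf ‖g‖ / 3 : ℝ) : ℂ) - ((cutf ‖g'‖ / 3 : ℝ) : ℂ)) := by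
    unfold tT; ring
  have h2 : ‖g - g'‖ ≤ ‖tT g - tT g'‖ + ‖((cutf ‖g‖ / 3 : ℝ) : ℂ) - ((cutf ‖g'‖ / 3 : ℝ) : ℂ)‖ := by
    nth_rw 1 [this]; exact norm_sub_le _ _
  linarith

theorem tT_inj : Function.Injective tT := by
  intro g g' h
  have := tT_low g g'
  rw [h, sub_self, norm_zero, mul_zero] at this
  exact sub_eq_zero.1 (norm_eq_zero.1 (le_antisymm this (norm_nonneg _)))

def tS (w : ℂ) : ℂ := (tT_surj w).choose
theorem tT_tS (w : ℂ) : tT (tS w) = w := (tT_surj w).choose_spec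
theorem tS_tT (w : ℂ) : tS (tT w) = w := tT_inj (tT_tS _)

structure HF (F : ℂ → ℂ) : Prop where
  lip : ∃ K : ℝ, ∀ g g', ‖F g - F g'‖ ≤ K * ‖g - g'‖
  id : ∀ g, ‖g‖ ≤ 1/2 → F g = g
  re : ∀ g, g ≠ 0 → 0 < (F g / g).re
  bd : ∀ g, ‖F g‖ ≤ ‖g‖ + 1/3

theorem cut_norm (g : ℂ) : ‖((cutf ‖g‖ / 3 : ℝ) : ℂ)‖ = cutf ‖g‖ / 3 := by
  rw [Complex.norm_real, Real.norm_of_nonneg (div_nonneg (cutf_nonneg _) (by norm_num))]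

theorem HF_tT : HF tT where
  lip := ⟨11/6, fun g g' => by
    have h1 := tT_pert g g'
    have : tT g - tT g' = (g - g') + (((cutf ‖g‖ / 3 : ℝ) : ℂ) - ((cutf ‖g'‖ / 3 : ℝ) : ℂ)) := by
      unfold tT; ring
    rw [this]
    refine (norm_add_le _ _).trans ?_
    linarith⟩
  id g hg := by rw [tT, cutf_zero hg]; simp
  bd g := by
    refine (norm_add_le _ _).trans ?_
    rw [cut_norm]; linarith [cutf_le ‖g‖]
  re g hg := by
    have hg0 := norm_pos_iff.2 hg
    have e : tT g / g = 1 + ((cutf ‖g‖ / 3 : ℝ) : ℂ) / g := by rw [tT]; field_simp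
    have h : ‖((cutf ‖g‖ / 3 : ℝ) : ℂ) / g‖ ≤ 2/3 := by
      rw [norm_div, cut_norm, div_le_iff₀ hg0]
      by_cases h : ‖g‖ ≤ 1/2
      · rw [cutf_zero h]; linarith
      · push Not at h; linarith [cutf_le ‖g‖]
    rw [e, Complex.add_re, Complex.one_re]
    have := neg_abs_le (((cutf ‖g‖ / 3 : ℝ) : ℂ) / g).re
    have := Complex.abs_re_le_norm (((cutf ‖g‖ / 3 : ℝ) : ℂ) / g)
    linarith

theorem HF_tS : HF tS where
  lip := ⟨6, fun g g' => by
    have := tT_low (tS g) (tS g')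
    rwa [tT_tS, tT_tS] at this⟩
  id g hg := tT_inj (by rw [tT_tS, HF_tT.id g hg])
  bd g := by
    have e : tS g = g - ((cutf ‖tS g‖ / 3 : ℝ) : ℂ) := by
      have := tT_tS g
      nth_rw 1 [tT] at this
      linear_combination this
    rw [e]
    refine (norm_sub_le _ _).trans ?_
    rw [cut_norm]; linarith [cutf_le ‖tS g‖]
  re g hg := by
    have h0 : tS g ≠ 0 := by
      intro h
      apply hg
      rw [← tT_tS g, h, HF_tT.id 0 (by simp)]
    have := HF_tT.re (tS g) h0
    rw [tT_tS] at this
    rw [← inv_div, Complex.inv_re]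
    have hne : g / tS g ≠ 0 := div_ne_zero hg h0
    exact div_pos this (Complex.normSq_pos.2 hne)

def hat (F : ℂ → ℂ) (χ : ℂ) : ℂ := χ * csq (F (χ ^ 2) / χ ^ 2)

theorem hat_odd (F : ℂ → ℂ) (χ : ℂ) : hat F (-χ) = - hat F χ := by
  rw [hat, hat, neg_sq]; ring

theorem re_ne {A : ℂ} (h : 0 < A.re) : A ≠ 0 := by rintro rfl; simp at h

theorem hat_sq {F : ℂ → ℂ} (hF : HF F) (χ : ℂ) : hat F χ ^ 2 = F (χ ^ 2) := by
  by_cases h : χ = 0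
  · subst h
    have := hF.id 0 (by simp)
    simp [hat, this]
  · have h2 : χ ^ 2 ≠ 0 := pow_ne_zero 2 h
    rw [hat, mul_pow, csq_sq (re_ne (hF.re _ h2)), mul_div_cancel₀ _ h2]

theorem hat_id {F : ℂ → ℂ} (hF : HF F) {χ : ℂ} (h : ‖χ ^ 2‖ ≤ 1/2) : hat F χ = χ := by
  by_cases h0 : χ = 0
  · subst h0; simp [hat]
  · have h2 : χ ^ 2 ≠ 0 := pow_ne_zero 2 h0
    rw [hat, hF.id _ h, div_self h2, csq_one, mul_one]

theorem hat_inv {F G : ℂ → ℂ} (hF : HF F) (hGF : ∀ g, G (F g) = g) (χ : ℂ) : hat G (hat F χ) = χ := by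
  by_cases h0 : χ = 0
  · subst h0; simp [hat]
  · have h2 : χ ^ 2 ≠ 0 := pow_ne_zero 2 h0
    have hr := hF.re _ h2
    have e : χ ^ 2 / F (χ ^ 2) = (F (χ ^ 2) / χ ^ 2)⁻¹ := (inv_div _ _).symm
    rw [hat, hat_sq hF, hGF, hat, e, mul_assoc, csq_inv hr, mul_one]

theorem hat_LL {F : ℂ → ℂ} (hF : HF F) (χ : ℂ) : LL (hat F) χ := by
  by_cases h0 : χ = 0
  · subst h0
    refine (LL.id (0:ℂ)).congr ?_
    have : ContinuousAt (fun χ : ℂ => ‖χ ^ 2‖) 0 := by fun_prop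
    filter_upwards [this.eventually (gt_mem_nhds (by simp : ‖(0:ℂ) ^ 2‖ < 1/2))] with χ hχ
    exact hat_id hF hχ.le
  · have h2 : χ ^ 2 ≠ 0 := pow_ne_zero 2 h0
    obtain ⟨K, hK⟩ := hF.lip
    have h1 : LL (fun χ : ℂ => F (χ ^ 2)) χ := (LL.of_lip K hK (χ ^ 2)).comp (f := fun χ : ℂ => χ ^ 2) ((LL.id χ).pow 2)
    have h3 : LL (fun χ : ℂ => F (χ ^ 2) / χ ^ 2) χ := h1.div ((LL.id χ).pow 2) h2
    exact (LL.id χ).mul ((csq_LL (hF.re _ h2)).comp (f := fun χ : ℂ => F (χ ^ 2) / χ ^ 2) h3)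

theorem hat_lip {F : ℂ → ℂ} (hF : HF F) : ∃ M : ℝ, 0 < M ∧ ∀ χ χ' : ℂ, ‖χ‖ ≤ 3 → ‖χ'‖ ≤ 3 →
    ‖hat F χ - hat F χ'‖ ≤ M * ‖χ - χ'‖ := by
  obtain ⟨M, hM, -, h⟩ := LL.compact (f := fun q : ℂ × ℂ => hat F q.1) (Q := Metric.closedBall 0 3 ×ˢ {0})
    ((isCompact_closedBall _ _).prod isCompact_singleton)
    (fun p _ => (hat_LL hF p.1).comp (f := fun q : ℂ × ℂ => q.1) (LL.id p).fst)
  refine ⟨M, hM, fun χ χ' h1 h2 => ?_⟩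
  have := h (χ, 0) (by simpa using h1) (χ', 0) (by simpa using h2)
  refine this.trans (le_of_eq ?_)
  rw [Prod.mk_sub_mk, sub_zero, Prod.norm_mk, norm_zero, max_eq_left (norm_nonneg _)]

theorem hat_norm {F : ℂ → ℂ} (hF : HF F) (χ : ℂ) : ‖hat F χ‖ ^ 2 ≤ ‖χ‖ ^ 2 + 1/3 := by
  rw [← norm_pow, hat_sq hF, ← norm_pow]; exact hF.bd _

theorem hat_PP {F : ℂ → ℂ} (hF : HF F) {χ : ℂ} (h : ‖χ‖ ≤ 2) : PP (1/3) (hat F χ) ≤ 180 * PP (1/3) χ := by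
  by_cases h1 : ‖χ ^ 2‖ ≤ 1/2
  · rw [hat_id hF h1]; linarith [PP_nonneg (1/3) χ]
  · push Not at h1
    have hn := hat_norm hF χ
    have h13 : ‖(1/3 : ℂ)‖ = 1/3 := by norm_num
    have a1 : 1/6 ≤ ‖χ ^ 2 - 1/3‖ := by
      have := norm_sub_norm_le (χ ^ 2) (1/3)
      rw [h13] at this; linarith
    rw [norm_pow] at h1
    have a2 : 7/10 ≤ ‖χ‖ := by nlinarith [norm_nonneg χ]
    have a3 : 7/60 ≤ PP (1/3) χ := by unfold PP; nlinarith
    have a4 : ‖hat F χ‖ ^ 2 ≤ 13/3 := by nlinarith [norm_nonneg χ]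
    have a5 : ‖hat F χ‖ ≤ 3 := by nlinarith
    have a6 : ‖hat F χ ^ 2 - 1/3‖ ≤ 14/3 := by
      have := norm_sub_le (hat F χ ^ 2) (1/3)
      rw [h13, norm_pow] at this; linarith
    have a7 : PP (1/3) (hat F χ) ≤ 14 := by
      unfold PP; nlinarith [norm_nonneg (hat F χ), norm_nonneg (hat F χ ^ 2 - 1/3)]
    linarith

theorem RPack.norm1 {b : ℂ} {R S : ℝ → ℂ → ℂ} (h : RPack b R S) {δ : ℝ} (hδ : 0 < δ) {w : ℂ} {c : ℝ} (hc : 7/10 ≤ c)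
    (hw : ‖w‖ ≤ c) : ‖R δ w‖ ≤ c := by
  rcases lt_or_ge ‖w‖ (7/10) with h1 | h1
  · linarith [h.small1 δ hδ w h1]
  · rwa [h.big1 δ hδ w h1]

theorem RPack.norm2 {b : ℂ} {R S : ℝ → ℂ → ℂ} (h : RPack b R S) {δ : ℝ} (hδ : 0 < δ) {w : ℂ} {c : ℝ} (hc : 7/10 ≤ c)
    (hw : ‖w‖ ≤ c) : ‖S δ w‖ ≤ c := by
  rcases lt_or_ge ‖w‖ (7/10) with h1 | h1
  · linarith [h.small2 δ hδ w h1]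
  · rwa [h.big2 δ hδ w h1]

theorem RPack.comp_est {b b' : ℂ} {R S R' S' : ℝ → ℂ → ℂ} (h : RPack b R S) (h' : RPack b' R' S') :
    ∃ C : ℝ, 0 < C ∧ ∀ δ0, 0 < δ0 → δ0 < 1 → ∀ χ0 : ℂ, ‖χ0‖ ≤ 2 →
      ContinuousAt (fun q : ℝ × ℂ => S' q.1 (R q.1 q.2)) (δ0, χ0) ∧ ∃ s ∈ 𝓝 (δ0, χ0), ∀ q ∈ s, ∀ q' ∈ s,
    (PP b' (S' δ0 (R δ0 χ0)) + δ0) * ‖S' q.1 (R q.1 q.2) - S' q'.1 (R q'.1 q'.2)‖ ≤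
      C * ((PP b χ0 + δ0) * ‖q.2 - q'.2‖ + |q.1 - q'.1|) := by
  obtain ⟨C, hC, H⟩ := h.est
  obtain ⟨C', hC', H'⟩ := h'.est
  refine ⟨C' * (C + 1), by positivity, fun δ0 hδ hδ1 χ0 hχ => ?_⟩
  obtain ⟨s, hs, k⟩ := H δ0 hδ hδ1 χ0 hχ
  have hM2 : ‖S' δ0 (R δ0 χ0)‖ ≤ 2 := h'.norm2 hδ (by norm_num) (h.norm1 hδ (by norm_num) hχ)
  obtain ⟨s', hs', k'⟩ := H' δ0 hδ hδ1 _ hM2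
  have hRc : ContinuousAt (fun q : ℝ × ℂ => R q.1 q.2) (δ0, χ0) := by
    rw [ContinuousAt, tendsto_iff_norm_sub_tendsto_zero]
    have hb : ∀ᶠ q : ℝ × ℂ in 𝓝 (δ0, χ0), ‖R q.1 q.2 - R δ0 χ0‖ ≤
        C * ((PP b χ0 + δ0) * ‖q.2 - χ0‖ + |q.1 - δ0|) := by
      filter_upwards [hs] with q hq
      exact (k q hq _ (mem_of_mem_nhds hs)).1
    refine squeeze_zero' (Eventually.of_forall fun _ => norm_nonneg _) hb ?_
    have : Continuous fun q : ℝ × ℂ => C * ((PP b χ0 + δ0) * ‖q.2 - χ0‖ + |q.1 - δ0|) := by fun_prop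
    simpa using this.tendsto (δ0, χ0)
  have hMc : ContinuousAt (fun q : ℝ × ℂ => S' q.1 (R q.1 q.2)) (δ0, χ0) :=
    ContinuousAt.comp (f := fun q : ℝ × ℂ => (q.1, R q.1 q.2)) (x := (δ0, χ0)) (h'.cont δ0 hδ (R δ0 χ0))
      (continuousAt_fst.prodMk hRc)
  refine ⟨hMc, ?_⟩
  have hMc2 : ContinuousAt (fun q : ℝ × ℂ => (q.1, S' q.1 (R q.1 q.2))) (δ0, χ0) := continuousAt_fst.prodMk hMc
  have h1 : ∀ᶠ q : ℝ × ℂ in 𝓝 (δ0, χ0), 0 < q.1 := continuousAt_fst.eventually (lt_mem_nhds hδ)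
  refine ⟨_, inter_mem hs (inter_mem (hMc2 hs') h1), ?_⟩
  rintro q ⟨hq1, hq2, hq3⟩ q' ⟨hq1', hq2', hq3'⟩
  have a := (k q hq1 q' hq1').1
  have a' := (k' _ hq2 _ hq2').2
  simp only [h'.inv1 _ hq3, h'.inv1 _ hq3'] at a'
  refine a'.trans ?_
  rw [mul_assoc]
  gcongr
  have : 0 ≤ (PP b χ0 + δ0) * ‖q.2 - q'.2‖ := by have := PP_nonneg b χ0; positivity
  linarith

structure KP (b b' : ℂ) (K L : ℝ → ℂ → ℂ) : Prop where
  odd : ∀ δ, 0 < δ → ∀ χ, K δ (-χ) = - K δ χ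
  dom : ∀ δ, 0 < δ → ∀ χ, ‖χ ^ 2 - b‖ < 95/100 → ‖(K δ χ) ^ 2 - b'‖ < 95/100 ∧ L δ (K δ χ) = χ
  bd : ∀ δ, 0 < δ → ∀ χ, 9/10 ≤ ‖χ ^ 2 - b‖ → ‖χ ^ 2 - b‖ ≤ 1 → K δ χ = χ * csq ((χ ^ 2 - b + b') / χ ^ 2)
  est : ∃ C : ℝ, 0 < C ∧ ∀ δ0, 0 < δ0 → δ0 < 1 → ∀ χ0 : ℂ, ‖χ0 ^ 2 - b‖ ≤ 1 → ∃ s ∈ 𝓝 (δ0, χ0), ∀ q ∈ s, ∀ q' ∈ s,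
    (PP b' (K δ0 χ0) + δ0) * ‖K q.1 q.2 - K q'.1 q'.2‖ ≤ C * ((PP b χ0 + δ0) * ‖q.2 - q'.2‖ + |q.1 - q'.1|)

theorem tT_third (g : ℂ) (h : ‖g‖ < 95/100) : ‖tT g - 1/3‖ < 95/100 := by
  by_cases h9 : 9/10 ≤ ‖g‖
  · rw [tT, cutf_one h9]; push_cast; simpa using h
  · push Not at h9
    have e : tT g - 1/3 = g - (((1 - cutf ‖g‖) / 3 : ℝ) : ℂ) := by rw [tT]; push_cast; ring
    rw [e]
    refine (norm_sub_le _ _).trans_lt ?_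
    rw [Complex.norm_real, Real.norm_of_nonneg (div_nonneg (by linarith [cutf_le ‖g‖]) (by norm_num))]
    have := cutf_ge h9.le
    have := cutf_nonneg ‖g‖
    rcases le_or_gt ‖g‖ (1/2) with h | h <;> linarith

theorem tS_third (g : ℂ) (h : ‖g - 1/3‖ < 95/100) : ‖tS g‖ < 95/100 := by
  by_contra h2
  push Not at h2
  have := tT_tS g
  rw [tT, cutf_one (by linarith)] at this
  rw [← this] at h
  push_cast at h
  rw [add_sub_cancel_right] at h
  linarith

theorem tS_bd (g : ℂ) (h : 9/10 ≤ ‖g - 1/3‖) : tS g = g - 1/3 := by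
  apply tT_inj
  rw [tT_tS, tT, cutf_one h]; push_cast; ring

theorem big_sq {w : ℂ} (h : 1/2 ≤ ‖w‖ ^ 2) : 7/10 ≤ ‖w‖ := by nlinarith [norm_nonneg w]
theorem small_sq {w : ℂ} (h : ‖w‖ < 7/10) : ‖w‖ ^ 2 < 1/2 := by nlinarith [norm_nonneg w]

theorem exists_KP : ∃ K L, KP 0 (1/3) K L ∧ KP (1/3) 0 L K := by
  obtain ⟨R1, S1, h1⟩ := exists_R1
  obtain ⟨R2, S2, h2⟩ := exists_R2
  have h13 : ‖(1/3 : ℂ)‖ = 1/3 := by norm_num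
  refine ⟨fun δ χ => hat tT (S2 δ (R1 δ χ)), fun δ χ => S1 δ (R2 δ (hat tS χ)), ⟨?_, ?_, ?_, ?_⟩, ⟨?_, ?_, ?_, ?_⟩⟩
  · intro δ hδ χ
    rw [h1.odd1 δ hδ, h2.odd2 δ hδ, hat_odd]
  · intro δ hδ χ hχ
    rw [sub_zero, norm_pow] at hχ
    constructor
    · rw [hat_sq HF_tT]
      apply tT_third
      rw [norm_pow]
      rcases lt_or_ge ‖χ‖ (7/10) with h | h
      · linarith [small_sq (h2.small2 δ hδ _ (h1.small1 δ hδ _ h))]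
      · rwa [h1.big1 δ hδ _ h, h2.big2 δ hδ _ h]
    · rw [hat_inv HF_tT tS_tT, h2.inv1 δ hδ, h1.inv2 δ hδ]
  · intro δ hδ χ hχ _
    rw [sub_zero] at hχ ⊢
    have hb : 7/10 ≤ ‖χ‖ := big_sq (by rw [norm_pow] at hχ; linarith)
    rw [h1.big1 δ hδ _ hb, h2.big2 δ hδ _ hb, hat, tT, cutf_one hχ]
    push_cast; rfl
  · obtain ⟨C, hC, H⟩ := h1.comp_est h2
    obtain ⟨M, hM, hlip⟩ := hat_lip HF_tT
    refine ⟨180 * M * C, by positivity, fun δ0 hδ hδ1 χ0 hχ => ?_⟩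
    rw [sub_zero, norm_pow] at hχ
    have hχ2 : ‖χ0‖ ≤ 2 := by nlinarith [norm_nonneg χ0]
    obtain ⟨hc, s, hs, k⟩ := H δ0 hδ hδ1 χ0 hχ2
    have hM2 : ‖S2 δ0 (R1 δ0 χ0)‖ ≤ 2 := h2.norm2 hδ (by norm_num) (h1.norm1 hδ (by norm_num) hχ2)
    have hn : ∀ᶠ q : ℝ × ℂ in 𝓝 (δ0, χ0), ‖S2 q.1 (R1 q.1 q.2)‖ < 3 :=
      hc.norm.eventually (gt_mem_nhds (by simp only; linarith))
    refine ⟨_, inter_mem hs hn, ?_⟩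
    rintro q ⟨hq, hqn⟩ q' ⟨hq', hqn'⟩
    have a := k q hq q' hq'
    have b := hlip _ _ (le_of_lt hqn) (le_of_lt hqn')
    have c := hat_PP HF_tT hM2
    have hP := PP_nonneg (1/3) (S2 δ0 (R1 δ0 χ0))
    calc _ ≤ (180 * (PP (1/3) (S2 δ0 (R1 δ0 χ0)) + δ0)) * (M * ‖S2 q.1 (R1 q.1 q.2) - S2 q'.1 (R1 q'.1 q'.2)‖) := by
          gcongr; linarith
      _ = 180 * M * ((PP (1/3) (S2 δ0 (R1 δ0 χ0)) + δ0) * ‖S2 q.1 (R1 q.1 q.2) - S2 q'.1 (R1 q'.1 q'.2)‖) := by ring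
      _ ≤ 180 * M * (C * ((PP 0 χ0 + δ0) * ‖q.2 - q'.2‖ + |q.1 - q'.1|)) := by gcongr
      _ = _ := by ring
  · intro δ hδ χ
    rw [hat_odd, h2.odd1 δ hδ, h1.odd2 δ hδ]
  · intro δ hδ χ hχ
    constructor
    · have h3 := tS_third _ hχ
      rw [← hat_sq HF_tS, norm_pow] at h3
      rw [sub_zero, norm_pow]
      rcases lt_or_ge ‖hat tS χ‖ (7/10) with h | h
      · linarith [small_sq (h1.small2 δ hδ _ (h2.small1 δ hδ _ h))]
      · rwa [h2.big1 δ hδ _ h, h1.big2 δ hδ _ h]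
    · rw [h1.inv1 δ hδ, h2.inv2 δ hδ, hat_inv HF_tS tT_tS]
  · intro δ hδ χ hχ _
    have e := tS_bd _ hχ
    have e2 := hat_sq HF_tS χ
    rw [e] at e2
    have hb : 7/10 ≤ ‖hat tS χ‖ := big_sq (by rw [← norm_pow, e2]; linarith)
    rw [h2.big1 δ hδ _ hb, h1.big2 δ hδ _ hb, hat, e, add_zero]
  · obtain ⟨C, hC, H⟩ := h2.comp_est h1
    obtain ⟨M, hM, hlip⟩ := hat_lip HF_tS
    refine ⟨180 * (M + 1) * C, by positivity, fun δ0 hδ hδ1 χ0 hχ => ?_⟩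
    have hχ2 : ‖χ0‖ ^ 2 ≤ 4/3 := by
      rw [← norm_pow]
      have := norm_sub_norm_le (χ0 ^ 2) (1/3)
      rw [h13] at this; linarith
    have hχ3 : ‖χ0‖ ≤ 2 := by nlinarith [norm_nonneg χ0]
    have hn := hat_norm HF_tS χ0
    have hh2 : ‖hat tS χ0‖ ≤ 2 := by nlinarith [norm_nonneg (hat tS χ0)]
    obtain ⟨hc, s, hs, k⟩ := H δ0 hδ hδ1 (hat tS χ0) hh2
    have hcc : ContinuousAt (fun q : ℝ × ℂ => (q.1, hat tS q.2)) (δ0, χ0) :=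
      continuousAt_fst.prodMk (ContinuousAt.comp (f := fun q : ℝ × ℂ => q.2) (x := (δ0, χ0)) (hat_LL HF_tS χ0).ca
        continuousAt_snd)
    have hn : ∀ᶠ q : ℝ × ℂ in 𝓝 (δ0, χ0), ‖q.2‖ < 3 :=
      continuousAt_snd.norm.eventually (gt_mem_nhds (by simp only; linarith))
    refine ⟨_, inter_mem (hcc hs) hn, ?_⟩
    rintro q ⟨hq, hqn⟩ q' ⟨hq', hqn'⟩
    have a := k _ hq _ hq'
    have b := hlip _ _ (le_of_lt hqn) (le_of_lt hqn')
    have c := hat_PP HF_tS hχ3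
    have hP := PP_nonneg (1/3) χ0
    refine a.trans ?_
    have hA := abs_nonneg (q.1 - q'.1)
    have hN := norm_nonneg (q.2 - q'.2)
    calc _ ≤ C * ((180 * (PP (1/3) χ0 + δ0)) * (M * ‖q.2 - q'.2‖) + 180 * (M + 1) * |q.1 - q'.1|) := by
          gcongr
          · linarith
          · nlinarith
      _ ≤ C * ((180 * (PP (1/3) χ0 + δ0)) * ((M + 1) * ‖q.2 - q'.2‖) + 180 * (M + 1) * |q.1 - q'.1|) := by
          gcongr; linarith
      _ = _ := by ring

def uu (h : ℂ) : ℂ := Complex.exp (-Complex.log (1 - h ^ 2) / 12)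

theorem uu_re {h : ℂ} (hh : ‖h‖ < 1) : 0 < (1 - h ^ 2).re := by
  have h1 := Complex.re_le_norm (h ^ 2)
  rw [norm_pow] at h1
  rw [Complex.sub_re, Complex.one_re]
  nlinarith [norm_nonneg h]

theorem uu_ne (h : ℂ) : uu h ≠ 0 := Complex.exp_ne_zero _

theorem uu_pow {h : ℂ} (hh : ‖h‖ < 1) : uu h ^ 12 * (1 - h ^ 2) = 1 := by
  have h0 : 1 - h ^ 2 ≠ 0 := re_ne (uu_re hh)
  rw [uu, ← Complex.exp_nat_mul]
  have : (12:ℕ) * (-Complex.log (1 - h ^ 2) / 12) = - Complex.log (1 - h ^ 2) := by push_cast; ring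
  rw [this, Complex.exp_neg, Complex.exp_log h0, inv_mul_cancel₀ h0]

theorem one_sub_bd {h : ℂ} (hh : ‖h‖ ≤ 97/100) : 1/20 ≤ ‖1 - h ^ 2‖ ∧ ‖1 - h ^ 2‖ ≤ 2 := by
  have h1 : ‖h ^ 2‖ ≤ 95/100 := by rw [norm_pow]; nlinarith [norm_nonneg h]
  have h2 := norm_sub_norm_le (1:ℂ) (h ^ 2)
  have h3 := norm_sub_le (1:ℂ) (h ^ 2)
  rw [norm_one] at h2 h3
  constructor <;> linarith

theorem uu_bd {h : ℂ} (hh : ‖h‖ ≤ 97/100) : 1/2 ≤ ‖uu h‖ ∧ ‖uu h‖ ≤ 2 := by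
  have h1 := uu_pow (h := h) (by linarith)
  obtain ⟨h2, h3⟩ := one_sub_bd hh
  have h4 : ‖uu h‖ ^ 12 * ‖1 - h ^ 2‖ = 1 := by rw [← norm_pow, ← norm_mul, h1, norm_one]
  constructor
  · by_contra h5
    push Not at h5
    have : ‖uu h‖ ^ 12 ≤ (1/2) ^ 12 := by gcongr
    have h0 : 0 ≤ ‖uu h‖ ^ 12 := by positivity
    nlinarith
  · by_contra h5
    push Not at h5
    have : 2 ^ 12 ≤ ‖uu h‖ ^ 12 := by gcongr
    nlinarith

theorem uu_deriv {b χ : ℂ} (hh : ‖χ ^ 2 - b‖ < 1) :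
    HasStrictDerivAt (fun χ => uu (χ ^ 2 - b))
      (uu (χ ^ 2 - b) * ((χ ^ 2 - b) * χ / (3 * (1 - (χ ^ 2 - b) ^ 2)))) χ := by
  have hs := re_slit (uu_re hh)
  have h0 : 1 - (χ ^ 2 - b) ^ 2 ≠ 0 := re_ne (uu_re hh)
  have h1 : HasStrictDerivAt (fun χ : ℂ => χ ^ 2 - b) (2 * χ) χ := by
    have := (hasStrictDerivAt_pow 2 χ).sub_const b
    refine HasStrictDerivAt.congr_deriv this ?_
    push_cast; ring
  have h2 : HasStrictDerivAt (fun χ : ℂ => 1 - (χ ^ 2 - b) ^ 2) (-(2 * (χ ^ 2 - b) * (2 * χ))) χ := by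
    have := (h1.pow 2).const_sub 1
    refine HasStrictDerivAt.congr_deriv this ?_
    push_cast; ring
  have h3 := ((h2.clog hs).neg.div_const 12).cexp
  refine HasStrictDerivAt.congr_deriv h3 ?_
  unfold uu
  congr 1
  field_simp
  ring

def Par (b c θ χ : ℂ) : CC := (-θ ^ 12, -θ ^ 14 * uu (χ ^ 2 - b) ^ 2, -c * θ ^ 15 * (χ * uu (χ ^ 2 - b) ^ 3))

theorem strict_pair {f g : ℂ → ℂ} {f' g' θ0 χ0 : ℂ} (hf : HasStrictDerivAt f f' θ0) (hg : HasStrictDerivAt g g' χ0)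
    {ε : ℝ} (hε : 0 < ε) : ∃ s ∈ 𝓝 (θ0, χ0), ∀ q ∈ s, ∀ q' ∈ s,
    ‖f q.1 * g q.2 - f q'.1 * g q'.2 - (f' * g χ0 * (q.1 - q'.1) + f θ0 * g' * (q.2 - q'.2))‖ ≤
      ε * (‖q.1 - q'.1‖ + ‖q.2 - q'.2‖) := by
  have h1 : HasStrictFDerivAt (fun q : ℂ × ℂ => f q.1) _ (θ0, χ0) :=
    HasStrictFDerivAt.comp (x := (θ0, χ0)) (g := f) (f := Prod.fst) hf.hasStrictFDerivAt hasStrictFDerivAt_fst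
  have h2 : HasStrictFDerivAt (fun q : ℂ × ℂ => g q.2) _ (θ0, χ0) :=
    HasStrictFDerivAt.comp (x := (θ0, χ0)) (g := g) (f := Prod.snd) hg.hasStrictFDerivAt hasStrictFDerivAt_snd
  have h3 := (h1.mul h2).isLittleO.def hε
  rw [nhds_prod_eq, eventually_prod_self_iff'] at h3
  obtain ⟨s, hs, H⟩ := h3
  refine ⟨s, hs, fun q hq q' hq' => ?_⟩
  have := H q hq q' hq'
  simp only [Pi.mul_apply] at this
  refine le_trans (le_of_eq ?_) (this.trans ?_)
  · congr 1
    simp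
    ring
  · gcongr
    rw [Prod.norm_def]
    exact max_le (by simp) (by simp)

theorem norm_lower {a d e : ℂ} {ε : ℝ} (h : ‖a - (d + e)‖ ≤ ε) : ‖e‖ ≤ ‖a‖ + ‖d‖ + ε := by
  have h1 : ‖e‖ ≤ ‖a - d‖ + ‖a - (d + e)‖ := by
    rw [show e = (a - d) - (a - (d + e)) by ring]
    refine (norm_sub_le _ _).trans (le_of_eq ?_)
    congr 2; ring
  linarith [norm_sub_le a d]

theorem norm_upper {a d e : ℂ} {ε : ℝ} (h : ‖a - (d + e)‖ ≤ ε) : ‖a‖ ≤ ‖d‖ + ‖e‖ + ε := by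
  have h1 : ‖a‖ ≤ ‖d + e‖ + ‖a - (d + e)‖ := by
    have := norm_add_le (d + e) (a - (d + e))
    rwa [add_sub_cancel] at this
  linarith [norm_add_le d e]

theorem Par_bds {b χ : ℂ} (hb : ‖b‖ ≤ 1/3) (hh : ‖χ ^ 2 - b‖ ≤ 97/100) : ∃ U' V' : ℂ,
    HasStrictDerivAt (fun χ => uu (χ ^ 2 - b) ^ 2) U' χ ∧
    HasStrictDerivAt (fun χ => χ * uu (χ ^ 2 - b) ^ 3) V' χ ∧
    PP b χ / 12 ≤ ‖U'‖ ∧ ‖U'‖ ≤ 60 * PP b χ ∧ 1/24 ≤ ‖V'‖ ∧ ‖V'‖ ≤ 300 ∧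
    ‖uu (χ ^ 2 - b) ^ 2‖ ≤ 4 ∧ ‖χ * uu (χ ^ 2 - b) ^ 3‖ ≤ 16 := by
  have hd := uu_deriv (b := b) (χ := χ) (by linarith)
  have h0 : 1 - (χ ^ 2 - b) ^ 2 ≠ 0 := re_ne (uu_re (by linarith))
  obtain ⟨u1, u2⟩ := uu_bd hh
  obtain ⟨w1, w2⟩ := one_sub_bd hh
  have hχ : ‖χ‖ ≤ 2 := by
    have := norm_sub_norm_le (χ ^ 2) b
    rw [norm_pow] at this
    nlinarith [norm_nonneg χ]
  set h := χ ^ 2 - b with hhd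
  set u := uu h
  set w := 1 - h ^ 2 with hw
  have hwp : 0 < ‖w‖ := by linarith
  have hP : PP b χ = ‖χ‖ * ‖h‖ := rfl
  have hP0 : 0 ≤ ‖χ‖ * ‖h‖ := by positivity
  refine ⟨2 / 3 * (χ * h) * u ^ 2 / w, u ^ 3 * (1 + b * h) / w, ?_, ?_, ?_⟩
  · refine HasStrictDerivAt.congr_deriv (hd.pow 2) ?_
    field_simp
    ring
  · refine HasStrictDerivAt.congr_deriv ((hasStrictDerivAt_id χ).mul (hd.pow 3)) ?_
    have e : b = χ ^ 2 - h := by rw [hhd]; ring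
    have hu : uu (χ ^ 2 - b) = u := rfl
    simp only [id, hu]
    field_simp
    rw [e, hw]
    ring
  have eU : ‖2 / 3 * (χ * h) * u ^ 2 / w‖ = 2/3 * (‖χ‖ * ‖h‖) * ‖u‖ ^ 2 / ‖w‖ := by
    simp
  have eV : ‖u ^ 3 * (1 + b * h) / w‖ = ‖u‖ ^ 3 * ‖1 + b * h‖ / ‖w‖ := by simp
  have q2a : 1/4 ≤ ‖u‖ ^ 2 := by nlinarith
  have q2b : ‖u‖ ^ 2 ≤ 4 := by nlinarith
  have q3a : (1/2) ^ 3 ≤ ‖u‖ ^ 3 := by gcongr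
  have q3b : ‖u‖ ^ 3 ≤ 2 ^ 3 := by gcongr
  have hbh : ‖b * h‖ ≤ 1/3 := by
    rw [norm_mul]; nlinarith [norm_nonneg b, norm_nonneg h]
  have k1 : 2/3 ≤ ‖1 + b * h‖ := by
    have := norm_sub_le (1 + b * h) (b * h)
    rw [add_sub_cancel_right, norm_one] at this
    linarith
  have k2 : ‖1 + b * h‖ ≤ 4/3 := by
    have := norm_add_le 1 (b * h)
    rw [norm_one] at this
    linarith
  rw [eU, eV, hP]
  refine ⟨?_, ?_, ?_, ?_, ?_, ?_⟩
  · rw [le_div_iff₀ hwp]; nlinarith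
  · rw [div_le_iff₀ hwp]
    have : ‖χ‖ * ‖h‖ * ‖u‖ ^ 2 ≤ ‖χ‖ * ‖h‖ * 4 := by gcongr
    have : ‖χ‖ * ‖h‖ * (1/20) ≤ ‖χ‖ * ‖h‖ * ‖w‖ := by gcongr
    nlinarith
  · rw [le_div_iff₀ hwp]; nlinarith
  · rw [div_le_iff₀ hwp]; nlinarith [norm_nonneg (1 + b * h)]
  · rw [norm_pow]; exact q2b
  · rw [norm_mul, norm_pow]; nlinarith [norm_nonneg χ]

set_option maxHeartbeats 1000000 in
theorem Par_est {b c : ℂ} (hb : ‖b‖ ≤ 1/3) (hc1 : 1/2 ≤ ‖c‖) (hc2 : ‖c‖ ≤ 1) {θ0 χ0 : ℂ} (hθ : 0 < ‖θ0‖)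
    (hθ1 : ‖θ0‖ < 1) (hh : ‖χ0 ^ 2 - b‖ ≤ 97/100) : ∃ s ∈ 𝓝 (θ0, χ0), ∀ q ∈ s, ∀ q' ∈ s,
    ‖Par b c q.1 q.2 - Par b c q'.1 q'.2‖ ≤ 10 ^ 5 * (‖θ0‖ ^ 11 * ‖q.1 - q'.1‖ +
      ‖θ0‖ ^ 14 * ((PP b χ0 + ‖θ0‖) * ‖q.2 - q'.2‖)) ∧
    ‖θ0‖ ^ 11 * ‖q.1 - q'.1‖ ≤ 10 ^ 5 * ‖Par b c q.1 q.2 - Par b c q'.1 q'.2‖ ∧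
    ‖θ0‖ ^ 14 * ((PP b χ0 + ‖θ0‖) * ‖q.2 - q'.2‖) ≤ 10 ^ 7 * ‖Par b c q.1 q.2 - Par b c q'.1 q'.2‖ := by
  obtain ⟨U', V', dU, dV, U1, U2, V1, V2, U3, V3⟩ := Par_bds hb hh
  have hpw : ∀ n : ℕ, HasStrictDerivAt (fun θ : ℂ => -θ ^ n) (-(n * θ0 ^ (n - 1))) θ0 := fun n =>
    (hasStrictDerivAt_pow n θ0).neg
  have hpc : HasStrictDerivAt (fun θ : ℂ => -c * θ ^ 15) (-c * (15 * θ0 ^ 14)) θ0 := by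
    have := (hasStrictDerivAt_pow 15 θ0).const_mul (-c)
    exact this
  set r := ‖θ0‖ with hr
  have hε : 0 < r ^ 15 / 10000 := by positivity
  obtain ⟨s1, hs1, H1⟩ := strict_pair (hpw 12) (hasStrictDerivAt_const χ0 (1:ℂ)) hε
  obtain ⟨s2, hs2, H2⟩ := strict_pair (hpw 14) dU hε
  obtain ⟨s3, hs3, H3⟩ := strict_pair hpc dV hε
  refine ⟨_, inter_mem hs1 (inter_mem hs2 hs3), ?_⟩
  rintro q ⟨k1, k2, k3⟩ q' ⟨k1', k2', k3'⟩
  have a1 := H1 q k1 q' k1'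
  have a2 := H2 q k2 q' k2'
  have a3 := H3 q k3 q' k3'
  simp only [mul_one, mul_zero, zero_mul, add_zero] at a1
  set N := ‖Par b c q.1 q.2 - Par b c q'.1 q'.2‖ with hN
  set dx := -q.1 ^ 12 - -q'.1 ^ 12
  set dy := -q.1 ^ 14 * uu (q.2 ^ 2 - b) ^ 2 - -q'.1 ^ 14 * uu (q'.2 ^ 2 - b) ^ 2
  set dz := -c * q.1 ^ 15 * (q.2 * uu (q.2 ^ 2 - b) ^ 3) - -c * q'.1 ^ 15 * (q'.2 * uu (q'.2 ^ 2 - b) ^ 3)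
  have hNe : N = max ‖dx‖ (max ‖dy‖ ‖dz‖) := by
    rw [hN, Par, Par, Prod.mk_sub_mk, Prod.mk_sub_mk, Prod.norm_mk, Prod.norm_mk]
  have nx : ‖dx‖ ≤ N := by rw [hNe]; exact le_max_left _ _
  have ny : ‖dy‖ ≤ N := by rw [hNe]; exact (le_max_left _ _).trans (le_max_right _ _)
  have nz : ‖dz‖ ≤ N := by rw [hNe]; exact (le_max_right _ _).trans (le_max_right _ _)
  set T := ‖q.1 - q'.1‖ with hT
  set X := ‖q.2 - q'.2‖ with hX
  have hT0 : 0 ≤ T := norm_nonneg _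
  have hX0 : 0 ≤ X := norm_nonneg _
  have hP := PP_nonneg b χ0
  set A := r ^ 11 * T with hA
  set D := r ^ 15 * X with hD
  set G := r ^ 14 * (PP b χ0 * X) with hG
  have hA0 : 0 ≤ A := by positivity
  have hD0 : 0 ≤ D := by positivity
  have hG0 : 0 ≤ G := by positivity
  have pw : ∀ m : ℕ, 11 ≤ m → r ^ m * T ≤ A := fun m hm =>
    mul_le_mul_of_nonneg_right (pow_le_pow_of_le_one hθ.le hθ1.le hm) hT0
  have herr : r ^ 15 / 10000 * (T + X) ≤ (A + D) / 10000 := by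
    have := pw 15 (by norm_num)
    have e : r ^ 15 / 10000 * (T + X) = (r ^ 15 * T + D) / 10000 := by rw [hD]; ring
    rw [e]; linarith
  have t13 : r ^ 13 * T ≤ A := pw 13 (by norm_num)
  have t14 : r ^ 14 * T ≤ A := pw 14 (by norm_num)
  have m1 : ‖-((12:ℕ) * θ0 ^ (12 - 1)) * (q.1 - q'.1)‖ = 12 * A := by
    simp [← hr, ← hT, hA]; ring
  have m2 : ‖-((14:ℕ) * θ0 ^ (14 - 1)) * uu (χ0 ^ 2 - b) ^ 2 * (q.1 - q'.1)‖ ≤ 56 * A := by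
    rw [norm_mul, norm_mul, ← hT]
    have : ‖-((14:ℕ) * θ0 ^ (14 - 1))‖ = 14 * r ^ 13 := by simp [← hr]
    rw [this]
    calc _ ≤ 14 * r ^ 13 * 4 * T := by gcongr
      _ = 56 * (r ^ 13 * T) := by ring
      _ ≤ _ := by linarith
  have m3 : ‖-c * (15 * θ0 ^ 14) * (χ0 * uu (χ0 ^ 2 - b) ^ 3) * (q.1 - q'.1)‖ ≤ 240 * A := by
    rw [norm_mul, norm_mul _ (χ0 * _), ← hT]
    have : ‖-c * (15 * θ0 ^ 14)‖ = ‖c‖ * (15 * r ^ 14) := by simp [← hr]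
    rw [this]
    calc _ ≤ 1 * (15 * r ^ 14) * 16 * T := by gcongr
      _ = 240 * (r ^ 14 * T) := by ring
      _ ≤ _ := by linarith
  have m4 : ‖-θ0 ^ 14 * U' * (q.2 - q'.2)‖ = r ^ 14 * ‖U'‖ * X := by
    rw [norm_mul, norm_mul, norm_neg, norm_pow]
  have m4a : G / 12 ≤ r ^ 14 * ‖U'‖ * X := by
    calc G / 12 = r ^ 14 * (PP b χ0 / 12) * X := by rw [hG]; ring
      _ ≤ _ := by gcongr
  have m4b : r ^ 14 * ‖U'‖ * X ≤ 60 * G := by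
    calc _ ≤ r ^ 14 * (60 * PP b χ0) * X := by gcongr
      _ = _ := by rw [hG]; ring
  have m5 : ‖-c * θ0 ^ 15 * V' * (q.2 - q'.2)‖ = ‖c‖ * ‖V'‖ * D := by
    rw [norm_mul, norm_mul, norm_mul, norm_neg, norm_pow, hD]; ring
  have m5a : D / 48 ≤ ‖c‖ * ‖V'‖ * D := by
    have : 1/2 * (1/24) * D ≤ ‖c‖ * ‖V'‖ * D := by gcongr
    linarith
  have m5b : ‖c‖ * ‖V'‖ * D ≤ 300 * D := by
    have : ‖c‖ * ‖V'‖ * D ≤ 1 * 300 * D := by gcongr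
    linarith
  have a1' : ‖dx - (0 + -((12:ℕ) * θ0 ^ (12 - 1)) * (q.1 - q'.1))‖ ≤ r ^ 15 / 10000 * (T + X) := by
    rw [zero_add]; exact a1
  have l1 := norm_lower a1'
  have l2 := norm_lower a2
  have l3 := norm_lower a3
  have p1 := norm_upper a1'
  have p2 := norm_upper a2
  have p3 := norm_upper a3
  rw [norm_zero, m1] at l1 p1
  rw [m4] at l2 p2
  rw [m5] at l3 p3
  have l2g : r ^ 14 * ‖U'‖ * X ≤ ‖dy‖ + 56 * A + r ^ 15 / 10000 * (T + X) := by
    refine l2.trans ?_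
    gcongr
  have p2g : ‖dy‖ ≤ 56 * A + r ^ 14 * ‖U'‖ * X + r ^ 15 / 10000 * (T + X) := by
    refine p2.trans ?_
    gcongr
  have eDG : r ^ 14 * ((PP b χ0 + r) * X) = G + D := by rw [hG, hD]; ring
  rw [eDG]
  refine ⟨?_, ?_, ?_⟩
  · rw [hNe]
    refine max_le ?_ (max_le ?_ ?_) <;> linarith
  · linarith
  · linarith

def hh (b c : ℂ) (p : CC) : ℂ := p.2.2 ^ 2 * p.1 / (c ^ 2 * p.2.1 ^ 3) - b
def om (b c : ℂ) (p : CC) : ℂ := (p.2.1 / p.1) / uu (hh b c p) ^ 2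
def chj (b c θ : ℂ) (p : CC) : ℂ := (p.2.2 / p.1) / (c * θ ^ 3 * uu (hh b c p) ^ 3)
def DiscM (b c b' c' : ℂ) (K : ℝ → ℂ → ℂ) (p : CC) : CC :=
  Par b' c' (csq (om b c p)) (K ‖csq (om b c p)‖ (chj b c (csq (om b c p)) p))

structure DEq (b c : ℂ) (p : CC) : Prop where
  x0 : p.1 ≠ 0
  y0 : p.2.1 ≠ 0
  hlt : ‖hh b c p‖ < 1
  eqn : p.2.1 ^ 6 * (1 - hh b c p ^ 2) = -p.1 ^ 7

theorem om_ne {b c : ℂ} {p : CC} (h : DEq b c p) : om b c p ≠ 0 :=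
  div_ne_zero (div_ne_zero h.y0 h.x0) (pow_ne_zero _ (uu_ne _))

theorem chj_sq {b c θ : ℂ} (hc : c ≠ 0) {p : CC} (hx : p.1 ≠ 0) (hy : p.2.1 ≠ 0) (hθ : θ ^ 2 = om b c p) :
    chj b c θ p ^ 2 = hh b c p + b := by
  have hu : uu (hh b c p) ≠ 0 := uu_ne _
  have e1 : chj b c θ p ^ 2 = (p.2.2 / p.1) ^ 2 / (c ^ 2 * (θ ^ 2) ^ 3 * uu (hh b c p) ^ 6) := by
    rw [chj, div_pow]; congr 1; ring
  rw [e1, hθ, om]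
  have e2 : hh b c p + b = p.2.2 ^ 2 * p.1 / (c ^ 2 * p.2.1 ^ 3) := by rw [hh]; ring
  rw [e2]
  field_simp

theorem Par_of_sq {b c θ : ℂ} (hc : c ≠ 0) {p : CC} (h : DEq b c p) (hθ : θ ^ 2 = om b c p) :
    Par b c θ (chj b c θ p) = p := by
  have hx := h.x0
  have hy := h.y0
  have e := chj_sq hc hx hy hθ
  have hu : uu (hh b c p) ≠ 0 := uu_ne _
  have e2 : chj b c θ p ^ 2 - b = hh b c p := by rw [e]; ring
  have hup := uu_pow h.hlt
  have t0 : θ ≠ 0 := by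
    intro h0
    rw [h0] at hθ
    exact om_ne h (by rw [← hθ]; simp)
  have o6 : θ ^ 12 = - p.1 := by
    have : θ ^ 12 = (om b c p) ^ 6 := by rw [← hθ]; ring
    rw [this, om, div_pow, div_pow, ← pow_mul, div_div, div_eq_iff (by positivity)]
    have := h.eqn
    calc p.2.1 ^ 6 = p.2.1 ^ 6 * (uu (hh b c p) ^ 12 * (1 - hh b c p ^ 2)) := by rw [hup, mul_one]
      _ = uu (hh b c p) ^ 12 * (p.2.1 ^ 6 * (1 - hh b c p ^ 2)) := by ring
      _ = _ := by rw [this]; ring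
  rw [Par, e2]
  refine Prod.ext ?_ (Prod.ext ?_ ?_)
  · show -θ ^ 12 = _
    rw [o6, neg_neg]
  · show -θ ^ 14 * uu (hh b c p) ^ 2 = _
    rw [show θ ^ 14 = θ ^ 12 * θ ^ 2 by ring, o6, hθ, om]
    field_simp
  · show -c * θ ^ 15 * (chj b c θ p * uu (hh b c p) ^ 3) = _
    rw [show θ ^ 15 = θ ^ 12 * θ ^ 3 by ring, o6, chj]
    field_simp

theorem Par_inv {b c θ χ : ℂ} (hc : c ≠ 0) (hθ : θ ≠ 0) (hχ : ‖χ ^ 2 - b‖ < 1) :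
    hh b c (Par b c θ χ) = χ ^ 2 - b ∧ om b c (Par b c θ χ) = θ ^ 2 ∧ chj b c θ (Par b c θ χ) = χ ∧
    DEq b c (Par b c θ χ) := by
  have hu : uu (χ ^ 2 - b) ≠ 0 := uu_ne _
  have hup := uu_pow hχ
  have e : hh b c (Par b c θ χ) = χ ^ 2 - b := by
    simp only [hh, Par]
    congr 1
    rw [div_eq_iff (by
      refine mul_ne_zero (pow_ne_zero _ hc) (pow_ne_zero _ (mul_ne_zero (neg_ne_zero.2 (pow_ne_zero _ hθ)) (pow_ne_zero _ hu))))]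
    ring
  refine ⟨e, ?_, ?_, ?_, ?_, ?_, ?_⟩
  · rw [om, e]; simp only [Par]; field_simp
  · rw [chj, e]; simp only [Par]; field_simp
  · simp [Par, hθ]
  · simp [Par, hθ, hu]
  · rw [e]; exact hχ
  · rw [e]; simp only [Par]
    linear_combination θ ^ 84 * hup

theorem Disc_eq {b c b' c' θ : ℂ} {K : ℝ → ℂ → ℂ} (hodd : ∀ δ, 0 < δ → ∀ χ, K δ (-χ) = -K δ χ)
    {p : CC} (h : DEq b c p) (hθ : θ ^ 2 = om b c p) :
    DiscM b c b' c' K p = Par b' c' θ (K ‖θ‖ (chj b c θ p)) := by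
  have h0 := om_ne h
  have t0 : θ ≠ 0 := by
    intro h1
    rw [h1] at hθ
    exact h0 (by rw [← hθ]; simp)
  have e := csq_sq h0
  rw [← hθ] at e
  have e' := sq_eq_sq_iff_eq_or_eq_neg.1 e
  rw [hθ] at e'
  rw [DiscM]
  rcases e' with e' | e'
  · rw [e']
  · rw [e']
    have ec : chj b c (-θ) p = - chj b c θ p := by
      rw [chj, chj, Odd.neg_pow (by decide : Odd 3)]
      rw [mul_neg, neg_mul, div_neg]
    rw [ec, norm_neg, hodd _ (norm_pos_iff.2 t0)]
    simp only [Par, neg_sq]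
    refine Prod.ext ?_ (Prod.ext ?_ ?_)
    · show -(-θ) ^ 12 = - θ ^ 12
      ring
    · simp only []; ring
    · simp only []; ring

theorem Disc_facts {b c b' c' : ℂ} {K L : ℝ → ℂ → ℂ} (hc : c ≠ 0) (hc' : c' ≠ 0) (k : KP b b' K L)
    (k' : KP b' b L K)
    {p : CC} (h : DEq b c p) (h95 : ‖hh b c p‖ < 95/100) :
    DEq b' c' (DiscM b c b' c' K p) ∧ ‖hh b' c' (DiscM b c b' c' K p)‖ < 95/100 ∧
    (DiscM b c b' c' K p).1 = p.1 ∧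
    DiscM b' c' b c L (DiscM b c b' c' K p) = p := by
  have h0 := om_ne h
  have e := csq_sq h0
  set θ := csq (om b c p) with hθ
  have t0 : θ ≠ 0 := csq_ne _
  have ec := chj_sq hc h.x0 h.y0 e
  have hP := Par_of_sq hc h e
  have ed : DiscM b c b' c' K p = Par b' c' θ (K ‖θ‖ (chj b c θ p)) := rfl
  set χ := chj b c θ p
  have hd : ‖χ ^ 2 - b‖ < 95/100 := by rw [ec, add_sub_cancel_right]; exact h95
  obtain ⟨d1, d2⟩ := k.dom ‖θ‖ (norm_pos_iff.2 t0) χ hd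
  set κ := K ‖θ‖ χ
  obtain ⟨i1, i2, i3, i4⟩ := Par_inv (b := b') hc' t0 (χ := κ) (d1.trans (by norm_num))
  rw [ed]
  refine ⟨i4, by rw [i1]; exact d1, ?_, ?_⟩
  · have : (Par b c θ χ).1 = p.1 := by rw [hP]
    exact this
  · rw [Disc_eq k'.odd i4 i2.symm, i3, d2, hP]

theorem Disc_bd {b c b' c' : ℂ} {K L : ℝ → ℂ → ℂ} (hc : c ≠ 0) (k : KP b b' K L)
    (hb : ‖b‖ ≤ 1/3) (hb' : ‖b'‖ ≤ 1/3)
    {p : CC} (h : DEq b c p) (h9 : 9/10 ≤ ‖hh b c p‖) :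
    DiscM b c b' c' K p = (p.1, p.2.1, c' / c * (p.2.2 * csq ((hh b c p + b') / (hh b c p + b)))) := by
  have h0 := om_ne h
  have e := csq_sq h0
  set θ := csq (om b c p) with hθ
  have t0 : θ ≠ 0 := csq_ne _
  have ec := chj_sq hc h.x0 h.y0 e
  have hP := Par_of_sq hc h e
  have ed : DiscM b c b' c' K p = Par b' c' θ (K ‖θ‖ (chj b c θ p)) := rfl
  have nz : ∀ w : ℂ, ‖w‖ ≤ 1/3 → hh b c p + w ≠ 0 := by
    intro w hw h0
    rw [add_eq_zero_iff_eq_neg] at h0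
    rw [h0, norm_neg] at h9
    linarith
  have hχ : ‖chj b c θ p ^ 2 - b‖ = ‖hh b c p‖ := by rw [ec, add_sub_cancel_right]
  have hk := k.bd ‖θ‖ (norm_pos_iff.2 t0) (chj b c θ p) (by rw [hχ]; exact h9) (by rw [hχ]; exact h.hlt.le)
  rw [ec, add_sub_cancel_right] at hk
  set A := (hh b c p + b') / (hh b c p + b) with hA
  have hA0 : A ≠ 0 := div_ne_zero (nz _ hb') (nz _ hb)
  have hk2 : (K ‖θ‖ (chj b c θ p)) ^ 2 - b' = hh b c p := by
    rw [hk, mul_pow, csq_sq hA0, ec, hA, mul_div_cancel₀ _ (nz _ hb)]; ring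
  have e2 : chj b c θ p ^ 2 - b = hh b c p := by rw [ec]; ring
  rw [ed]
  simp only [Par, hk2]
  rw [Par, e2] at hP
  have q1 : -θ ^ 12 = p.1 := congrArg (fun p : CC => p.1) hP
  have q2 : -θ ^ 14 * uu (hh b c p) ^ 2 = p.2.1 := congrArg (fun p : CC => p.2.1) hP
  have q3 : -c * θ ^ 15 * (chj b c θ p * uu (hh b c p) ^ 3) = p.2.2 := congrArg (fun p : CC => p.2.2) hP
  rw [q1, q2, hk, ← q3]
  refine Prod.ext rfl (Prod.ext rfl ?_)
  show -c' * θ ^ 15 * _ = _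
  field_simp

theorem Disc_norm {b c b' c' : ℂ} {K L : ℝ → ℂ → ℂ} (hc : c ≠ 0) (k : KP b b' K L)
    (hb' : ‖b'‖ ≤ 1/3) (hc2 : ‖c'‖ ≤ 1)
    {p : CC} (h : DEq b c p) (h95 : ‖hh b c p‖ < 95/100) (hx1 : ‖p.1‖ < 1) :
    ‖csq (om b c p)‖ < 1 ∧ ‖DiscM b c b' c' K p‖ ≤ 16 * ‖p.1‖ := by
  have h0 := om_ne h
  have e := csq_sq h0
  set θ := csq (om b c p) with hθ
  have t0 : θ ≠ 0 := csq_ne _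
  have ec := chj_sq hc h.x0 h.y0 e
  have hP := Par_of_sq hc h e
  have ed : DiscM b c b' c' K p = Par b' c' θ (K ‖θ‖ (chj b c θ p)) := rfl
  have q1 : -θ ^ 12 = p.1 := congrArg (fun p : CC => p.1) hP
  have n1 : ‖θ‖ ^ 12 = ‖p.1‖ := by rw [← q1, norm_neg, norm_pow]
  have r1 : ‖θ‖ < 1 := by
    rw [← n1] at hx1
    exact (pow_lt_one_iff_of_nonneg (norm_nonneg _) (by norm_num)).1 hx1
  refine ⟨r1, ?_⟩
  set χ := chj b c θ p
  have hd : ‖χ ^ 2 - b‖ < 95/100 := by rw [ec, add_sub_cancel_right]; exact h95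
  obtain ⟨d1, d2⟩ := k.dom ‖θ‖ (norm_pos_iff.2 t0) χ hd
  rw [ed, Par]
  set κ := K ‖θ‖ χ
  obtain ⟨u1, u2⟩ := uu_bd (h := κ ^ 2 - b') (d1.le.trans (by norm_num))
  set u := uu (κ ^ 2 - b')
  have hκ : ‖κ‖ ^ 2 ≤ 2 ^ 2 := by
    have := norm_add_le (κ ^ 2 - b') b'
    rw [sub_add_cancel, norm_pow] at this
    linarith
  have hκ2 : ‖κ‖ ≤ 2 := by
    nlinarith [norm_nonneg κ]
  have w14 : ‖θ‖ ^ 14 ≤ ‖θ‖ ^ 12 := pow_le_pow_of_le_one (norm_nonneg _) r1.le (by norm_num)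
  have w15 : ‖θ‖ ^ 15 ≤ ‖θ‖ ^ 12 := pow_le_pow_of_le_one (norm_nonneg _) r1.le (by norm_num)
  rw [← n1]
  refine CC.norm_le ?_ ?_ ?_
  · simp only [norm_neg, norm_pow]
    nlinarith [pow_nonneg (norm_nonneg θ) 12]
  · simp only [norm_neg, norm_pow, norm_mul]
    calc ‖θ‖ ^ 14 * ‖u‖ ^ 2 ≤ ‖θ‖ ^ 12 * 2 ^ 2 := by gcongr
      _ ≤ _ := by nlinarith [pow_nonneg (norm_nonneg θ) 12]
  · simp only [norm_neg, norm_pow, norm_mul]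
    calc ‖c'‖ * ‖θ‖ ^ 15 * (‖κ‖ * ‖u‖ ^ 3) ≤ 1 * ‖θ‖ ^ 12 * (2 * 2 ^ 3) := by gcongr
      _ ≤ _ := by nlinarith [pow_nonneg (norm_nonneg θ) 12]

theorem hh_cont {b c : ℂ} (hc : c ≠ 0) {p : CC} (hy : p.2.1 ≠ 0) : ContinuousAt (hh b c) p := by
  unfold hh
  refine ContinuousAt.sub (ContinuousAt.div (by fun_prop) (by fun_prop) ?_) continuousAt_const
  exact mul_ne_zero (pow_ne_zero _ hc) (pow_ne_zero _ hy)

theorem uu_cont {h : ℂ} (hl : ‖h‖ < 1) : ContinuousAt uu h := by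
  have h1 : 0 < (1 - h ^ 2).re := by
    have h2 : ‖h ^ 2‖ < 1 := by rw [norm_pow]; exact pow_lt_one₀ (norm_nonneg _) hl (by norm_num)
    have := Complex.re_le_norm (h ^ 2)
    rw [Complex.sub_re, Complex.one_re]; linarith
  unfold uu
  have : ContinuousAt (fun h : ℂ => 1 - h ^ 2) h := by fun_prop
  exact (((this.clog (re_slit h1)).neg).div_const 12).cexp

set_option maxHeartbeats 1000000 in
theorem Disc_lip {b c b' c' : ℂ} {K L : ℝ → ℂ → ℂ} (hc1 : 1/2 ≤ ‖c‖) (hc2 : ‖c‖ ≤ 1)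
    (hc1' : 1/2 ≤ ‖c'‖) (hc2' : ‖c'‖ ≤ 1) (k : KP b b' K L)
    (hb : ‖b‖ ≤ 1/3) (hb' : ‖b'‖ ≤ 1/3) : ∃ M : ℝ, 0 < M ∧
    ∀ p0 : CC, DEq b c p0 → ‖hh b c p0‖ < 95/100 → ‖p0.1‖ < 1 →
    ∃ s ∈ 𝓝 p0, ∀ p ∈ s, ∀ p' ∈ s, DEq b c p → DEq b c p' →
    ‖DiscM b c b' c' K p - DiscM b c b' c' K p'‖ ≤ M * ‖p - p'‖ := by
  obtain ⟨C, hC, est⟩ := k.est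
  have hc : c ≠ 0 := norm_pos_iff.1 (by linarith)
  refine ⟨10 ^ 5 * ((1 + C) * 10 ^ 5 + C * 10 ^ 7), by positivity, ?_⟩
  intro p0 h h95 hx1
  have h0 := om_ne h
  have e := csq_sq h0
  have hθ1 := (Disc_norm (c' := c') hc k hb' hc2' h h95 hx1).1
  set θ0 := csq (om b c p0) with hθ
  have t0 : θ0 ≠ 0 := csq_ne _
  have ec := chj_sq hc h.x0 h.y0 e
  set χ0 := chj b c θ0 p0 with hχ0
  have hd : ‖χ0 ^ 2 - b‖ < 95/100 := by rw [ec, add_sub_cancel_right]; exact h95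
  have r0 : 0 < ‖θ0‖ := norm_pos_iff.2 t0
  obtain ⟨d1, d2⟩ := k.dom ‖θ0‖ r0 χ0 hd
  obtain ⟨s1, hs1, H1⟩ := Par_est hb hc1 hc2 r0 hθ1 (hd.le.trans (by norm_num))
  obtain ⟨s2, hs2, H2⟩ := est ‖θ0‖ r0 hθ1 χ0 (hd.le.trans (by norm_num))
  obtain ⟨s3, hs3, H3⟩ := Par_est hb' hc1' hc2' r0 hθ1 (d1.le.trans (by norm_num))
  set κ0 := K ‖θ0‖ χ0 with hκ0
  have hPP := PP_nonneg b χ0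
  have hPP' := PP_nonneg b' κ0
  -- local branch
  let T : CC → ℂ := fun p => θ0 * csq (om b c p / om b c p0)
  let X : CC → ℂ := fun p => chj b c (T p) p
  have T0 : T p0 = θ0 := by simp only [T]; rw [div_self h0, csq_one, mul_one]
  have X0 : X p0 = χ0 := by simp only [X]; rw [T0]
  have chh := hh_cont (b := b) hc h.y0
  have cuu : ContinuousAt (fun p => uu (hh b c p)) p0 :=
    ContinuousAt.comp (f := hh b c) (g := uu) (uu_cont h.hlt) chh
  have com : ContinuousAt (om b c) p0 := by
    unfold om
    refine ContinuousAt.div (ContinuousAt.div (by fun_prop) (by fun_prop) h.x0) (cuu.pow 2) ?_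
    exact pow_ne_zero _ (uu_ne _)
  have cT : ContinuousAt T p0 := by
    refine continuousAt_const.mul ?_
    have : ContinuousAt csq (om b c p0 / om b c p0) := by
      rw [div_self h0]
      exact (csq_LL (by simp)).ca
    exact ContinuousAt.comp (f := fun p => om b c p / om b c p0) (g := csq) this (com.div_const _)
  have cX : ContinuousAt X p0 := by
    show ContinuousAt (fun p => (p.2.2 / p.1) / (c * T p ^ 3 * uu (hh b c p) ^ 3)) p0
    refine ContinuousAt.div (ContinuousAt.div (by fun_prop) (by fun_prop) h.x0)
      ((continuousAt_const.mul (cT.pow 3)).mul (cuu.pow 3)) ?_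
    refine mul_ne_zero (mul_ne_zero hc (pow_ne_zero _ ?_)) (pow_ne_zero _ (uu_ne _))
    rw [T0]; exact t0
  have cK : ContinuousAt (fun q : ℝ × ℂ => K q.1 q.2) (‖θ0‖, χ0) := by
    have hm := mem_of_mem_nhds hs2
    rw [ContinuousAt, tendsto_iff_norm_sub_tendsto_zero]
    have hA : 0 < PP b' κ0 + ‖θ0‖ := by positivity
    refine squeeze_zero' (Eventually.of_forall fun _ => norm_nonneg _)
      (g := fun q : ℝ × ℂ => (C * ((PP b χ0 + ‖θ0‖) * ‖q.2 - χ0‖ + |q.1 - ‖θ0‖|)) / (PP b' κ0 + ‖θ0‖)) ?_ ?_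
    · filter_upwards [hs2] with q hq
      rw [le_div_iff₀ hA, mul_comm]
      exact H2 q hq _ hm
    · have : ContinuousAt (fun q : ℝ × ℂ => (C * ((PP b χ0 + ‖θ0‖) * ‖q.2 - χ0‖ + |q.1 - ‖θ0‖|)) / (PP b' κ0 + ‖θ0‖)) (‖θ0‖, χ0) := by
        fun_prop
      have h2 := this.tendsto
      simpa using h2
  have cTX : Tendsto (fun p => (T p, X p)) (𝓝 p0) (𝓝 (θ0, χ0)) := by
    have := (cT.prodMk cX).tendsto
    rwa [T0, X0] at this
  have cNX : Tendsto (fun p => (‖T p‖, X p)) (𝓝 p0) (𝓝 (‖θ0‖, χ0)) := by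
    have := (cT.norm.prodMk cX).tendsto
    rwa [T0, X0] at this
  have cTK : Tendsto (fun p => (T p, K ‖T p‖ (X p))) (𝓝 p0) (𝓝 (θ0, κ0)) := by
    refine Tendsto.prodMk_nhds ?_ ?_
    · have := cT.tendsto
      rwa [T0] at this
    · exact cK.tendsto.comp cNX
  refine ⟨_, inter_mem (cTX hs1) (inter_mem (cNX hs2) (cTK hs3)), ?_⟩
  rintro p ⟨k1, k2, k3⟩ p' ⟨k1', k2', k3'⟩ hp hp'
  have hT : ∀ q, DEq b c q → T q ^ 2 = om b c q := by
    intro q hq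
    simp only [T]
    rw [mul_pow, e, csq_sq (div_ne_zero (om_ne hq) h0), mul_div_cancel₀ _ h0]
  obtain ⟨-, l1, l2⟩ := H1 _ k1 _ k1'
  have m := H2 _ k2 _ k2'
  obtain ⟨u, -, -⟩ := H3 _ k3 _ k3'
  simp only at l1 l2 m u
  rw [Par_of_sq hc hp (hT p hp), Par_of_sq hc hp' (hT p' hp')] at l1 l2
  rw [← Disc_eq k.odd hp (hT p hp), ← Disc_eq k.odd hp' (hT p' hp')] at u
  have hn : |‖T p‖ - ‖T p'‖| ≤ ‖T p - T p'‖ := abs_norm_sub_norm_le _ _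
  set N := ‖p - p'‖
  set D := ‖T p - T p'‖
  set E := ‖X p - X p'‖
  set F := ‖K ‖T p‖ (X p) - K ‖T p'‖ (X p')‖
  have D0 : 0 ≤ D := norm_nonneg _
  have m2 : ‖θ0‖ ^ 14 * ((PP b' κ0 + ‖θ0‖) * F) ≤ C * (‖θ0‖ ^ 14 * ((PP b χ0 + ‖θ0‖) * E)) + C * (‖θ0‖ ^ 11 * D) := by
    have w : ‖θ0‖ ^ 14 ≤ ‖θ0‖ ^ 11 := pow_le_pow_of_le_one (norm_nonneg _) hθ1.le (by norm_num)
    calc ‖θ0‖ ^ 14 * ((PP b' κ0 + ‖θ0‖) * F) ≤ ‖θ0‖ ^ 14 * (C * ((PP b χ0 + ‖θ0‖) * E + D)) := by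
          refine mul_le_mul_of_nonneg_left ?_ (by positivity)
          exact m.trans (mul_le_mul_of_nonneg_left (by linarith) hC.le)
      _ = C * (‖θ0‖ ^ 14 * ((PP b χ0 + ‖θ0‖) * E)) + C * (‖θ0‖ ^ 14 * D) := by ring
      _ ≤ _ := by gcongr
  refine u.trans ?_
  have v1 : C * (‖θ0‖ ^ 14 * ((PP b χ0 + ‖θ0‖) * E)) ≤ C * (10 ^ 7 * N) := by gcongr
  have v2 : (1 + C) * (‖θ0‖ ^ 11 * D) ≤ (1 + C) * (10 ^ 5 * N) := by gcongr
  rw [mul_assoc]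
  gcongr
  linarith

def Wf (s t : ℝ → ℝ) (p : CC) : ℂ := (s (afun p) : ℂ) * (p.2.2 ^ 2 * p.1) + (t (afun p) : ℂ) * p.2.1 ^ 3

structure Side (A : Set CC) (b c : ℝ) (s t : ℝ → ℝ) : Prop where
  be : ∃ β : CC → ℝ, (∀ p, 1/2 ≤ β p ∧ β p ≤ 1) ∧ A = Sset β
  inx : ∀ p : CC, ‖p.2.2‖ < ‖p.1‖ → (p ∈ A ↔ (p.2.1 ^ 3) ^ 2 - Wf s t p ^ 2 + mfun p ^ 7 = 0)
  inz : ∀ p : CC, ‖p.1‖ ≤ ‖p.2.2‖ → (p ∈ A ↔ p ∈ Sset afun)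
  sb : ∀ a, 1/2 ≤ a → a ≤ 1 → 1 ≤ s a ∧ s a ≤ 4/3
  tb : ∀ a, 1/2 ≤ a → a ≤ 1 → -(1/3) ≤ t a ∧ t a ≤ 0
  sl : ∀ a a', 1/2 ≤ a → a ≤ 1 → 1/2 ≤ a' → a' ≤ 1 → |s a - s a'| ≤ 2 * |a - a'|
  tl : ∀ a a', 1/2 ≤ a → a ≤ 1 → 1/2 ≤ a' → a' ≤ 1 → |t a - t a'| ≤ 2 * |a - a'|
  s1 : s 1 = 1
  t1 : t 1 = 0
  sh : s (1/2) * c ^ 2 = 1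
  th : t (1/2) = -b
  b0 : 0 ≤ b
  b1 : b ≤ 1/3
  c0 : 1/2 ≤ c
  c1 : c ≤ 1

theorem keyW (Y Z m : ℂ) (a : ℝ) (h : 1/2 ≤ a) : (Y - Z) * ((a:ℂ) * Y + Z) + ((1 + (a:ℂ))/2) ^ 2 * m = 0 ↔
    Y ^ 2 - (((2 / (1 + a) : ℝ) : ℂ) * Z + ((-((1 - a) / (1 + a)) : ℝ) : ℂ) * Y) ^ 2 + m = 0 := by
  have h1 : (1 + (a:ℂ)) ≠ 0 := by
    have : (1 + a) ≠ 0 := by linarith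
    exact_mod_cast this
  have e : (Y - Z) * ((a:ℂ) * Y + Z) + ((1 + (a:ℂ))/2) ^ 2 * m = ((1 + (a:ℂ))/2) ^ 2 *
    (Y ^ 2 - (((2 / (1 + a) : ℝ) : ℂ) * Z + ((-((1 - a) / (1 + a)) : ℝ) : ℂ) * Y) ^ 2 + m) := by
    push_cast
    field_simp
    ring
  rw [e, mul_eq_zero, or_iff_right]
  exact pow_ne_zero _ (div_ne_zero h1 two_ne_zero)

theorem side_one : Side (Sset az) 0 1 (fun _ => 1) (fun _ => 0) where
  be := ⟨az, az_mem, rfl⟩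
  inx := by
    intro p h
    have : az p = 1 := if_neg (not_le.2 h)
    show _ = _ ↔ _
    rw [this, Wf]
    push_cast
    ring_nf
  inz := by
    intro p h
    have : az p = afun p := if_pos h
    show _ = _ ↔ _ = _
    rw [this]
  sb := by intros; norm_num
  tb := by intros; norm_num
  sl := by intros; simp
  tl := by intros; simp
  s1 := rfl
  t1 := rfl
  sh := by norm_num
  th := by norm_num
  b0 := le_rfl
  b1 := by norm_num
  c0 := by norm_num
  c1 := le_rfl

theorem side_two : Side (Sset afun) (1/3) (√3 / 2) (fun a => 2 / (1 + a)) (fun a => -((1 - a) / (1 + a))) where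
  be := ⟨afun, afun_mem, rfl⟩
  inx := by
    intro p _
    exact keyW _ _ _ _ (afun_mem p).1
  inz := fun _ _ => Iff.rfl
  sb := by
    intro a h1 h2
    constructor
    · rw [le_div_iff₀ (by linarith)]; linarith
    · rw [div_le_iff₀ (by linarith)]; linarith
  tb := by
    intro a h1 h2
    constructor
    · rw [neg_le_neg_iff, div_le_iff₀ (by linarith)]; linarith
    · rw [neg_nonpos]; exact div_nonneg (by linarith) (by linarith)
  sl := by
    intro a a' h1 h2 h3 h4
    have e : 2 / (1 + a) - 2 / (1 + a') = (a' - a) * (2 / ((1 + a) * (1 + a'))) := by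
      have : (1 + a) ≠ 0 := by linarith
      have : (1 + a') ≠ 0 := by linarith
      field_simp; ring
    rw [e, abs_mul, abs_sub_comm, abs_of_nonneg (a := 2 / ((1 + a) * (1 + a'))) (by positivity)]
    have : 2 / ((1 + a) * (1 + a')) ≤ 2 := by
      rw [div_le_iff₀ (by positivity)]; nlinarith
    nlinarith [abs_nonneg (a - a')]
  tl := by
    intro a a' h1 h2 h3 h4
    have e : -((1 - a) / (1 + a)) - -((1 - a') / (1 + a')) = (a - a') * (2 / ((1 + a) * (1 + a'))) := by
      have : (1 + a) ≠ 0 := by linarith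
      have : (1 + a') ≠ 0 := by linarith
      field_simp; ring
    rw [e, abs_mul, abs_of_nonneg (a := 2 / ((1 + a) * (1 + a'))) (by positivity)]
    have : 2 / ((1 + a) * (1 + a')) ≤ 2 := by
      rw [div_le_iff₀ (by positivity)]; nlinarith
    nlinarith [abs_nonneg (a - a')]
  s1 := by norm_num
  t1 := by norm_num
  sh := by
    rw [div_pow, Real.sq_sqrt (by norm_num)]; norm_num
  th := by norm_num
  b0 := by norm_num
  b1 := by norm_num
  c0 := by
    have : (1:ℝ) ≤ √3 := by rw [Real.one_le_sqrt]; norm_num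
    linarith
  c1 := by
    have : √3 ≤ 2 := by rw [Real.sqrt_le_left (by norm_num)]; norm_num
    linarith

def eps2 : ℝ := 1 / (12 ^ 7 * 10 ^ 22)
theorem eps2_pos : 0 < eps2 := by unfold eps2; positivity
theorem eps2_lt : eps2 < eps0 := by unfold eps2 eps0; norm_num
theorem eps2_one : eps2 < 1 := by unfold eps2; norm_num

section
variable {A : Set CC} {b c : ℝ} {s t : ℝ → ℝ} {p : CC}

theorem Side.loc (S : Side A b c s t) (hp : p ∈ A) (hn : ‖p‖ < eps2) (h : ‖p.2.2‖ ≤ ‖p.1‖) :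
    ‖p.2.1‖ ≤ 2 * ‖p.1‖ ∧ (8 * ‖p.2.1‖ ≤ ‖p.1‖ → 16 * ‖p.2.2‖ ≤ ‖p.1‖) := by
  obtain ⟨β, hβ, rfl⟩ := S.be
  exact locX hβ hp (hn.trans eps2_lt) h

theorem Side.wy0 (S : Side A b c s t) (hp : p ∈ A) (hn : ‖p‖ < eps2) (h : ‖p.2.2‖ < ‖p.1‖)
    (hy : p.2.1 = 0) : Wf s t p ≠ 0 := by
  intro hW
  have e := (S.inx p h).1 hp
  have := (S.loc hp hn h.le).2 (by rw [hy]; simp)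
  have hm : mfun p = p.1 := mfun_x (by rw [hy, norm_zero]; linarith [norm_nonneg p.1])
  rw [hW, hy, hm] at e
  have h0 : p.1 = 0 := by simpa using e
  rw [h0, norm_zero] at h
  linarith [norm_nonneg p.2.2]

theorem Side.small (S : Side A b c s t) (hp : p ∈ A) (hn : ‖p‖ < eps2) (h : ‖p.2.2‖ < ‖p.1‖)
    (hW : ‖Wf s t p‖ ≤ 97/100 * ‖p.2.1 ^ 3‖) : p.2.1 ≠ 0 ∧ 1000 * ‖p.2.1‖ < ‖p.1‖ := by
  have e := (S.inx p h).1 hp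
  have hx0 : 0 < ‖p.1‖ := (norm_nonneg _).trans_lt h
  refine ⟨?_, ?_⟩
  · intro hy
    apply S.wy0 hp hn h hy
    rw [hy] at hW
    simpa using hW
  by_contra hc
  push Not at hc
  have hl := (S.loc hp hn h.le).1
  have hpx : ‖p‖ ≤ 2 * ‖p.1‖ := CC.norm_le (by linarith) hl (by linarith)
  have hm := mfun_bound p
  have e1 : ‖p.2.1 ^ 3‖ ^ 2 ≤ ‖Wf s t p‖ ^ 2 + ‖mfun p‖ ^ 7 := by
    have : (p.2.1 ^ 3) ^ 2 = Wf s t p ^ 2 - mfun p ^ 7 := by linear_combination e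
    rw [← norm_pow, this, ← norm_pow (Wf s t p), ← norm_pow]
    exact norm_sub_le _ _
  have e2 : ‖Wf s t p‖ ^ 2 ≤ (97/100 * ‖p.2.1 ^ 3‖) ^ 2 := by gcongr
  have e3 : ‖mfun p‖ ^ 7 ≤ 12 ^ 7 * eps2 * (2 * ‖p.1‖) ^ 6 := by
    calc ‖mfun p‖ ^ 7 ≤ (12 * ‖p‖) ^ 7 := by gcongr
      _ = 12 ^ 7 * ‖p‖ * ‖p‖ ^ 6 := by ring
      _ ≤ _ := by
        have := eps2_pos
        gcongr
  have e4 : ‖p.1‖ ^ 6 ≤ (1000 * ‖p.2.1‖) ^ 6 := by gcongr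
  rw [norm_pow] at e1 e2
  have e5 : (12:ℝ) ^ 7 * eps2 = 1 / 10 ^ 22 := by unfold eps2; field_simp
  rw [e5] at e3
  have hx6 : 0 < ‖p.1‖ ^ 6 := by positivity
  have : (1000 * ‖p.2.1‖) ^ 6 = 10 ^ 18 * (‖p.2.1‖ ^ 3) ^ 2 := by ring
  rw [this] at e4
  have e6 : (2 * ‖p.1‖) ^ 6 = 64 * ‖p.1‖ ^ 6 := by ring
  rw [e6] at e3
  nlinarith

theorem Side.cc (S : Side A b c s t) : (c:ℂ) ≠ 0 := by
  have := S.c0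
  have : c ≠ 0 := by linarith
  exact_mod_cast this

theorem Side.cn (S : Side A b c s t) : 1/2 ≤ ‖(c:ℂ)‖ ∧ ‖(c:ℂ)‖ ≤ 1 := by
  have := S.c0
  rw [Complex.norm_real, Real.norm_of_nonneg (by linarith)]
  exact ⟨S.c0, S.c1⟩

theorem Side.bn (S : Side A b c s t) : ‖(b:ℂ)‖ ≤ 1/3 := by
  rw [Complex.norm_real, Real.norm_of_nonneg S.b0]
  exact S.b1

/-- in the `a = 1/2` zone `W = Y h`. -/
theorem Side.Wh (S : Side A b c s t) (hy : p.2.1 ≠ 0) (ha : afun p = 1/2) :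
    Wf s t p = p.2.1 ^ 3 * hh b c p := by
  have hc := S.cc
  have e1 : (s (1/2) : ℂ) * (c:ℂ) ^ 2 = 1 := by exact_mod_cast S.sh
  have e2 : (t (1/2) : ℂ) = -b := by exact_mod_cast S.th
  rw [Wf, hh, ha, e2]
  field_simp
  linear_combination (p.2.2 ^ 2 * p.1) * e1

theorem half_of (h1 : 500 * ‖p.2.1‖ ≤ ‖p.1‖) : afun p = 1/2 :=
  afun_half (h1.trans (le_max_left _ _))

theorem Side.disc (S : Side A b c s t) (hp : p ∈ A) (hn : ‖p‖ < eps2) (h : ‖p.2.2‖ < ‖p.1‖)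
    (hW : ‖Wf s t p‖ ≤ 97/100 * ‖p.2.1 ^ 3‖) : DEq b c p ∧ ‖Wf s t p‖ = ‖p.2.1 ^ 3‖ * ‖hh b c p‖ ∧
      afun p = 1/2 := by
  obtain ⟨hy, h1⟩ := S.small hp hn h hW
  have ha : afun p = 1/2 := half_of (by linarith [norm_nonneg p.2.1])
  have e := S.Wh hy ha
  have hW2 : ‖Wf s t p‖ = ‖p.2.1 ^ 3‖ * ‖hh b c p‖ := by rw [e, norm_mul]
  have hY : 0 < ‖p.2.1 ^ 3‖ := norm_pos_iff.2 (pow_ne_zero _ hy)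
  have h16 := (S.loc hp hn h.le).2 (by linarith [norm_nonneg p.2.1])
  have hm : mfun p = p.1 := mfun_x (by linarith [norm_nonneg p.2.1, norm_nonneg p.1])
  refine ⟨⟨?_, hy, ?_, ?_⟩, hW2, ha⟩
  · rw [← norm_pos_iff]; linarith [norm_nonneg p.2.2]
  · rw [hW2] at hW
    nlinarith
  · have := (S.inx p h).1 hp
    rw [e, hm] at this
    linear_combination this

theorem Side.back (S : Side A b c s t) (hD : DEq b c p) (h95 : ‖hh b c p‖ < 95/100) (hx : ‖p.1‖ < eps2) :
    p ∈ A ∧ ‖p.2.2‖ < ‖p.1‖ ∧ ‖Wf s t p‖ < 95/100 * ‖p.2.1 ^ 3‖ := by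
  have hx0 : 0 < ‖p.1‖ := norm_pos_iff.2 hD.x0
  have hy0 : 0 < ‖p.2.1‖ := norm_pos_iff.2 hD.y0
  have hc := S.cc
  have e1 : ‖p.2.1‖ ^ 6 * (1/20) ≤ eps2 * ‖p.1‖ ^ 6 := by
    have h1 : ‖p.2.1 ^ 6 * (1 - hh b c p ^ 2)‖ = ‖p.1‖ ^ 7 := by rw [hD.eqn, norm_neg, norm_pow]
    rw [norm_mul, norm_pow] at h1
    have h2 : 1/20 ≤ ‖1 - hh b c p ^ 2‖ := by
      have := norm_sub_norm_le 1 (hh b c p ^ 2)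
      rw [norm_one, norm_pow] at this
      nlinarith [norm_nonneg (hh b c p)]
    calc ‖p.2.1‖ ^ 6 * (1/20) ≤ ‖p.2.1‖ ^ 6 * ‖1 - hh b c p ^ 2‖ := by gcongr
      _ = ‖p.1‖ * ‖p.1‖ ^ 6 := by rw [h1]; ring
      _ ≤ _ := by gcongr
  have h1000 : 1000 * ‖p.2.1‖ < ‖p.1‖ := by
    by_contra hcn
    push Not at hcn
    have e4 : ‖p.1‖ ^ 6 ≤ (1000 * ‖p.2.1‖) ^ 6 := by gcongr
    have e5 : eps2 ≤ 1 / 10 ^ 22 := by unfold eps2; norm_num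
    have : (1000 * ‖p.2.1‖) ^ 6 = 10 ^ 18 * (‖p.2.1‖ ^ 6) := by ring
    rw [this] at e4
    have hx6 : 0 < ‖p.1‖ ^ 6 := by positivity
    nlinarith
  have ha : afun p = 1/2 := half_of (by linarith)
  have hz : 16 * ‖p.2.2‖ ≤ ‖p.1‖ := by
    have e2 : p.2.2 ^ 2 * p.1 = (hh b c p + b) * ((c:ℂ) ^ 2 * p.2.1 ^ 3) := by
      have := hD.y0
      rw [hh, sub_add_cancel]; field_simp
    have e3 : ‖p.2.2‖ ^ 2 * ‖p.1‖ ≤ 2 * (1 ^ 2 * ‖p.2.1‖ ^ 3) := by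
      rw [← norm_pow, ← norm_mul, e2, norm_mul, norm_mul, norm_pow, norm_pow]
      have := S.bn
      have := S.cn.2
      gcongr
      exact (norm_add_le _ _).trans (by linarith)
    have e4 : ‖p.2.1‖ ^ 3 ≤ (‖p.1‖ / 1000) ^ 3 := by gcongr; linarith
    have e5 : ‖p.2.2‖ ^ 2 * ‖p.1‖ ≤ (‖p.1‖ / 16) ^ 2 * ‖p.1‖ := by
      have : 0 < ‖p.1‖ ^ 3 := by positivity
      nlinarith
    have e6 := le_of_mul_le_mul_right e5 hx0
    have := abs_le_of_sq_le_sq e6 (by positivity)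
    rw [abs_norm] at this
    linarith
  have hlt : ‖p.2.2‖ < ‖p.1‖ := by linarith [norm_nonneg p.2.2]
  have hm : mfun p = p.1 := mfun_x (by linarith)
  have e := S.Wh hD.y0 ha
  refine ⟨?_, hlt, ?_⟩
  · rw [S.inx p hlt, e, hm]
    linear_combination hD.eqn
  · rw [e, norm_mul, mul_comm]
    have hY : 0 < ‖p.2.1 ^ 3‖ := norm_pos_iff.2 (pow_ne_zero _ hD.y0)
    gcongr
end

def Nco (s t t' : ℝ → ℝ) (p : CC) : ℂ :=
  (s (afun p) : ℂ) + ((t (afun p) : ℂ) - (t' (afun p) : ℂ)) * (p.2.1 ^ 3 / (p.2.2 ^ 2 * p.1))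
def Aco (s t s' t' : ℝ → ℝ) (p : CC) : ℂ := Nco s t t' p / (s' (afun p) : ℂ)
def Fx (s t s' t' : ℝ → ℝ) (p : CC) : CC := (p.1, p.2.1, p.2.2 * csq (Aco s t s' t' p))

section
variable {A A' : Set CC} {b c b' c' : ℝ} {s t s' t' : ℝ → ℝ} {p : CC}

theorem Side.s'0 (S : Side A b c s t) (p : CC) : (s (afun p) : ℂ) ≠ 0 := by
  have := (S.sb _ (afun_mem p).1 (afun_mem p).2).1
  have h : s (afun p) ≠ 0 := by linarith
  exact_mod_cast h

theorem Side.out (S : Side A b c s t) (S' : Side A' b' c' s' t') (hp : p ∈ A) (hn : ‖p‖ < eps2)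
    (h : ‖p.2.2‖ < ‖p.1‖) (hW : 9/10 * ‖p.2.1 ^ 3‖ ≤ ‖Wf s t p‖) :
    p.2.2 ≠ 0 ∧ ‖p.2.1‖ ^ 3 ≤ 12/5 * (‖p.2.2‖ ^ 2 * ‖p.1‖) ∧ 1/4 ≤ (Aco s t s' t' p).re ∧
    ‖Aco s t s' t' p‖ ≤ 9/4 := by
  have hx0 : 0 < ‖p.1‖ := (norm_nonneg _).trans_lt h
  obtain ⟨a1, a2⟩ := afun_mem p
  obtain ⟨s1, s2⟩ := S.sb _ a1 a2
  obtain ⟨t1, t2⟩ := S.tb _ a1 a2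
  obtain ⟨u1, u2⟩ := S'.sb _ a1 a2
  obtain ⟨v1, v2⟩ := S'.tb _ a1 a2
  have wy := S.wy0 hp hn h
  set a := afun p with ha
  have e1 : ‖Wf s t p‖ ≤ s a * (‖p.2.2‖ ^ 2 * ‖p.1‖) + 1/3 * ‖p.2.1‖ ^ 3 := by
    refine (norm_add_le _ _).trans ?_
    rw [norm_mul, norm_mul (_ : ℂ) (p.2.1 ^ 3), norm_mul, norm_pow, norm_pow, Complex.norm_real, Complex.norm_real,
      Real.norm_of_nonneg (by linarith), Real.norm_of_nonpos (by linarith), ← ha]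
    gcongr
    linarith
  rw [norm_pow] at hW
  have e2 : 17/30 * ‖p.2.1‖ ^ 3 ≤ s a * (‖p.2.2‖ ^ 2 * ‖p.1‖) := by linarith
  have hz : p.2.2 ≠ 0 := by
    intro hz
    rw [hz, norm_zero] at e2
    have hy3 : ‖p.2.1‖ ^ 3 = 0 := le_antisymm (by nlinarith) (by positivity)
    have hy : p.2.1 = 0 := by simpa using hy3
    apply wy hy
    simp [Wf, hy, hz]
  have hz0 : 0 < ‖p.2.2‖ := norm_pos_iff.2 hz
  have hZ : 0 < ‖p.2.2‖ ^ 2 * ‖p.1‖ := by positivity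
  refine ⟨hz, by nlinarith, ?_⟩
  set w : ℂ := ((t a : ℂ) - (t' a : ℂ)) * (p.2.1 ^ 3 / (p.2.2 ^ 2 * p.1)) with hw
  have hwn : ‖w‖ ≤ 3/5 * s a := by
    rw [hw, norm_mul, norm_div, norm_mul, norm_pow, norm_pow, ← Complex.ofReal_sub, Complex.norm_real]
    have h1 : ‖t a - t' a‖ ≤ 1/3 := by rw [Real.norm_eq_abs, abs_le]; constructor <;> linarith
    have h2 : ‖p.2.1‖ ^ 3 / (‖p.2.2‖ ^ 2 * ‖p.1‖) ≤ 30/17 * s a := by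
      rw [div_le_iff₀ hZ]; linarith
    calc _ ≤ 1/3 * (30/17 * s a) := by gcongr
      _ ≤ _ := by linarith
  have eA : Aco s t s' t' p = ((s a : ℂ) + w) / (s' a : ℂ) := rfl
  have hre := Complex.abs_re_le_norm w
  rw [abs_le] at hre
  rw [eA]
  constructor
  · rw [Complex.div_ofReal_re, le_div_iff₀ (by linarith), Complex.add_re, Complex.ofReal_re]
    linarith
  · rw [norm_div, Complex.norm_real, Real.norm_of_nonneg (by linarith : 0 ≤ s' a), div_le_iff₀ (by linarith)]
    have := norm_add_le (s a : ℂ) w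
    rw [Complex.norm_real, Real.norm_of_nonneg (by linarith)] at this
    linarith

theorem csq_norm {B : ℂ} (h : 1/4 ≤ B.re) (h2 : ‖B‖ ≤ 9/4) : 1/2 ≤ ‖csq B‖ ∧ ‖csq B‖ ≤ 2 := by
  have hB : B ≠ 0 := re_ne (by linarith)
  have e : ‖csq B‖ ^ 2 = ‖B‖ := by rw [← norm_pow, csq_sq hB]
  have := (Complex.re_le_norm B)
  constructor <;> nlinarith [norm_nonneg (csq B)]

theorem Side.aone (S : Side A b c s t) (S' : Side A' b' c' s' t') (ha : afun p = 1) : Fx s t s' t' p = p := by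
  rw [Fx, Aco, Nco, ha, S.s1, S.t1, S'.s1, S'.t1]
  simp [csq_one]

theorem Side.fx (S : Side A b c s t) (S' : Side A' b' c' s' t') (hp : p ∈ A) (hn : ‖p‖ < eps2)
    (h : ‖p.2.2‖ < ‖p.1‖) (hW : 9/10 * ‖p.2.1 ^ 3‖ ≤ ‖Wf s t p‖) :
    Fx s t s' t' p ∈ A' ∧ ‖(Fx s t s' t' p).2.2‖ < ‖p.1‖ ∧ Wf s' t' (Fx s t s' t' p) = Wf s t p ∧
    Fx s' t' s t (Fx s t s' t' p) = p ∧ ‖Fx s t s' t' p‖ ≤ 2 * ‖p‖ := by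
  obtain ⟨hz, hy3, hA1, hA2⟩ := S.out S' hp hn h hW
  have hx0 : 0 < ‖p.1‖ := (norm_nonneg _).trans_lt h
  have hx : p.1 ≠ 0 := norm_pos_iff.1 hx0
  obtain ⟨g1, g2⟩ := csq_norm hA1 hA2
  set B := Aco s t s' t' p with hB
  have hB0 : B ≠ 0 := re_ne (by linarith)
  set q := Fx s t s' t' p with hq
  have q1 : q.1 = p.1 := rfl
  have q2 : q.2.1 = p.2.1 := rfl
  have q3 : q.2.2 = p.2.2 * csq B := rfl
  have nq : ‖q‖ ≤ 2 * ‖p‖ := by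
    obtain ⟨n1, n2, n3⟩ := CC.le p
    refine CC.norm_le ?_ ?_ ?_
    · rw [q1]; linarith [norm_nonneg p]
    · rw [q2]; linarith [norm_nonneg p]
    · rw [q3, norm_mul]; nlinarith [norm_nonneg p.2.2]
  have key : ‖q.2.2‖ < ‖p.1‖ ∧ mfun q = mfun p := by
    by_cases ha : afun p = 1
    · have : q = p := S.aone S' ha
      rw [this]; exact ⟨h, rfl⟩
    · have h8 : 8 * ‖p.2.1‖ ≤ ‖p.1‖ := by
        by_contra hc
        push Not at hc
        apply ha
        refine afun_one ?_ (max_le hc.le (by linarith))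
        intro hy; rw [hy, norm_zero] at hc; linarith
      have h16 := (S.loc hp hn h.le).2 h8
      have hq3 : ‖q.2.2‖ ≤ ‖p.1‖ / 8 := by rw [q3, norm_mul]; nlinarith [norm_nonneg p.2.2]
      refine ⟨by linarith, ?_⟩
      rw [mfun_x (p := p) (by linarith), mfun_x (p := q) (by rw [q1, q2]; linarith), q1]
  obtain ⟨k1, k2⟩ := key
  have ka : afun q = afun p := by
    refine afun_congr q2 ?_
    rw [q1, max_eq_left k1.le, max_eq_left h.le]
  have hs' := S'.s'0 p
  have hs := S.s'0 p
  have eB : B * (s' (afun p) : ℂ) = Nco s t t' p := div_mul_cancel₀ _ hs'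
  have eN : Nco s t t' p * (p.2.2 ^ 2 * p.1) = (s (afun p) : ℂ) * (p.2.2 ^ 2 * p.1) +
      ((t (afun p) : ℂ) - (t' (afun p) : ℂ)) * p.2.1 ^ 3 := by
    rw [Nco]; field_simp
  have eZ : q.2.2 ^ 2 * q.1 = B * (p.2.2 ^ 2 * p.1) := by
    rw [q3, q1, mul_pow, csq_sq hB0]; ring
  have hWW : Wf s' t' q = Wf s t p := by
    rw [Wf, Wf, ka, eZ, q2]
    linear_combination (p.2.2 ^ 2 * p.1) * eB + eN
  refine ⟨?_, k1, hWW, ?_, nq⟩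
  · rw [S'.inx q (by rw [q1]; exact k1), hWW, k2, q2]
    exact (S.inx p h).1 hp
  · have eI : Aco s' t' s t q = B⁻¹ := by
      rw [Aco, Nco, ka, eZ, q2, div_eq_iff hs]
      rw [inv_mul_eq_div, eq_div_iff hB0]
      have : p.2.1 ^ 3 / (B * (p.2.2 ^ 2 * p.1)) * B = p.2.1 ^ 3 / (p.2.2 ^ 2 * p.1) := by
        field_simp
      rw [add_mul, mul_assoc, this]
      have e : Nco s t t' p = (s (afun p) : ℂ) + ((t (afun p) : ℂ) - (t' (afun p) : ℂ)) * (p.2.1 ^ 3 / (p.2.2 ^ 2 * p.1)) := rfl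
      linear_combination eB + e
    rw [Fx, eI, q1, q2, q3, mul_assoc, csq_inv (by linarith), mul_one]

theorem Side.match (S : Side A b c s t) (S' : Side A' b' c' s' t') {K L : ℝ → ℂ → ℂ} (k : KP b b' K L)
    (hp : p ∈ A) (hn : ‖p‖ < eps2)
    (h : ‖p.2.2‖ < ‖p.1‖) (hW : 9/10 * ‖p.2.1 ^ 3‖ ≤ ‖Wf s t p‖) (hW2 : ‖Wf s t p‖ ≤ 97/100 * ‖p.2.1 ^ 3‖) :
    DiscM b c b' c' K p = Fx s t s' t' p := by
  obtain ⟨hD, hWe, ha⟩ := S.disc hp hn h hW2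
  obtain ⟨hz, hy3, hA1, hA2⟩ := S.out S' hp hn h hW
  have hY : 0 < ‖p.2.1 ^ 3‖ := norm_pos_iff.2 (pow_ne_zero _ hD.y0)
  rw [hWe] at hW
  have hx := hD.x0
  have hy := hD.y0
  have h9 : 9/10 ≤ ‖hh b c p‖ := by nlinarith
  have nz : hh b c p + b ≠ 0 := by
    intro h0
    rw [add_eq_zero_iff_eq_neg] at h0
    rw [h0, norm_neg] at h9
    linarith [S.bn]
  have nz' : hh b c p + b' ≠ 0 := by
    intro h0
    rw [add_eq_zero_iff_eq_neg] at h0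
    rw [h0, norm_neg] at h9
    linarith [S'.bn]
  rw [Disc_bd S.cc k S.bn S'.bn hD h9, Fx]
  have hc := S.cc
  have hc' := S'.cc
  have eA : Aco s t s' t' p = (((c' / c) ^ 2 : ℝ) : ℂ) * ((hh b c p + b') / (hh b c p + b)) := by
    have e1 : (s (1/2) : ℂ) * (c:ℂ) ^ 2 = 1 := by exact_mod_cast S.sh
    have e2 : (t (1/2) : ℂ) = -b := by exact_mod_cast S.th
    have e1' : (s' (1/2) : ℂ) * (c':ℂ) ^ 2 = 1 := by exact_mod_cast S'.sh
    have e2' : (t' (1/2) : ℂ) = -b' := by exact_mod_cast S'.th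
    have f1 : (s (1/2) : ℂ) = 1 / (c:ℂ) ^ 2 := by rw [eq_div_iff (pow_ne_zero _ hc), e1]
    have f1' : (s' (1/2) : ℂ) = 1 / (c':ℂ) ^ 2 := by rw [eq_div_iff (pow_ne_zero _ hc'), e1']
    have ev : p.2.1 ^ 3 / (p.2.2 ^ 2 * p.1) = 1 / ((c:ℂ) ^ 2 * (hh b c p + b)) := by
      rw [hh, sub_add_cancel]; field_simp
    rw [Aco, Nco, ha, f1, f1', e2, e2', ev]
    push_cast
    field_simp
    ring
  have hr : 0 < c' / c := div_pos (by linarith [S'.c0]) (by linarith [S.c0])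
  rw [eA, csq_real_mul hr (div_ne_zero nz' nz)]
  refine Prod.ext rfl (Prod.ext rfl ?_)
  show _ = _
  push_cast
  ring
end

theorem quot_lip {u u' v v' e : ℝ} (hv : 1 ≤ v) (hv2 : v ≤ 4/3) (hv' : 1 ≤ v') (hv2' : v' ≤ 4/3)
    (hu' : |u'| ≤ 4/3) (h1 : |u - u'| ≤ 4 * e) (h2 : |v - v'| ≤ 2 * e) : |u / v - u' / v'| ≤ 8 * e := by
  have e1 : u / v - u' / v' = ((u - u') * v' - u' * (v - v')) / (v * v') := by
    have : v ≠ 0 := by linarith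
    have : v' ≠ 0 := by linarith
    field_simp; ring
  have he : 0 ≤ e := by linarith [abs_nonneg (v - v')]
  rw [e1, abs_div, abs_of_nonneg (by positivity : 0 ≤ v * v'), div_le_iff₀ (by positivity)]
  have e2 : |(u - u') * v' - u' * (v - v')| ≤ |u - u'| * v' + |u'| * |v - v'| := by
    refine (abs_sub _ _).trans ?_
    rw [abs_mul, abs_mul, abs_of_nonneg (by linarith : 0 ≤ v')]
  have e3 : |u - u'| * v' ≤ 4 * e * (4/3) := by gcongr
  have e4 : |u'| * |v - v'| ≤ 4/3 * (2 * e) := by gcongr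
  have e5 : 1 ≤ v * v' := one_le_mul_of_one_le_of_one_le hv hv'
  have e6 : 8 * e * 1 ≤ 8 * e * (v * v') := by gcongr
  linarith

theorem ysq {x y z : ℝ} (hx : 0 < x) (hy : 0 ≤ y) (hz : 0 < z) (hzx : z ≤ x) (h : y ^ 3 ≤ 12/5 * (z ^ 2 * x)) :
    y ^ 2 ≤ 2 * (z * x) := by
  by_contra hc
  push Not at hc
  have h1 : (2 * (z * x)) ^ 3 < (y ^ 2) ^ 3 := by gcongr
  have h2 : (y ^ 3) ^ 2 ≤ (12/5 * (z ^ 2 * x)) ^ 2 := by gcongr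
  have h3 : (y ^ 2) ^ 3 = (y ^ 3) ^ 2 := by ring
  have h4 : z ^ 3 * x ^ 2 * z ≤ z ^ 3 * x ^ 2 * x := by gcongr
  have h5 : 0 < z ^ 3 * x ^ 2 * x := by positivity
  nlinarith

theorem core_lip {x y z x' y' z' : ℂ} {α α' β β' e d Z0 X0 : ℝ} (hZ : 0 < Z0) (hZX : Z0 ≤ X0)
    (hz : ‖z‖ ≤ 2 * Z0) (hz' : ‖z'‖ ≤ 2 * Z0) (hx : X0 / 2 ≤ ‖x‖) (hx2 : ‖x‖ ≤ 2 * X0)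
    (hx' : X0 / 2 ≤ ‖x'‖) (hx2' : ‖x'‖ ≤ 2 * X0)
    (hz0 : 0 < ‖z‖) (hz0' : 0 < ‖z'‖) (hzx : ‖z‖ ≤ ‖x‖) (hzx' : ‖z'‖ ≤ ‖x'‖)
    (hy : ‖y‖ ^ 3 ≤ 12/5 * (‖z‖ ^ 2 * ‖x‖)) (hy' : ‖y'‖ ^ 3 ≤ 12/5 * (‖z'‖ ^ 2 * ‖x'‖))
    (dx : ‖x - x'‖ ≤ d) (dy : ‖y - y'‖ ≤ d) (dz : ‖z - z'‖ ≤ d)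
    (hα' : |α'| ≤ 4/3) (hβ' : |β'| ≤ 4/3) (hα : |α - α'| ≤ e) (hβ : |β - β'| ≤ e) :
    ‖((α:ℂ) * z ^ 2 + (β:ℂ) * (y ^ 3 / x)) - ((α':ℂ) * z' ^ 2 + (β':ℂ) * (y' ^ 3 / x'))‖ ≤
      14 * e * Z0 ^ 2 + 100 * Z0 * d := by
  have hX : 0 < X0 := by linarith
  have hxp : 0 < ‖x‖ := by linarith
  have hxp' : 0 < ‖x'‖ := by linarith
  have hd : 0 ≤ d := (norm_nonneg _).trans dx
  have he : 0 ≤ e := (abs_nonneg _).trans hα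
  have x0 : x ≠ 0 := norm_pos_iff.1 hxp
  have x0' : x' ≠ 0 := norm_pos_iff.1 hxp'
  have s1 := ysq hxp (norm_nonneg y) hz0 hzx hy
  have s1' := ysq hxp' (norm_nonneg y') hz0' hzx' hy'
  have w1 : ‖y ^ 3 / x‖ ≤ 10 * Z0 ^ 2 := by
    rw [norm_div, norm_pow, div_le_iff₀ hxp]
    calc _ ≤ 12/5 * (‖z‖ ^ 2 * ‖x‖) := hy
      _ ≤ 12/5 * ((2 * Z0) ^ 2 * ‖x‖) := by gcongr
      _ ≤ _ := by nlinarith [mul_pos (pow_pos hZ 2) hxp]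
  have w1' : ‖y' ^ 3 / x'‖ ≤ 10 * Z0 ^ 2 := by
    rw [norm_div, norm_pow, div_le_iff₀ hxp']
    calc _ ≤ 12/5 * (‖z'‖ ^ 2 * ‖x'‖) := hy'
      _ ≤ 12/5 * ((2 * Z0) ^ 2 * ‖x'‖) := by gcongr
      _ ≤ _ := by nlinarith [mul_pos (pow_pos hZ 2) hxp']
  have q : ‖y‖ ^ 2 ≤ 8 * (Z0 * X0) := by
    calc _ ≤ 2 * (‖z‖ * ‖x‖) := s1
      _ ≤ 2 * ((2 * Z0) * (2 * X0)) := by gcongr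
      _ = _ := by ring
  have q' : ‖y'‖ ^ 2 ≤ 8 * (Z0 * X0) := by
    calc _ ≤ 2 * (‖z'‖ * ‖x'‖) := s1'
      _ ≤ 2 * ((2 * Z0) * (2 * X0)) := by gcongr
      _ = _ := by ring
  have w2 : ‖y ^ 3 / x - y' ^ 3 / x'‖ ≤ 68 * Z0 * d := by
    have e1 : y ^ 3 / x - y' ^ 3 / x' = (y - y') * (y ^ 2 + y * y' + y' ^ 2) / x + (y' ^ 3 / x') * ((x' - x) / x) := by
      field_simp; ring
    rw [e1]
    refine (norm_add_le _ _).trans ?_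
    have t1 : ‖(y - y') * (y ^ 2 + y * y' + y' ^ 2) / x‖ ≤ 48 * Z0 * d := by
      rw [norm_div, norm_mul, div_le_iff₀ hxp]
      have : ‖y ^ 2 + y * y' + y' ^ 2‖ ≤ 24 * (Z0 * X0) := by
        refine (norm_add₃_le).trans ?_
        rw [norm_mul, norm_pow, norm_pow]
        nlinarith [sq_nonneg (‖y‖ - ‖y'‖)]
      calc _ ≤ d * (24 * (Z0 * X0)) := by gcongr
        _ = 48 * Z0 * d * (X0 / 2) := by ring
        _ ≤ _ := by gcongr
    have t2 : ‖(y' ^ 3 / x') * ((x' - x) / x)‖ ≤ 20 * Z0 * d := by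
      rw [norm_mul, norm_div (x' - x), norm_sub_rev]
      calc _ ≤ 10 * Z0 ^ 2 * (d / (X0 / 2)) := by gcongr
        _ = 20 * Z0 * d * (Z0 / X0) := by field_simp; ring
        _ ≤ 20 * Z0 * d * 1 := by
          gcongr
          rw [div_le_one hX]; exact hZX
        _ = _ := by ring
    linarith
  have w3 : ‖z ^ 2 - z' ^ 2‖ ≤ 4 * Z0 * d := by
    rw [show z ^ 2 - z' ^ 2 = (z + z') * (z - z') by ring, norm_mul]
    have := norm_add_le z z'
    gcongr
    linarith
  have w4 : ‖z ^ 2‖ ≤ 4 * Z0 ^ 2 := by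
    rw [norm_pow]
    calc _ ≤ (2 * Z0) ^ 2 := by gcongr
      _ = _ := by ring
  have e2 : ((α:ℂ) * z ^ 2 + (β:ℂ) * (y ^ 3 / x)) - ((α':ℂ) * z' ^ 2 + (β':ℂ) * (y' ^ 3 / x')) =
      (((α - α' : ℝ):ℂ) * z ^ 2 + (α':ℂ) * (z ^ 2 - z' ^ 2)) +
      (((β - β' : ℝ):ℂ) * (y ^ 3 / x) + (β':ℂ) * (y ^ 3 / x - y' ^ 3 / x')) := by
    push_cast; ring
  rw [e2]
  have n1 : ‖((α - α' : ℝ):ℂ) * z ^ 2‖ ≤ e * (4 * Z0 ^ 2) := by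
    rw [norm_mul, Complex.norm_real, Real.norm_eq_abs]; gcongr
  have n2 : ‖(α':ℂ) * (z ^ 2 - z' ^ 2)‖ ≤ 4/3 * (4 * Z0 * d) := by
    rw [norm_mul, Complex.norm_real, Real.norm_eq_abs]; gcongr
  have n3 : ‖((β - β' : ℝ):ℂ) * (y ^ 3 / x)‖ ≤ e * (10 * Z0 ^ 2) := by
    rw [norm_mul, Complex.norm_real, Real.norm_eq_abs]; gcongr
  have n4 : ‖(β':ℂ) * (y ^ 3 / x - y' ^ 3 / x')‖ ≤ 4/3 * (68 * Z0 * d) := by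
    rw [norm_mul, Complex.norm_real, Real.norm_eq_abs]; gcongr
  have hZd : 0 ≤ Z0 * d := by positivity
  refine (norm_add_le _ _).trans ?_
  have := norm_add_le (((α - α' : ℝ):ℂ) * z ^ 2) ((α':ℂ) * (z ^ 2 - z' ^ 2))
  have := norm_add_le (((β - β' : ℝ):ℂ) * (y ^ 3 / x)) ((β':ℂ) * (y ^ 3 / x - y' ^ 3 / x'))
  linarith

theorem afun_lip : ∃ K : ℝ, 0 < K ∧ ∀ p : CC, p ≠ 0 → ∃ s ∈ 𝓝 p, ∀ q ∈ s, ∀ q' ∈ s,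
    |afun q - afun q'| * ‖p‖ ≤ K * ‖q - q'‖ := by
  obtain ⟨K, hK, h⟩ := homog_lip (Φ := afun) (Ω := univ) 0 isClosed_univ (fun _ _ _ _ => mem_univ _)
    (fun p t ht => by rw [afun_homog p ht]; simp) (fun p _ hp => afun_LL hp)
  refine ⟨K, hK, fun p hp => ?_⟩
  obtain ⟨-, s, hs, H⟩ := h p (mem_univ _) hp
  refine ⟨s, hs, fun q hq q' hq' => ?_⟩
  have := H q hq q' hq'
  rw [pow_zero, mul_one, Real.norm_eq_abs] at this
  exact this

section
variable {A A' : Set CC} {b c b' c' : ℝ} {s t s' t' : ℝ → ℝ} {p : CC}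

theorem lipa_cont {s : ℝ → ℝ} (sl : ∀ a a', 1/2 ≤ a → a ≤ 1 → 1/2 ≤ a' → a' ≤ 1 → |s a - s a'| ≤ 2 * |a - a'|)
    (hp : p ≠ 0) : ContinuousAt (fun q => ((s (afun q) : ℝ) : ℂ)) p := by
  have ha := (afun_LL hp).ca
  refine Complex.continuous_ofReal.continuousAt.comp (f := fun q => s (afun q)) ?_
  rw [ContinuousAt, tendsto_iff_norm_sub_tendsto_zero]
  refine squeeze_zero (fun _ => norm_nonneg _) (g := fun q => 2 * |afun q - afun p|) ?_ ?_
  · intro q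
    exact sl _ _ (afun_mem q).1 (afun_mem q).2 (afun_mem p).1 (afun_mem p).2
  · have : ContinuousAt (fun q => 2 * |afun q - afun p|) p := by fun_prop
    simpa using this.tendsto

theorem Side.Wcont (S : Side A b c s t) (hp : p ≠ 0) : ContinuousAt (Wf s t) p := by
  unfold Wf
  have h1 := lipa_cont S.sl hp
  have h2 := lipa_cont S.tl hp
  fun_prop

set_option maxHeartbeats 1000000 in
theorem Side.fxlip (S : Side A b c s t) (S' : Side A' b' c' s' t') : ∃ M : ℝ, 0 < M ∧ ∀ p ∈ A, ‖p‖ < eps2 →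
    ‖p.2.2‖ < ‖p.1‖ → 9/10 * ‖p.2.1 ^ 3‖ < ‖Wf s t p‖ → LipAt M A (Fx s t s' t') p := by
  obtain ⟨K0, hK0, haf⟩ := afun_lip
  refine ⟨1 + 2 * (14 * (8 * K0) + 100), by positivity, ?_⟩
  intro p hp hn h hW
  obtain ⟨hz, hy3, hA1, hA2⟩ := S.out S' hp hn h hW.le
  have hx0 : 0 < ‖p.1‖ := (norm_nonneg _).trans_lt h
  have hx : p.1 ≠ 0 := norm_pos_iff.1 hx0
  have hz0 : 0 < ‖p.2.2‖ := norm_pos_iff.2 hz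
  have hp0 : p ≠ 0 := by rintro rfl; exact hx rfl
  obtain ⟨g1, g2⟩ := csq_norm hA1 hA2
  set g : CC → ℂ := fun q => q.2.2 * csq (Aco s t s' t' q) with hg
  have cA : ContinuousAt (Aco s t s' t') p := by
    unfold Aco Nco
    have h1 := lipa_cont S.sl hp0
    have h2 := lipa_cont S.tl hp0
    have h3 := lipa_cont S'.sl hp0
    have h4 := lipa_cont S'.tl hp0
    refine ContinuousAt.div (h1.add ((h2.sub h4).mul (ContinuousAt.div (by fun_prop) (by fun_prop) ?_))) h3 (S'.s'0 p)
    exact mul_ne_zero (pow_ne_zero _ hz) hx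
  have cg : ContinuousAt g p := by
    have : ContinuousAt csq (Aco s t s' t' p) := (csq_LL (by linarith)).ca
    refine ContinuousAt.mul (by fun_prop) ?_
    exact ContinuousAt.comp (f := Aco s t s' t') (g := csq) this cA
  have hg0 : ‖p.2.2‖ / 2 ≤ ‖g p‖ := by
    simp only [hg]; rw [norm_mul]; nlinarith
  have hgp : 0 < ‖g p‖ := by linarith
  obtain ⟨U, hU, HU⟩ := haf p hp0
  have ev : ∀ᶠ q in 𝓝 p, ‖q‖ < eps2 ∧ ‖q.2.2‖ < ‖q.1‖ ∧ 9/10 * ‖q.2.1 ^ 3‖ < ‖Wf s t q‖ ∧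
      ‖g q - g p‖ < ‖g p‖ / 2 ∧ ‖q.2.2‖ < 2 * ‖p.2.2‖ ∧ ‖p.1‖ / 2 < ‖q.1‖ ∧ ‖q.1‖ < 2 * ‖p.1‖ := by
    have cW := S.Wcont hp0
    have c1 : ContinuousAt (fun q : CC => ‖q.1‖) p := by fun_prop
    have c3 : ContinuousAt (fun q : CC => ‖q.2.2‖) p := by fun_prop
    refine (ContinuousAt.eventually_lt (f := fun q : CC => ‖q‖) (by fun_prop) continuousAt_const hn).and ?_
    refine (c3.eventually_lt c1 h).and ?_
    refine (ContinuousAt.eventually_lt (f := fun q : CC => 9/10 * ‖q.2.1 ^ 3‖) (by fun_prop) cW.norm hW).and ?_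
    refine (ContinuousAt.eventually_lt (f := fun q : CC => ‖g q - g p‖) ((cg.sub continuousAt_const).norm) continuousAt_const (by simpa using hgp)).and ?_
    refine (c3.eventually_lt continuousAt_const (by linarith)).and ?_
    exact (ContinuousAt.eventually_lt continuousAt_const c1 (by linarith)).and (c1.eventually_lt continuousAt_const (by linarith))
  refine ⟨_, inter_mem (mem_nhdsWithin_of_mem_nhds (inter_mem hU ev)) self_mem_nhdsWithin, ?_⟩
  rintro q ⟨⟨qU, q1, q2, q3, q4, q5, q6, q7⟩, qA⟩ q' ⟨⟨qU', q1', q2', q3', q4', q5', q6', q7'⟩, qA'⟩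
  obtain ⟨z1, y1, B1, -⟩ := S.out S' qA q1 q2 q3.le
  obtain ⟨z1', y1', B1', -⟩ := S.out S' qA' q1' q2' q3'.le
  have sqg : ∀ q : CC, q.1 ≠ 0 → q.2.2 ≠ 0 → 1/4 ≤ (Aco s t s' t' q).re → g q ^ 2 =
      ((s (afun q) / s' (afun q) : ℝ) : ℂ) * q.2.2 ^ 2 +
      (((t (afun q) - t' (afun q)) / s' (afun q) : ℝ) : ℂ) * (q.2.1 ^ 3 / q.1) := by
    intro q hx hz hB
    simp only [hg]
    rw [mul_pow, csq_sq (re_ne (by linarith)), Aco, Nco]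
    have := S'.s'0 q
    push_cast
    field_simp
  have x1 : q.1 ≠ 0 := norm_pos_iff.1 (by linarith)
  have x1' : q'.1 ≠ 0 := norm_pos_iff.1 (by linarith)
  have m1 := HU q qU q' qU'
  obtain ⟨d1, d2, d3⟩ := CC.le (q - q')
  set d := ‖q - q'‖ with hd
  have d0 : 0 ≤ d := norm_nonneg _
  obtain ⟨a1, a2⟩ := afun_mem q
  obtain ⟨a1', a2'⟩ := afun_mem q'
  obtain ⟨sb1, sb2⟩ := S.sb _ a1 a2
  obtain ⟨sb1', sb2'⟩ := S.sb _ a1' a2'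
  obtain ⟨tb1, tb2⟩ := S.tb _ a1 a2
  obtain ⟨tb1', tb2'⟩ := S.tb _ a1' a2'
  obtain ⟨ub1, ub2⟩ := S'.sb _ a1 a2
  obtain ⟨ub1', ub2'⟩ := S'.sb _ a1' a2'
  obtain ⟨vb1, vb2⟩ := S'.tb _ a1 a2
  obtain ⟨vb1', vb2'⟩ := S'.tb _ a1' a2'
  have l1 := S.sl _ _ a1 a2 a1' a2'
  have l2 := S.tl _ _ a1 a2 a1' a2'
  have l3 := S'.sl _ _ a1 a2 a1' a2'
  have l4 := S'.tl _ _ a1 a2 a1' a2'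
  have sg := sqg q x1 z1 B1
  have sg' := sqg q' x1' z1' B1'
  set a := afun q
  set a' := afun q'
  set e := |a - a'| with he
  have e0 : 0 ≤ e := abs_nonneg _
  have k1 : |s a / s' a - s a' / s' a'| ≤ 8 * e :=
    quot_lip ub1 ub2 ub1' ub2' (by rw [abs_of_nonneg (by linarith)]; exact sb2') (by linarith) l3
  have k2 : |(t a - t' a) / s' a - (t a' - t' a') / s' a'| ≤ 8 * e := by
    refine quot_lip ub1 ub2 ub1' ub2' (by rw [abs_le]; constructor <;> linarith) ?_ l3
    rw [show t a - t' a - (t a' - t' a') = (t a - t a') - (t' a - t' a') by ring]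
    exact (abs_sub _ _).trans (by linarith)
  have k3 : |s a' / s' a'| ≤ 4/3 := by
    rw [abs_of_nonneg (by positivity), div_le_iff₀ (by linarith)]; linarith
  have k4 : |(t a' - t' a') / s' a'| ≤ 4/3 := by
    rw [abs_div, abs_of_nonneg (by linarith : 0 ≤ s' a'), div_le_iff₀ (by linarith), abs_le]; constructor <;> linarith
  have main := core_lip hz0 h.le q5.le q5'.le q6.le q7.le q6'.le q7'.le (norm_pos_iff.2 z1) (norm_pos_iff.2 z1')
    q2.le q2'.le y1 y1' d1 d2 d3 k3 k4 k1 k2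
  rw [← sg, ← sg'] at main
  have eZ : e * ‖p.2.2‖ ≤ K0 * d := le_trans (by gcongr; exact (CC.le p).2.2) m1
  have main2 : ‖g q ^ 2 - g q' ^ 2‖ ≤ (14 * (8 * K0) + 100) * d * ‖p.2.2‖ := by
    refine main.trans ?_
    have : 14 * (8 * e) * ‖p.2.2‖ ^ 2 = 14 * 8 * (e * ‖p.2.2‖) * ‖p.2.2‖ := by ring
    rw [this]
    have : 14 * 8 * (e * ‖p.2.2‖) * ‖p.2.2‖ ≤ 14 * 8 * (K0 * d) * ‖p.2.2‖ := by gcongr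
    linarith
  have sum : ‖p.2.2‖ / 2 ≤ ‖g q + g q'‖ := by
    have e1 : 2 * g p = (g q + g q') - ((g q - g p) + (g q' - g p)) := by ring
    have e2 : 2 * ‖g p‖ ≤ ‖g q + g q'‖ + (‖g q - g p‖ + ‖g q' - g p‖) := by
      have : ‖2 * g p‖ = 2 * ‖g p‖ := by simp
      rw [← this, e1]
      exact (norm_sub_le _ _).trans (by gcongr; exact norm_add_le _ _)
    linarith
  have fin : ‖g q - g q'‖ ≤ 2 * (14 * (8 * K0) + 100) * d := by
    have e1 : g q ^ 2 - g q' ^ 2 = (g q + g q') * (g q - g q') := by ring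
    rw [e1, norm_mul] at main2
    have e2 : ‖p.2.2‖ / 2 * ‖g q - g q'‖ ≤ ‖g q + g q'‖ * ‖g q - g q'‖ := by gcongr
    have e3 : ‖p.2.2‖ * ‖g q - g q'‖ ≤ ‖p.2.2‖ * (2 * (14 * (8 * K0) + 100) * d) := by linarith
    exact le_of_mul_le_mul_left e3 hz0
  have big : d ≤ (1 + 2 * (14 * (8 * K0) + 100)) * d := by
    have : 0 ≤ 2 * (14 * (8 * K0) + 100) * d := by positivity
    linarith
  refine CC.norm_le (d1.trans big) (d2.trans big) ?_
  show ‖g q - g q'‖ ≤ _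
  linarith
end

open Classical in
def XM (b c b' c' : ℝ) (s t s' t' : ℝ → ℝ) (K : ℝ → ℂ → ℂ) (p : CC) : CC :=
  if ‖p.1‖ ≤ ‖p.2.2‖ then p else
    if ‖Wf s t p‖ < 95/100 * ‖p.2.1 ^ 3‖ then DiscM b c b' c' K p else Fx s t s' t' p

section
variable {A A' : Set CC} {b c b' c' : ℝ} {s t s' t' : ℝ → ℝ} {p : CC}

theorem lip_congr {M : ℝ} {A : Set CC} {f g : CC → CC} {p : CC} (h : LipAt M A g p)
    (he : ∀ᶠ q in 𝓝 p, q ∈ A → f q = g q) : LipAt M A f p := by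
  obtain ⟨u, hu, H⟩ := h
  refine ⟨_, inter_mem hu (inter_mem (mem_nhdsWithin_of_mem_nhds he) self_mem_nhdsWithin), ?_⟩
  rintro q ⟨h1, h2, h3⟩ q' ⟨h1', h2', h3'⟩
  rw [h2 h3, h2' h3']
  exact H q h1 q' h1'

theorem lip_up {M M' : ℝ} {A : Set CC} {f : CC → CC} {p : CC} (h : LipAt M A f p) (hM : M ≤ M') : LipAt M' A f p := by
  obtain ⟨u, hu, H⟩ := h
  exact ⟨u, hu, fun q hq q' hq' => (H q hq q' hq').trans (by gcongr)⟩

theorem lip_id {A : Set CC} {p : CC} : LipAt 1 A (fun q => q) p :=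
  ⟨univ, univ_mem, fun q _ q' _ => by simp⟩

set_option maxHeartbeats 1000000 in
theorem Side.half (S : Side A b c s t) (S' : Side A' b' c' s' t') {K L : ℝ → ℂ → ℂ} (k : KP b b' K L)
    (k' : KP b' b L K) :
    ∃ M ε, Half A A' (XM b c b' c' s t s' t' K) (XM b' c' b c s' t' s t L) M ε := by
  obtain ⟨M1, hM1, L1⟩ := Disc_lip S.cn.1 S.cn.2 S'.cn.1 S'.cn.2 k S.bn S'.bn
  obtain ⟨M2, hM2, L2⟩ := S.fxlip S'
  refine ⟨16 + M1 + M2, eps2, by positivity, eps2_pos, ?_⟩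
  intro p hp hn
  have hnx : ‖p.1‖ < eps2 := (CC.le p).1.trans_lt hn
  have hpn := norm_nonneg p
  have up : ∀ r : ℝ, r ≤ 16 → r * ‖p‖ ≤ (16 + M1 + M2) * ‖p‖ := fun r hr => by gcongr; linarith
  have part1 : XM b c b' c' s t s' t' K p ∈ A' ∧
      XM b' c' b c s' t' s t L (XM b c b' c' s t s' t' K p) = p ∧
      ‖XM b c b' c' s t s' t' K p‖ ≤ (16 + M1 + M2) * ‖p‖ := by
    by_cases h1 : ‖p.1‖ ≤ ‖p.2.2‖
    · have e : ∀ b c b' c' s t s' t' K, XM b c b' c' s t s' t' K p = p := by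
        intros; exact if_pos h1
      rw [e, e]
      refine ⟨(S'.inz p h1).2 ((S.inz p h1).1 hp), rfl, ?_⟩
      have := up 1 (by norm_num)
      linarith
    have h1l := not_le.1 h1
    by_cases h2 : ‖Wf s t p‖ < 95/100 * ‖p.2.1 ^ 3‖
    · have e : XM b c b' c' s t s' t' K p = DiscM b c b' c' K p := by
        rw [XM, if_neg h1, if_pos h2]
      rw [e]
      obtain ⟨hD, hWe, ha⟩ := S.disc hp hn h1l (h2.le.trans (by gcongr; norm_num))
      have hY : 0 < ‖p.2.1 ^ 3‖ := norm_pos_iff.2 (pow_ne_zero _ hD.y0)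
      have h95 : ‖hh b c p‖ < 95/100 := by
        rw [hWe] at h2; nlinarith
      obtain ⟨f1, f2, f3, f4⟩ := Disc_facts (c' := c') S.cc S'.cc k k' hD h95
      obtain ⟨b1, b2, b3⟩ := S'.back f1 f2 (by rw [f3]; exact hnx)
      refine ⟨b1, ?_, ?_⟩
      · rw [XM, if_neg (not_le.2 b2), if_pos b3, f4]
      · refine (Disc_norm (c' := c') S.cc k S'.bn S'.cn.2 hD h95 (hnx.trans eps2_one)).2.trans ?_
        refine le_trans ?_ (up 16 le_rfl)
        gcongr
        exact (CC.le p).1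
    · have e : XM b c b' c' s t s' t' K p = Fx s t s' t' p := by
        rw [XM, if_neg h1, if_neg h2]
      rw [e]
      have h2l := not_lt.1 h2
      obtain ⟨f1, f2, f3, f4, f5⟩ := S.fx S' hp hn h1l (by have := norm_nonneg (p.2.1 ^ 3); linarith)
      refine ⟨f1, ?_, f5.trans (up 2 (by norm_num))⟩
      rw [XM, if_neg (show ¬ ‖(Fx s t s' t' p).1‖ ≤ ‖(Fx s t s' t' p).2.2‖ from not_le.2 f2),
        if_neg (show ¬ ‖Wf s' t' (Fx s t s' t' p)‖ < 95/100 * ‖(Fx s t s' t' p).2.1 ^ 3‖ by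
          rw [f3]; exact h2), f4]
  refine ⟨part1.1, part1.2.1, part1.2.2, ?_⟩
  intro hp0
  have c1 : ContinuousAt (fun q : CC => ‖q.1‖) p := by fun_prop
  have c2 : ContinuousAt (fun q : CC => ‖q.2.1‖) p := by fun_prop
  have c3 : ContinuousAt (fun q : CC => ‖q.2.2‖) p := by fun_prop
  have evn : ∀ᶠ q : CC in 𝓝 p, ‖q‖ < eps2 :=
    ContinuousAt.eventually_lt (f := fun q : CC => ‖q‖) (by fun_prop) continuousAt_const hn
  rcases lt_trichotomy ‖p.1‖ ‖p.2.2‖ with h1 | h1 | h1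
  · refine lip_up (lip_congr lip_id ?_) (by linarith : (1:ℝ) ≤ 16 + M1 + M2)
    filter_upwards [c1.eventually_lt c3 h1] with q hq _
    exact if_pos hq.le
  · refine lip_up (lip_congr lip_id ?_) (by linarith : (1:ℝ) ≤ 16 + M1 + M2)
    obtain ⟨l1, l2⟩ := S.loc hp hn h1.ge
    have hx0 : 0 < ‖p.1‖ := by
      by_contra hc
      have hx : ‖p.1‖ = 0 := le_antisymm (not_lt.1 hc) (norm_nonneg _)
      have : ‖p‖ ≤ 0 := CC.norm_le hx.le (by linarith) (by linarith)
      exact hp0 (norm_le_zero_iff.1 this)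
    have h8 : ‖p.1‖ < 8 * ‖p.2.1‖ := by
      by_contra hc
      have := l2 (not_lt.1 hc)
      linarith
    have c28 : ContinuousAt (fun q : CC => 8 * ‖q.2.1‖) p := by fun_prop
    filter_upwards [evn, c1.eventually_lt c28 h8, c3.eventually_lt c28 (by linarith)] with q q1 q2 q3 qA
    by_cases g1 : ‖q.1‖ ≤ ‖q.2.2‖
    · exact if_pos g1
    have g1l := not_le.1 g1
    have g2 : ¬ ‖Wf s t q‖ < 95/100 * ‖q.2.1 ^ 3‖ := by
      intro g2
      have := (S.small qA q1 g1l (g2.le.trans (by gcongr; norm_num))).2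
      linarith [norm_nonneg q.2.1]
    rw [XM, if_neg g1, if_neg g2]
    refine S.aone S' (afun_one ?_ (max_le q2.le q3.le))
    intro hy
    rw [hy, norm_zero] at q2
    linarith [norm_nonneg q.1]
  · have hx0 : 0 < ‖p.1‖ := (norm_nonneg _).trans_lt h1
    have cW := S.Wcont hp0
    by_cases h2 : ‖Wf s t p‖ < 95/100 * ‖p.2.1 ^ 3‖
    · obtain ⟨hD, hWe, ha⟩ := S.disc hp hn h1 (h2.le.trans (by gcongr; norm_num))
      have hY : 0 < ‖p.2.1 ^ 3‖ := norm_pos_iff.2 (pow_ne_zero _ hD.y0)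
      have h95 : ‖hh b c p‖ < 95/100 := by
        rw [hWe] at h2; nlinarith
      obtain ⟨u, hu, H⟩ := L1 p hD h95 (hnx.trans eps2_one)
      have ev : ∀ᶠ q in 𝓝 p, ‖Wf s t q‖ < 95/100 * ‖q.2.1 ^ 3‖ :=
        cW.norm.eventually_lt (g := fun q : CC => 95/100 * ‖q.2.1 ^ 3‖) (by fun_prop) h2
      have hall := evn.and (ev.and (c3.eventually_lt c1 h1))
      have hl : LipAt M1 A (DiscM b c b' c' K) p := by
        refine ⟨_, inter_mem (mem_nhdsWithin_of_mem_nhds (inter_mem hu hall)) self_mem_nhdsWithin, ?_⟩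
        rintro q ⟨⟨q1, q2, q3, q4⟩, qA⟩ q' ⟨⟨q1', q2', q3', q4'⟩, qA'⟩
        exact H q q1 q' q1' (S.disc qA q2 q4 (q3.le.trans (by gcongr; norm_num))).1
          (S.disc qA' q2' q4' (q3'.le.trans (by gcongr; norm_num))).1
      refine lip_up (lip_congr hl ?_) (by linarith)
      filter_upwards [hall] with q hq _
      rw [XM, if_neg (not_le.2 hq.2.2), if_pos hq.2.1]
    · have h2l := not_lt.1 h2
      have h9 : 9/10 * ‖p.2.1 ^ 3‖ < ‖Wf s t p‖ := by
        by_cases hy : p.2.1 = 0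
        · have := norm_pos_iff.2 (S.wy0 hp hn h1 hy)
          rw [hy]; simpa using this
        · have hY : 0 < ‖p.2.1 ^ 3‖ := norm_pos_iff.2 (pow_ne_zero _ hy)
          linarith
      refine lip_up (lip_congr (L2 p hp hn h1 h9) ?_) (by linarith)
      have ev : ∀ᶠ q in 𝓝 p, 9/10 * ‖q.2.1 ^ 3‖ < ‖Wf s t q‖ :=
        ContinuousAt.eventually_lt (f := fun q : CC => 9/10 * ‖q.2.1 ^ 3‖) (by fun_prop) cW.norm h9
      filter_upwards [evn, ev, c3.eventually_lt c1 h1] with q q1 q2 q3 qA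
      rw [XM, if_neg (not_le.2 q3)]
      split_ifs with g
      · exact S.match S' k qA q1 q3 q2.le (g.le.trans (by gcongr; norm_num))
      · rfl
end

theorem Xstep : GermEq (Sset az) (Sset afun) := by
  obtain ⟨K, L, k, k'⟩ := exists_KP
  have k1 : KP ((0:ℝ):ℂ) ((1/3:ℝ):ℂ) K L := by
    push_cast; exact k
  have k2 : KP ((1/3:ℝ):ℂ) ((0:ℝ):ℂ) L K := by
    push_cast; exact k'
  exact ⟨_, _, side_one.half side_two k1 k2, side_two.half side_one k2 k1⟩

end Work

/-- The two superisolated singularities `(X₁,0)` and `(X₂,0)` of Theorem 1.2 (ii) are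
inner bilipschitz equivalent. -/
theorem XOne_XTwo_inner_bilipschitz_equivalent :
    InnerBilipschitzEquiv XOne XTwo := by
  exact GermEq.inner (by simp [XOne])
    (XOne_germ.trans (Zstep.trans (Xstep.trans (S2step.trans XTwo_germ.symm))))
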